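/- Let C = {v, w} be a mild contour from x to y in a ray category P such that v⃗ is transit, with v = v_1⋯v_n, w = w_1⋯w_m, α = v⃗_1, β = w⃗_1, γ = v⃗_2⋯v⃗_n, and ρ = π(y) = αω where ω is not an identity. Then γ does not factor as γ = ωξ for any morphism ξ. -/

import Mathlib

set_option autoImplicit false

/-- A ray category (Bautista–Gabriel–Roiter–Salmerón).  The fields `pipow x`
record the powers of the generator `π(x)` of the radical of `P(x,x)`. -/
structure RayCategory : Type 1 where
  Obj : Type
  Hom : Obj → Obj → Type
  id : ∀ x : Obj, Hom x x
  comp : ∀ {x y z : Obj}, Hom y z → Hom x y → Hom x z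
  zero : ∀ x y : Obj, Hom x y
  comp_id : ∀ {x y : Obj} (f : Hom x y), comp f (id x) = f
  id_comp : ∀ {x y : Obj} (f : Hom x y), comp (id y) f = f
  assoc : ∀ {x y z w : Obj} (h : Hom z w) (g : Hom y z) (f : Hom x y),
      comp (comp h g) f = comp h (comp g f)
  /-- axiom b : zero morphisms -/
  zero_comp : ∀ {x y z : Obj} (f : Hom x y), comp (zero y z) f = zero x z
  comp_zero : ∀ {x y z : Obj} (f : Hom y z), comp f (zero x y) = zero x z
  /-- axiom a : the objects are pairwise non-isomorphic -/
  no_iso : ∀ {x y : Obj} (f : Hom x y) (g : Hom y x),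
      comp g f = id x → comp f g = id y → x = y
  /-- axiom c : local finiteness -/
  finite_target : ∀ x : Obj, {y : Obj | ∃ f : Hom x y, f ≠ zero x y}.Finite
  finite_source : ∀ x : Obj, {y : Obj | ∃ f : Hom y x, f ≠ zero y x}.Finite
  /-- the powers of the generator `π(x)` of `P(x,x)`; `pipow x 1 = π(x)`. -/
  pipow : ∀ x : Obj, ℕ → Hom x x
  pipow_zero : ∀ x, pipow x 0 = id x
  pipow_succ : ∀ x n, pipow x (n + 1) = comp (pipow x 1) (pipow x n)
  nilp : Obj → ℕ
  nilp_pos : ∀ x, 1 ≤ nilp x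
  /-- axiom d : `P(x,x) = {id, σ, …, σ^{n-1} ≠ 0 = σ^n}` -/
  endo_cyclic : ∀ (x : Obj) (f : Hom x x), ∃ i : ℕ, f = pipow x i
  pipow_nilp : ∀ x, pipow x (nilp x) = zero x x
  pipow_nilp_ne : ∀ x, pipow x (nilp x - 1) ≠ zero x x
  /-- axiom e : `P(x,y)` is cyclic under the action of `P(x,x)` or of `P(y,y)` -/
  hom_cyclic : ∀ x y : Obj, ∃ g : Hom x y,
      (∀ f : Hom x y, ∃ i : ℕ, f = comp (pipow y i) g) ∨
      (∀ f : Hom x y, ∃ i : ℕ, f = comp g (pipow x i))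
  /-- axiom f : cancellation -/
  cancel : ∀ {x y z w : Obj} (kappa : Hom x y) (mu nu : Hom y z) (lam : Hom z w),
      comp lam (comp mu kappa) = comp lam (comp nu kappa) →
      comp lam (comp mu kappa) ≠ zero x w → mu = nu

namespace RayCategory

variable (P : RayCategory)

/-- the generator of the radical of `P(x,x)` -/
def pi (x : P.Obj) : P.Hom x x := P.pipow x 1

/-- powers of an endomorphism -/
def pow {x : P.Obj} (f : P.Hom x x) : ℕ → P.Hom x x
  | 0 => P.id x
  | n + 1 => P.comp f (pow f n)

/-- `f` is an identity morphism -/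
def IsId {x y : P.Obj} (f : P.Hom x y) : Prop := ∃ _ : x = y, HEq f (P.id x)

/-- irreducible morphisms (= arrows of the quiver of `P`): nonzero morphisms which are
not identities and cannot be written as a product of two non-identity morphisms -/
def IsIrreducible {x y : P.Obj} (f : P.Hom x y) : Prop :=
  f ≠ P.zero x y ∧ ¬ P.IsId f ∧
    ∀ (z : P.Obj) (g : P.Hom z y) (h : P.Hom x z), f = P.comp g h → P.IsId g ∨ P.IsId h

/-- irreducibility inside the full subcategory supported by `S` -/
def IsIrreducibleOn (S : Set P.Obj) {x y : P.Obj} (f : P.Hom x y) : Prop :=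
  f ≠ P.zero x y ∧ ¬ P.IsId f ∧
    ∀ z ∈ S, ∀ (g : P.Hom z y) (h : P.Hom x z), f = P.comp g h → P.IsId g ∨ P.IsId h

/-- the sub-bimodule `P(y,y) μ P(x,x)` of `P(x,y)` generated by `μ` -/
def Bimod {x y : P.Obj} (mu : P.Hom x y) : Set (P.Hom x y) :=
  {f | ∃ i j : ℕ, f = P.comp (P.pipow y i) (P.comp mu (P.pipow x j))}

/-- `μ` is transit : the sub-bimodule generated by `μ` is cyclic over `P(y,y)` -/
def IsTransit {x y : P.Obj} (mu : P.Hom x y) : Prop :=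
  mu ≠ P.zero x y ∧
    ∃ g ∈ P.Bimod mu, ∀ f ∈ P.Bimod mu, ∃ i : ℕ, f = P.comp (P.pipow y i) g

/-- `μ` is cotransit : the sub-bimodule generated by `μ` is cyclic over `P(x,x)` -/
def IsCotransit {x y : P.Obj} (mu : P.Hom x y) : Prop :=
  mu ≠ P.zero x y ∧
    ∃ g ∈ P.Bimod mu, ∀ f ∈ P.Bimod mu, ∃ j : ℕ, f = P.comp g (P.pipow x j)

/-- `μ` is deep : `π(y)μ = 0 = μπ(x)` -/
def IsDeep {x y : P.Obj} (mu : P.Hom x y) : Prop :=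
  mu ≠ P.zero x y ∧ P.comp (P.pi y) mu = P.zero x y ∧ P.comp mu (P.pi x) = P.zero x y

/-- transport of a morphism along equalities of objects -/
def castHom {a b c d : P.Obj} (h1 : a = c) (h2 : b = d) (f : P.Hom a b) : P.Hom c d :=
  cast (by rw [h1, h2]) f

/-- the composite `a_{i+j-1} ⋯ a_{i+1} a_i : x_i → x_{i+j}` of a chain of morphisms -/
def chain (x : ℕ → P.Obj) (a : ∀ i : ℕ, P.Hom (x i) (x (i + 1))) (i : ℕ) :
    ∀ j : ℕ, P.Hom (x i) (x (i + j))
  | 0 => P.id (x i)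
  | j + 1 => P.comp (a (i + j)) (chain x a i j)

end RayCategory

/-- Paths in the quiver `Q_P` of a ray category `P` (the arrow `f` of `cons f hf p`
is the *last* arrow of the path). -/
inductive RPath (P : RayCategory) : P.Obj → P.Obj → Type
  | nil (x : P.Obj) : RPath P x x
  | cons {x y z : P.Obj} (f : P.Hom y z) (hf : P.IsIrreducible f) (p : RPath P x y) :
      RPath P x z

namespace RPath

variable {P : RayCategory}

/-- the morphism `v⃗` of `P` obtained by composing the arrows of a path `v` -/
def toHom : ∀ {x y : P.Obj}, RPath P x y → P.Hom x y
  | _, _, .nil x => P.id x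
  | _, _, .cons f _ p => P.comp f p.toHom

def length : ∀ {x y : P.Obj}, RPath P x y → ℕ
  | _, _, .nil _ => 0
  | _, _, .cons _ _ p => p.length + 1

/-- the set of points visited by a path -/
def points : ∀ {x y : P.Obj}, RPath P x y → Set P.Obj
  | _, _, .nil x => {x}
  | _, _, @RPath.cons _ _ _ z _ _ p => insert z p.points

/-- concatenation of paths -/
def append : ∀ {x y z : P.Obj}, RPath P y z → RPath P x y → RPath P x z
  | _, _, _, .nil _, p => p
  | _, _, _, .cons f hf q, p => .cons f hf (q.append p)

/-- the arrow `g` occurs in the path -/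
def HasArrow : ∀ {x y : P.Obj}, RPath P x y → ∀ {a b : P.Obj}, P.Hom a b → Prop
  | _, _, .nil _, _, _, _ => False
  | _, _, .cons f _ p, _, _, g => HEq f g ∨ p.HasArrow g

/-- one step of the interlacing relation: `v = p v' q`, `w = p w' q` with
`v⃗' = w⃗' ≠ 0` and `p`, `q` not both identities -/
def InterlaceStep {x y : P.Obj} (v w : RPath P x y) : Prop :=
  ∃ (a b : P.Obj) (p : RPath P b y) (v' w' : RPath P a b) (q : RPath P x a),
    v = p.append (v'.append q) ∧ w = p.append (w'.append q) ∧
    v'.toHom = w'.toHom ∧ v'.toHom ≠ P.zero a b ∧ ¬ (p.length = 0 ∧ q.length = 0)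

/-- two paths are interlaced if they lie in the transitive closure of the relation above -/
def Interlaced {x y : P.Obj} (v w : RPath P x y) : Prop :=
  Relation.TransGen (fun v' w' : RPath P x y => InterlaceStep v' w') v w

end RPath

/-- a chain of arrows as a path -/
def pchain (P : RayCategory) (x : ℕ → P.Obj) (a : ∀ i : ℕ, P.Hom (x i) (x (i + 1)))
    (ha : ∀ i, P.IsIrreducible (a i)) (i : ℕ) : ∀ j : ℕ, RPath P (x i) (x (i + j))
  | 0 => .nil (x i)
  | j + 1 => .cons (a (i + j)) (ha (i + j)) (pchain P x a ha i j)

/-- A contour `C = {v,w}` of `P` from `x` to `y` : a pair of different, non-interlaced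
paths with `v⃗ = w⃗ ≠ 0`. -/
structure Contour (P : RayCategory) (x y : P.Obj) : Type where
  v : RPath P x y
  w : RPath P x y
  ne : v ≠ w
  hom_eq : v.toHom = w.toHom
  nz : v.toHom ≠ P.zero x y
  nint : ¬ RPath.Interlaced v w
/-- A module over the linearization `k(D/I)` of the quotient by the ideal generated by the
morphisms in `I` of the full subcategory of `P` supported by `D`:
a `k`-linear functor defined on the morphisms between points of `D`, vanishing on `I`.
For `D = Set.univ` and `I = fun _ _ _ => False` this is exactly a `k(P)`-module. -/
structure RMod (P : RayCategory) (k : Type) [Field k] (D : Set P.Obj)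
    (I : ∀ a b : P.Obj, P.Hom a b → Prop) where
  M : P.Obj → Type
  [acg : ∀ x, AddCommGroup (M x)]
  [mod : ∀ x, Module k (M x)]
  act : ∀ {x y : P.Obj}, P.Hom x y → (M x →ₗ[k] M y)
  act_id : ∀ x ∈ D, act (P.id x) = LinearMap.id
  act_comp : ∀ {x y z : P.Obj}, x ∈ D → y ∈ D → z ∈ D →
      ∀ (g : P.Hom y z) (f : P.Hom x y), act (P.comp g f) = (act g).comp (act f)
  act_zero : ∀ {x y : P.Obj}, x ∈ D → y ∈ D → act (P.zero x y) = 0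
  supp : ∀ x : P.Obj, x ∉ D → ∀ m : M x, m = 0
  killed : ∀ {a b : P.Obj} (f : P.Hom a b), I a b f → act f = 0

attribute [instance] RMod.acg RMod.mod

/-- morphisms of modules -/
structure RModHom {P : RayCategory} {k : Type} [Field k] {D : Set P.Obj}
    {I : ∀ a b : P.Obj, P.Hom a b → Prop} (M N : RMod P k D I) where
  app : ∀ x : P.Obj, M.M x →ₗ[k] N.M x
  natural : ∀ {x y : P.Obj} (f : P.Hom x y), (N.act f).comp (app x) = (app y).comp (M.act f)

/-- isomorphism of modules -/
def RModIso {P : RayCategory} {k : Type} [Field k] {D : Set P.Obj}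
    {I : ∀ a b : P.Obj, P.Hom a b → Prop} (M N : RMod P k D I) : Prop :=
  ∃ φ : RModHom M N, ∀ x, Function.Bijective (φ.app x)

namespace RMod

variable {P : RayCategory} {k : Type} [Field k] {D : Set P.Obj}
  {I : ∀ a b : P.Obj, P.Hom a b → Prop}

/-- finite-dimensional: the sum of the dimensions of all `M x` is finite -/
def FinDim (M : RMod P k D I) : Prop :=
  (∀ x, FiniteDimensional k (M.M x)) ∧ {x : P.Obj | ∃ m : M.M x, m ≠ 0}.Finite

def Nonzero (M : RMod P k D I) : Prop := ∃ x, ∃ m : M.M x, m ≠ 0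

/-- indecomposable: nonzero, and the only idempotent endomorphisms are `0` and `id` -/
def Indec (M : RMod P k D I) : Prop :=
  M.Nonzero ∧ ∀ e : RModHom M M, (∀ x, (e.app x).comp (e.app x) = e.app x) →
    (∀ x, e.app x = 0) ∨ (∀ x, e.app x = LinearMap.id)

end RMod

/-- the full subcategory supported by `D` of the quotient of `P` by the ideal generated
by `I` is (locally) representation-finite: for any field `k`, every point lies in the
support of only finitely many isomorphism classes of finite-dimensional indecomposables -/
def RepFin (P : RayCategory) (D : Set P.Obj) (I : ∀ a b : P.Obj, P.Hom a b → Prop) : Prop :=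
  ∀ (k : Type) [Field k], ∀ x : P.Obj,
    ∃ (ι : Type) (_ : Finite ι) (rep : ι → RMod P k D I),
      ∀ M : RMod P k D I, M.FinDim → M.Indec → (∃ m : M.M x, m ≠ 0) →
        ∃ i : ι, RModIso (rep i) M

/-- the trivial ideal -/
def RayCategory.noIdeal (P : RayCategory) : ∀ a b : P.Obj, P.Hom a b → Prop :=
  fun _ _ _ => False

/-- `P` is locally representation-finite -/
def LocRepFin (P : RayCategory) : Prop := RepFin P Set.univ P.noIdeal

/-- the ideal of `P` generated by the morphism `μ` -/
def IdealOf (P : RayCategory) {a b : P.Obj} (mu : P.Hom a b) :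
    ∀ s t : P.Obj, P.Hom s t → Prop :=
  fun s t f => ∃ (g : P.Hom b t) (h : P.Hom s a), f = P.comp g (P.comp mu h)

/-- an ideal of a ray category -/
structure RIdeal (P : RayCategory) where
  mem : ∀ a b : P.Obj, P.Hom a b → Prop
  zero_mem : ∀ a b : P.Obj, mem a b (P.zero a b)
  comp_mem_left : ∀ {a b c : P.Obj} (g : P.Hom b c) (f : P.Hom a b),
      mem a b f → mem a c (P.comp g f)
  comp_mem_right : ∀ {a b c : P.Obj} (g : P.Hom b c) (f : P.Hom a b),
      mem b c g → mem a c (P.comp g f)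

/-- `P` is minimal representation-infinite: not locally representation-finite, but every
proper quotient (quotient by an ideal containing a nonzero morphism) is locally
representation-finite -/
def MinRepInfinite (P : RayCategory) : Prop :=
  ¬ LocRepFin P ∧ ∀ J : RIdeal P,
    (∃ (a b : P.Obj) (f : P.Hom a b), f ≠ P.zero a b ∧ J.mem a b f) →
      RepFin P Set.univ J.mem

/-- support of the indecomposable projective module `P_x` over the quotient of `P` by `I` -/
def ProjSupp (P : RayCategory) (I : ∀ a b : P.Obj, P.Hom a b → Prop) (x : P.Obj) :
    Set P.Obj :=
  {y : P.Obj | ∃ f : P.Hom x y, f ≠ P.zero x y ∧ ¬ I x y f}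

/-- support of the indecomposable injective module `I_y` over the quotient of `P` by `I` -/
def InjSupp (P : RayCategory) (I : ∀ a b : P.Obj, P.Hom a b → Prop) (y : P.Obj) :
    Set P.Obj :=
  {z : P.Obj | ∃ f : P.Hom z y, f ≠ P.zero z y ∧ ¬ I z y f}

namespace Contour

variable {P : RayCategory} {x y : P.Obj} (C : Contour P x y)

/-- points of the contour = points of the full subcategory `P(C)` -/
def points : Set P.Obj := C.v.points ∪ C.w.points

/-- the contour is non-deep -/
def NonDeep : Prop := ¬ P.IsDeep C.v.toHom

/-- the ideal generated by `π(y)v⃗`, so that `P' = P/π(y)v⃗` (transit case) -/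
def It : ∀ a b : P.Obj, P.Hom a b → Prop := IdealOf P (P.comp (P.pi y) C.v.toHom)

/-- the ideal generated by `v⃗π(x)` (cotransit case) -/
def Ic : ∀ a b : P.Obj, P.Hom a b → Prop := IdealOf P (P.comp C.v.toHom (P.pi x))

/-- decisive subcategories of `P' = P/π(y)v⃗` for `C` (transit case) -/
def DecisiveT (D : Set P.Obj) : Prop :=
  x ∈ D ∧ y ∈ D ∧ D ⊆ ProjSupp P C.It x ∪ InjSupp P C.It y

/-- decisive subcategories (cotransit case) -/
def DecisiveC (D : Set P.Obj) : Prop :=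
  x ∈ D ∧ y ∈ D ∧ D ⊆ ProjSupp P C.Ic x ∪ InjSupp P C.Ic y

/-- mildness in the transit case: `C` is non-deep, `v⃗` is transit, and every decisive
full subcategory of `P/π(y)v⃗` with at most 4 points is representation-finite -/
def MildTransit : Prop :=
  C.NonDeep ∧ P.IsTransit C.v.toHom ∧
    ∀ D : Set P.Obj, C.DecisiveT D → D.Finite → D.ncard ≤ 4 → RepFin P D C.It

/-- mildness in the cotransit case (dual) -/
def MildCotransit : Prop :=
  C.NonDeep ∧ P.IsCotransit C.v.toHom ∧
    ∀ D : Set P.Obj, C.DecisiveC D → D.Finite → D.ncard ≤ 4 → RepFin P D C.Ic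

/-- a mild contour -/
def Mild : Prop := C.MildTransit ∨ C.MildCotransit

/-- equality of contours (with possibly different endpoints), as sets `{v,w}` -/
def Same {x' y' : P.Obj} (C' : Contour P x' y') : Prop :=
  ∃ (_ : x = x') (_ : y = y'),
    (HEq C.v C'.v ∧ HEq C.w C'.w) ∨ (HEq C.v C'.w ∧ HEq C.w C'.v)

end Contour
/-- the full subcategory on `{x,y}` is a dumb-bell with loops `lam`, `rho`, arrow `mu`
and nilpotency indices `r`, `s` -/
def DumbBellData (P : RayCategory) (x y : P.Obj) (lam : P.Hom x x) (mu : P.Hom x y)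
    (rho : P.Hom y y) (r s : ℕ) : Prop :=
  x ≠ y ∧
  P.IsIrreducibleOn {x, y} lam ∧ P.IsIrreducibleOn {x, y} mu ∧ P.IsIrreducibleOn {x, y} rho ∧
  (∀ a b : P.Obj, a ∈ ({x, y} : Set P.Obj) → b ∈ ({x, y} : Set P.Obj) →
      ∀ f : P.Hom a b, P.IsIrreducibleOn {x, y} f → HEq f lam ∨ HEq f mu ∨ HEq f rho) ∧
  P.comp mu lam = P.comp rho mu ∧
  P.pow lam r = P.zero x x ∧ P.pow rho s = P.zero y y ∧
  P.pow lam (r - 1) ≠ P.zero x x ∧ P.pow rho (s - 1) ≠ P.zero y y ∧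
  min r s = 3 ∧ max r s ≤ 5 ∧
  (∀ f : P.Hom x x, ∃ i : ℕ, f = P.pow lam i) ∧
  (∀ f : P.Hom y y, ∃ i : ℕ, f = P.pow rho i) ∧
  (∀ f : P.Hom x y, f = P.zero x y ∨ ∃ i : ℕ, f = P.comp mu (P.pow lam i)) ∧
  (∀ i : ℕ, i < min r s → P.comp mu (P.pow lam i) ≠ P.zero x y) ∧
  (∀ f : P.Hom y x, f = P.zero y x)

/-- the full subcategory supported by `S` is a dumb-bell -/
def IsDumbBellOn (P : RayCategory) (S : Set P.Obj) : Prop :=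
  ∃ (x y : P.Obj) (lam : P.Hom x x) (mu : P.Hom x y) (rho : P.Hom y y) (r s : ℕ),
    DumbBellData P x y lam mu rho r s ∧ S = {x, y}

/-- the full subcategory on the points `x 0, …, x (n-1)` is a penny-farthing with arrows
`a i` (`a i = α_{i+1} : x_i → x_{i+1}`, indices mod `n`) and loop `rho` at `x 0` -/
def PennyData (P : RayCategory) (n : ℕ) (x : ℕ → P.Obj)
    (a : ∀ i : ℕ, P.Hom (x i) (x (i + 1))) (rho : P.Hom (x 0) (x 0)) : Prop :=
  1 ≤ n ∧
  (∀ i, x (i + n) = x i) ∧ (∀ i, HEq (a (i + n)) (a i)) ∧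
  (∀ i j, i < n → j < n → x i = x j → i = j) ∧
  (∀ i, P.IsIrreducibleOn (Set.range x) (a i)) ∧
  P.IsIrreducibleOn (Set.range x) rho ∧
  (∀ b c : P.Obj, b ∈ Set.range x → c ∈ Set.range x → ∀ f : P.Hom b c,
      P.IsIrreducibleOn (Set.range x) f → HEq f rho ∨ ∃ i, i < n ∧ HEq f (a i)) ∧
  -- relation α₁αₙ = 0
  P.chain x a (n - 1) 2 = P.zero (x (n - 1)) (x (n - 1 + 2)) ∧
  -- relation αₙ⋯α₁ = ρ²
  (∀ h : x (0 + n) = x 0, P.castHom rfl h (P.chain x a 0 n) = P.comp rho rho) ∧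
  -- relations 0 = α_{e i}⋯α₁ ρ αₙ⋯α_{i+1} for a non-decreasing e : {1,…,n-1} → {1,…,n}
  ∃ e : ℕ → ℕ,
    (∀ i, 1 ≤ i → i ≤ n - 1 → 1 ≤ e i ∧ e i ≤ n) ∧
    (∀ i j, 1 ≤ i → i ≤ j → j ≤ n - 1 → e i ≤ e j) ∧
    (∀ i, 1 ≤ i → i ≤ n - 1 → ∀ h : x (i + (n - i)) = x 0,
      P.comp (P.chain x a 0 (e i))
        (P.comp rho (P.castHom rfl h (P.chain x a i (n - i)))) =
      P.zero (x i) (x (0 + e i)))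

/-- the full subcategory supported by `S` is a penny-farthing -/
def IsPennyFarthingOn (P : RayCategory) (S : Set P.Obj) : Prop :=
  ∃ (n : ℕ) (x : ℕ → P.Obj) (a : ∀ i : ℕ, P.Hom (x i) (x (i + 1))) (rho : P.Hom (x 0) (x 0)),
    PennyData P n x a rho ∧ S = Set.range x

/-- the full subcategory on `{x,z,t,y}` is a diamond with arrows
`gam : x → z`, `lam : z → x`, `del : x → t`, `bet : t → y`, `alp : z → y`, `kap : y → z` -/
def DiamondData (P : RayCategory) (x z t y : P.Obj) (gam : P.Hom x z) (lam : P.Hom z x)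
    (del : P.Hom x t) (bet : P.Hom t y) (alp : P.Hom z y) (kap : P.Hom y z) : Prop :=
  (x ≠ z ∧ x ≠ t ∧ x ≠ y ∧ z ≠ t ∧ z ≠ y ∧ t ≠ y) ∧
  P.IsIrreducibleOn {x, z, t, y} gam ∧ P.IsIrreducibleOn {x, z, t, y} lam ∧
  P.IsIrreducibleOn {x, z, t, y} del ∧ P.IsIrreducibleOn {x, z, t, y} bet ∧
  P.IsIrreducibleOn {x, z, t, y} alp ∧ P.IsIrreducibleOn {x, z, t, y} kap ∧
  (∀ a b : P.Obj, a ∈ ({x, z, t, y} : Set P.Obj) → b ∈ ({x, z, t, y} : Set P.Obj) →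
      ∀ f : P.Hom a b, P.IsIrreducibleOn {x, z, t, y} f →
        HEq f gam ∨ HEq f lam ∨ HEq f del ∨ HEq f bet ∨ HEq f alp ∨ HEq f kap) ∧
  P.comp alp gam = P.comp bet del ∧
  P.comp lam kap = P.zero y x ∧
  P.comp kap alp = P.comp gam lam

/-- the full subcategory supported by `S` is a diamond -/
def IsDiamondOn (P : RayCategory) (S : Set P.Obj) : Prop :=
  ∃ (x z t y : P.Obj) (gam : P.Hom x z) (lam : P.Hom z x) (del : P.Hom x t)
    (bet : P.Hom t y) (alp : P.Hom z y) (kap : P.Hom y z),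
    DiamondData P x z t y gam lam del bet alp kap ∧ S = {x, z, t, y}

notation:80 g:81 "⊙" f:80 => RayCategory.comp _ g f

namespace RayCategory

variable {P : RayCategory}

theorem isId_endo {x : P.Obj} {f : P.Hom x x} : P.IsId f ↔ f = P.id x :=
  ⟨fun ⟨_, h⟩ => eq_of_heq h, fun h => ⟨rfl, heq_of_eq h⟩⟩

theorem isId_id (x : P.Obj) : P.IsId (P.id x) := isId_endo.2 rfl

theorem pipow_add (x : P.Obj) (m n : ℕ) :
    P.pipow x (m + n) = P.pipow x m ⊙ P.pipow x n := by
  induction m with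
  | zero => rw [Nat.zero_add, P.pipow_zero, P.id_comp]
  | succ m ih => rw [Nat.add_right_comm, P.pipow_succ, ih, P.pipow_succ x m, P.assoc]

theorem pipow_comp_pipow (x : P.Obj) (m n : ℕ) :
    P.pipow x m ⊙ P.pipow x n = P.pipow x (m + n) := (pipow_add x m n).symm

theorem pipow_comp_pipow_comp {x z : P.Obj} (m n : ℕ) (f : P.Hom z x) :
    P.pipow x m ⊙ P.pipow x n ⊙ f = P.pipow x (m + n) ⊙ f := by
  rw [← P.assoc, pipow_comp_pipow]

theorem pipow_eq_zero {x : P.Obj} {n : ℕ} (h : P.nilp x ≤ n) : P.pipow x n = P.zero x x := by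
  obtain ⟨k, rfl⟩ := Nat.exists_eq_add_of_le' h
  rw [pipow_add, P.pipow_nilp, P.comp_zero]

theorem pipow_ne_zero_of_le {x : P.Obj} {m n : ℕ} (h : m ≤ n) (hn : P.pipow x n ≠ P.zero x x) :
    P.pipow x m ≠ P.zero x x := by
  obtain ⟨k, rfl⟩ := Nat.exists_eq_add_of_le' h
  intro h0
  rw [pipow_add, h0, P.comp_zero] at hn
  exact hn rfl

theorem id_ne_zero (x : P.Obj) : P.id x ≠ P.zero x x := by
  rw [← P.pipow_zero]
  exact pipow_ne_zero_of_le (Nat.zero_le _) (P.pipow_nilp_ne x)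

/-- If `π^i f = π^j f ≠ 0` then `i = j`. -/
theorem pipow_comp_inj {x z : P.Obj} {f : P.Hom z x} {i j : ℕ}
    (h : P.pipow x i ⊙ f = P.pipow x j ⊙ f) (h0 : P.pipow x i ⊙ f ≠ P.zero z x) : i = j := by
  have key : ∀ i d : ℕ, P.pipow x i ⊙ f = P.pipow x (d + 1 + i) ⊙ f →
      P.pipow x i ⊙ f = P.zero z x := by
    intro i d h
    have : ∀ k : ℕ, P.pipow x i ⊙ f = P.pipow x (k * (d + 1) + i) ⊙ f := by
      intro k
      induction k with
      | zero => rw [Nat.zero_mul, Nat.zero_add]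
      | succ k ih =>
        rw [Nat.succ_mul, Nat.add_assoc, pipow_add, P.assoc, ← h, ← P.assoc,
          ← pipow_add, ← ih]
    rw [this (P.nilp x), pipow_eq_zero (by nlinarith), P.zero_comp]
  rcases lt_trichotomy i j with hij | hij | hij
  · obtain ⟨d, rfl⟩ := Nat.exists_eq_add_of_lt hij
    exact absurd (key i d (by rw [h]; congr 2; omega)) h0
  · exact hij
  · obtain ⟨d, rfl⟩ := Nat.exists_eq_add_of_lt hij
    exact absurd (key j d (by rw [← h]; congr 2; omega)) (h ▸ h0)

/-- If `f π^i = f π^j ≠ 0` then `i = j`. -/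
theorem comp_pipow_inj {x z : P.Obj} {f : P.Hom x z} {i j : ℕ}
    (h : f ⊙ P.pipow x i = f ⊙ P.pipow x j) (h0 : f ⊙ P.pipow x i ≠ P.zero x z) : i = j := by
  have key : ∀ i d : ℕ, f ⊙ P.pipow x i = f ⊙ P.pipow x (i + (d + 1)) →
      f ⊙ P.pipow x i = P.zero x z := by
    intro i d h
    have : ∀ k : ℕ, f ⊙ P.pipow x i = f ⊙ P.pipow x (i + k * (d + 1)) := by
      intro k
      induction k with
      | zero => rw [Nat.zero_mul, Nat.add_zero]
      | succ k ih =>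
        rw [Nat.succ_mul, Nat.add_comm (k * (d + 1)), ← Nat.add_assoc, pipow_add, ← P.assoc, ← h,
          P.assoc, ← pipow_add, ← ih]
    rw [this (P.nilp x), pipow_eq_zero (by nlinarith), P.comp_zero]
  rcases lt_trichotomy i j with hij | hij | hij
  · obtain ⟨d, rfl⟩ := Nat.exists_eq_add_of_lt hij
    exact absurd (key i d (by rw [h]; congr 2)) h0
  · exact hij
  · obtain ⟨d, rfl⟩ := Nat.exists_eq_add_of_lt hij
    exact absurd (key j d (by rw [← h]; congr 2)) (h ▸ h0)

theorem pipow_inj {x : P.Obj} {i j : ℕ} (h : P.pipow x i = P.pipow x j)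
    (h0 : P.pipow x i ≠ P.zero x x) : i = j := by
  rw [← P.comp_id (P.pipow x i), ← P.comp_id (P.pipow x j)] at h
  rw [← P.comp_id (P.pipow x i)] at h0
  exact pipow_comp_inj h h0

theorem left_ne_zero {x y z : P.Obj} {g : P.Hom y z} {f : P.Hom x y}
    (h : g ⊙ f ≠ P.zero x z) : g ≠ P.zero y z := by
  rintro rfl; exact h (P.zero_comp f)

theorem right_ne_zero {x y z : P.Obj} {g : P.Hom y z} {f : P.Hom x y}
    (h : g ⊙ f ≠ P.zero x z) : f ≠ P.zero x y := by
  rintro rfl; exact h (P.comp_zero g)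

theorem cancel_left {x y z : P.Obj} {g : P.Hom y z} {f f' : P.Hom x y}
    (h : g ⊙ f = g ⊙ f') (h0 : g ⊙ f ≠ P.zero x z) : f = f' := by
  apply P.cancel (P.id x) f f' g
  · rwa [P.comp_id, P.comp_id]
  · rwa [P.comp_id]

theorem cancel_right {x y z : P.Obj} {g g' : P.Hom y z} {f : P.Hom x y}
    (h : g ⊙ f = g' ⊙ f) (h0 : g ⊙ f ≠ P.zero x z) : g = g' := by
  apply P.cancel f g g' (P.id z)
  · rwa [P.id_comp, P.id_comp]
  · rwa [P.id_comp]

/-- A morphism with a one-sided inverse is an identity. -/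
theorem isId_of_comp_eq_id {x y : P.Obj} {f : P.Hom x y} {g : P.Hom y x}
    (h : g ⊙ f = P.id x) : P.IsId f ∧ P.IsId g := by
  obtain ⟨i, hi⟩ := P.endo_cyclic y (f ⊙ g)
  have e : P.pipow y (i + i) = P.pipow y i := by
    rw [pipow_add, ← hi, P.assoc, ← P.assoc g, h, P.id_comp]
  have h0 : P.pipow y i ≠ P.zero y y := by
    intro h0
    have : g ⊙ (f ⊙ g) ⊙ f = P.id x := by rw [P.assoc, h, P.comp_id, h]
    rw [hi, h0, P.zero_comp, P.comp_zero] at this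
    exact id_ne_zero x this.symm
  have hi0 : i = 0 := by
    have := pipow_inj e (e ▸ h0); omega
  rw [hi0, P.pipow_zero] at hi
  obtain rfl := P.no_iso f g h hi
  obtain ⟨m, rfl⟩ := P.endo_cyclic x f
  obtain ⟨n, rfl⟩ := P.endo_cyclic x g
  rw [pipow_comp_pipow, ← P.pipow_zero] at h
  have := pipow_inj h (by rw [h, P.pipow_zero]; exact id_ne_zero x)
  have hm : m = 0 := by omega
  have hn : n = 0 := by omega
  subst hm hn
  simp only [P.pipow_zero]
  exact ⟨isId_id x, isId_id x⟩

theorem isId_of_comp_eq_self_left {x y : P.Obj} {f : P.Hom x y} {g : P.Hom y y}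
    (h : g ⊙ f = f) (h0 : f ≠ P.zero x y) : g = P.id y := by
  apply cancel_right (f := f)
  · rw [h, P.id_comp]
  · rwa [h]

theorem isId_of_comp_eq_self_right {x y : P.Obj} {f : P.Hom x y} {g : P.Hom x x}
    (h : f ⊙ g = f) (h0 : f ≠ P.zero x y) : g = P.id x := by
  apply cancel_left (g := f)
  · rw [h, P.comp_id]
  · rwa [h]

theorem isId_comp_iff {x y z : P.Obj} {f : P.Hom x y} {g : P.Hom y z} :
    P.IsId (g ⊙ f) ↔ P.IsId f ∧ P.IsId g := by
  constructor
  · intro h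
    obtain rfl := h.1
    exact isId_of_comp_eq_id (isId_endo.1 h)
  · rintro ⟨h1, h2⟩
    obtain rfl := h1.1
    obtain rfl := h2.1
    rw [isId_endo] at *
    rw [h1, h2, P.id_comp]

theorem finite_hom (x y : P.Obj) : Finite (P.Hom x y) := by
  obtain ⟨g, hg | hg⟩ := P.hom_cyclic x y
  · refine Finite.of_surjective
      (fun i : Fin (P.nilp y + 1) => P.pipow y i ⊙ g) fun f => ?_
    obtain ⟨i, rfl⟩ := hg f
    by_cases hi : i ≤ P.nilp y
    · exact ⟨⟨i, by omega⟩, rfl⟩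
    · exact ⟨⟨P.nilp y, by omega⟩, by
        simp only [P.pipow_nilp, pipow_eq_zero (le_of_not_ge hi)]⟩
  · refine Finite.of_surjective
      (fun i : Fin (P.nilp x + 1) => g ⊙ P.pipow x i) fun f => ?_
    obtain ⟨i, rfl⟩ := hg f
    by_cases hi : i ≤ P.nilp x
    · exact ⟨⟨i, by omega⟩, rfl⟩
    · exact ⟨⟨P.nilp x, by omega⟩, by
        simp only [P.pipow_nilp, pipow_eq_zero (le_of_not_ge hi)]⟩

end RayCategory

namespace RayCategory

variable {P : RayCategory}

/-- the nonzero multiples `g ⊙ h` of `h`, together with their targets -/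
def leftMultiples {x y : P.Obj} (h : P.Hom x y) : Set (Σ z : P.Obj, P.Hom x z) :=
  {k | k.2 ≠ P.zero x k.1 ∧ ∃ g : P.Hom y k.1, k.2 = g ⊙ h}

theorem finite_leftMultiples {x y : P.Obj} (h : P.Hom x y) : (leftMultiples h).Finite := by
  have : (⋃ z ∈ {z : P.Obj | ∃ f : P.Hom x z, f ≠ P.zero x z},
      Set.range (fun f : P.Hom x z => (⟨z, f⟩ : Σ z : P.Obj, P.Hom x z))).Finite := by
    refine Set.Finite.biUnion (P.finite_target x) fun z _ => ?_
    have := finite_hom x z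
    exact Set.finite_range _
  refine this.subset ?_
  rintro ⟨z, k⟩ ⟨hk, -⟩
  simp only [Set.mem_iUnion]
  exact ⟨z, ⟨k, hk⟩, k, rfl⟩

theorem leftMultiples_comp_ssubset {x y z : P.Obj} {g : P.Hom y z} {h : P.Hom x y}
    (hg : ¬ P.IsId g) (h0 : h ≠ P.zero x y) : leftMultiples (g ⊙ h) ⊂ leftMultiples h := by
  refine ⟨?_, fun hsub => hg ?_⟩
  · rintro ⟨t, k⟩ ⟨hk, u, hu⟩
    exact ⟨hk, u ⊙ g, hu.trans (P.assoc _ _ _).symm⟩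
  · have hm : (⟨y, h⟩ : Σ z : P.Obj, P.Hom x z) ∈ leftMultiples h :=
      ⟨h0, P.id y, (P.id_comp h).symm⟩
    obtain ⟨-, u, hu⟩ := hsub hm
    simp only at u hu
    rw [← P.assoc] at hu
    exact (isId_of_comp_eq_id (isId_of_comp_eq_self_left hu.symm h0)).1

/-- Every nonzero morphism is the composite of a path. -/
theorem exists_path {x y : P.Obj} (h : P.Hom x y) (h0 : h ≠ P.zero x y) :
    ∃ p : RPath P x y, p.toHom = h := by
  have key : ∀ n : ℕ, ∀ y (h : P.Hom x y), h ≠ P.zero x y →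
      (leftMultiples (P.id x)).ncard ≤ n + (leftMultiples h).ncard →
      ∃ p : RPath P x y, p.toHom = h := by
    intro n
    induction n using Nat.strong_induction_on with
    | _ n ih =>
    intro y h h0 hn
    by_cases hid : P.IsId h
    · obtain rfl := hid.1
      exact ⟨RPath.nil x, by rw [isId_endo.1 hid, RPath.toHom]⟩
    let A : Set ℕ := {m | ∃ (z : P.Obj) (g : P.Hom z y) (h' : P.Hom x z), h = g ⊙ h' ∧
      ¬ P.IsId g ∧ (leftMultiples h').ncard = m}
    have hA : A.Nonempty := ⟨_, x, h, P.id x, (P.comp_id h).symm, hid, rfl⟩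
    obtain ⟨z, g, h', rfl, hg, hm⟩ := Nat.sInf_mem hA
    have hmin : ∀ m ∈ A, (leftMultiples h').ncard ≤ m := fun m hmA => hm ▸ Nat.sInf_le hmA
    have h0' := right_ne_zero h0
    have hirr : P.IsIrreducible g := by
      refine ⟨left_ne_zero h0, hg, fun t g1 g2 hgg => ?_⟩
      by_contra hcon
      push Not at hcon
      subst hgg
      have h1 := hmin _ ⟨t, g1, g2 ⊙ h', P.assoc _ _ _, hcon.1, rfl⟩
      have h2 := Set.ncard_lt_ncard (leftMultiples_comp_ssubset hcon.2 h0')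
        (finite_leftMultiples h')
      omega
    have hlt := Set.ncard_lt_ncard (leftMultiples_comp_ssubset hg h0') (finite_leftMultiples h')
    have hle : (leftMultiples h').ncard ≤ (leftMultiples (P.id x)).ncard :=
      Set.ncard_le_ncard (fun k hk => ⟨hk.1, k.2, (P.comp_id _).symm⟩) (finite_leftMultiples _)
    obtain ⟨p, rfl⟩ := ih ((leftMultiples (P.id x)).ncard - (leftMultiples h').ncard) (by omega)
      z h' h0' (by omega)
    exact ⟨RPath.cons g hirr p, by rw [RPath.toHom]⟩
  exact key _ y h h0 (Nat.le_add_right _ _)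

end RayCategory

namespace RPath

variable {P : RayCategory}

theorem toHom_append {x y z : P.Obj} (p : RPath P y z) (q : RPath P x y) :
    (p.append q).toHom = p.toHom ⊙ q.toHom := by
  induction p with
  | nil => simp only [append, toHom, P.id_comp]
  | cons f hf p ih => simp only [append, toHom, ih, P.assoc]

theorem append_nil {x y : P.Obj} (p : RPath P x y) : p.append (nil x) = p := by
  induction p with
  | nil => simp only [append]
  | cons f hf p ih => simp only [append, ih]

theorem isId_toHom_of_length {x y : P.Obj} (p : RPath P x y) (h : p.length = 0) :
    P.IsId p.toHom := by
  cases p with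
  | nil => simp only [toHom]; exact RayCategory.isId_id x
  | cons => simp [length] at h

/-- Two paths ending with arrows `α` and `β` are interlaced as soon as their common composite
also starts with a common non-identity morphism `F`. -/
theorem interlaced_of_comp {x y a b c : P.Obj} {alp : P.Hom a y} (halp : P.IsIrreducible alp)
    {bet : P.Hom b y} (hbet : P.IsIrreducible bet) (p : RPath P x a) (q : RPath P x b)
    (h0 : alp ⊙ p.toHom ≠ P.zero x y) (he : alp ⊙ p.toHom = bet ⊙ q.toHom)
    {F : P.Hom x c} (hF : ¬ P.IsId F) (G : P.Hom c b) (G' : P.Hom c a)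
    (hq : q.toHom = G ⊙ F) (hG : bet ⊙ G = alp ⊙ G') :
    Interlaced (cons alp halp p) (cons bet hbet q) := by
  have hp : p.toHom = G' ⊙ F := by
    apply RayCategory.cancel_left (g := alp) _ h0
    rw [he, hq, ← P.assoc, hG, P.assoc]
  have n1 : alp ⊙ (G' ⊙ F) ≠ P.zero x y := hp ▸ h0
  have n2 : bet ⊙ (G ⊙ F) ≠ P.zero x y := by rw [← hq, ← he]; exact h0
  obtain ⟨pF, hpF⟩ := RayCategory.exists_path F (RayCategory.right_ne_zero
    (RayCategory.right_ne_zero n1))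
  obtain ⟨pG, hpG⟩ := RayCategory.exists_path G (RayCategory.left_ne_zero
    (RayCategory.right_ne_zero n2))
  obtain ⟨pG', hpG'⟩ := RayCategory.exists_path G' (RayCategory.left_ne_zero
    (RayCategory.right_ne_zero n1))
  have hlen : pF.length ≠ 0 := fun h => hF (hpF ▸ isId_toHom_of_length pF h)
  have s1 : InterlaceStep (cons alp halp p) (cons alp halp (pG'.append pF)) := by
    refine ⟨x, a, cons alp halp (nil a), p, pG'.append pF, nil x, ?_, ?_, ?_, ?_, ?_⟩
    · rw [append_nil]; simp only [append]
    · rw [append_nil]; simp only [append]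
    · rw [toHom_append, hpF, hpG', hp]
    · exact RayCategory.right_ne_zero h0
    · simp [length]
  have s2 : InterlaceStep (cons alp halp (pG'.append pF)) (cons bet hbet (pG.append pF)) := by
    refine ⟨c, y, nil y, cons alp halp pG', cons bet hbet pG, pF, ?_, ?_, ?_, ?_, ?_⟩
    · simp only [append]
    · simp only [append]
    · simp only [toHom, hpG, hpG', hG]
    · simp only [toHom, hpG']
      rw [← P.assoc] at n1
      exact RayCategory.left_ne_zero n1
    · exact fun h => hlen h.2
  have s3 : InterlaceStep (cons bet hbet (pG.append pF)) (cons bet hbet q) := by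
    refine ⟨x, b, cons bet hbet (nil b), pG.append pF, q, nil x, ?_, ?_, ?_, ?_, ?_⟩
    · rw [append_nil]; simp only [append]
    · rw [append_nil]; simp only [append]
    · rw [toHom_append, hpF, hpG, hq]
    · rw [toHom_append, hpF, hpG]
      exact RayCategory.right_ne_zero n2
    · simp [length]
  exact Relation.TransGen.head s1 (Relation.TransGen.head s2 (Relation.TransGen.single s3))

end RPath

namespace RModHom

variable {P : RayCategory} {k : Type} [Field k] {D : Set P.Obj}
  {I : ∀ a b : P.Obj, P.Hom a b → Prop}

theorem natural_apply {M N : RMod P k D I} (φ : RModHom M N) {x y : P.Obj} (f : P.Hom x y)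
    (m : M.M x) : N.act f (φ.app x m) = φ.app y (M.act f m) :=
  LinearMap.congr_fun (φ.natural f) m

end RModHom

namespace RModIso

variable {P : RayCategory} {k : Type} [Field k] {D : Set P.Obj}
  {I : ∀ a b : P.Obj, P.Hom a b → Prop}

theorem symm {M N : RMod P k D I} (h : RModIso M N) : RModIso N M := by
  obtain ⟨φ, hφ⟩ := h
  let e := fun x => LinearEquiv.ofBijective (φ.app x) (hφ x)
  refine ⟨⟨fun x => (e x).symm, fun {x y} f => ?_⟩, fun x => (e x).symm.bijective⟩
  ext n
  obtain ⟨m, rfl⟩ := (e x).surjective n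
  have : N.act f (e x m) = e y (M.act f m) := φ.natural_apply f m
  simp [this]

theorem trans {M N L : RMod P k D I} (h : RModIso M N) (h' : RModIso N L) : RModIso M L := by
  obtain ⟨φ, hφ⟩ := h
  obtain ⟨ψ, hψ⟩ := h'
  refine ⟨⟨fun x => (ψ.app x).comp (φ.app x), fun {x y} f => ?_⟩,
    fun x => (hψ x).comp (hφ x)⟩
  ext m
  simp [ψ.natural_apply, φ.natural_apply]

end RModIso

namespace RMod

variable {P : RayCategory} {k : Type} [Field k] {D : Set P.Obj}
  {I : ∀ a b : P.Obj, P.Hom a b → Prop}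

variable (P k D I) in
/-- the zero module -/
def zeroMod : RMod P k D I where
  M _ := PUnit
  act _ := 0
  act_id _ _ := by ext
  act_comp _ _ _ _ _ := by ext
  act_zero _ _ := rfl
  supp _ _ _ := rfl
  killed _ _ := rfl

/-- the product of two modules -/
def prodMod (M N : RMod P k D I) : RMod P k D I where
  M x := M.M x × N.M x
  act f := (M.act f).prodMap (N.act f)
  act_id x hx := by rw [M.act_id x hx, N.act_id x hx]; rfl
  act_comp hx hy hz g f := by rw [M.act_comp hx hy hz, N.act_comp hx hy hz]; rfl
  act_zero hx hy := by rw [M.act_zero hx hy, N.act_zero hx hy]; rfl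
  supp x hx m := Prod.ext (M.supp x hx _) (N.supp x hx _)
  killed f hf := by rw [M.killed f hf, N.killed f hf]; rfl

/-- a submodule, as a module -/
def subMod (M : RMod P k D I) (S : ∀ x, Submodule k (M.M x))
    (hS : ∀ {x y : P.Obj} (f : P.Hom x y), ∀ m ∈ S x, M.act f m ∈ S y) : RMod P k D I where
  M x := S x
  act f := (M.act f).restrict (hS f)
  act_id x hx := by ext m; simp [M.act_id x hx]
  act_comp hx hy hz g f := by ext m; simp [M.act_comp hx hy hz]
  act_zero hx hy := by ext m; simp [M.act_zero hx hy]
  supp x hx m := Subtype.ext (M.supp x hx _)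
  killed f hf := by ext m; simp [M.killed f hf]

theorem _root_.RModIso.prodMod {M N M' N' : RMod P k D I} (h : RModIso M M')
    (h' : RModIso N N') : RModIso (M.prodMod N) (M'.prodMod N') := by
  obtain ⟨φ, hφ⟩ := h
  obtain ⟨ψ, hψ⟩ := h'
  refine ⟨⟨fun x => (φ.app x).prodMap (ψ.app x), fun {x y} f => ?_⟩, fun x =>
    (hφ x).prodMap (hψ x)⟩
  refine LinearMap.ext fun m => ?_
  exact Prod.ext (φ.natural_apply f m.1) (ψ.natural_apply f m.2)

/-- total dimension over a finite set of points -/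
noncomputable def totalDim (hD : D.Finite) (M : RMod P k D I) : ℕ :=
  ∑ x ∈ hD.toFinset, Module.finrank k (M.M x)

theorem finDim_of_finite (hD : D.Finite) (M : RMod P k D I)
    (h : ∀ x, FiniteDimensional k (M.M x)) : M.FinDim := by
  refine ⟨h, hD.subset fun x => ?_⟩
  rintro ⟨m, hm⟩
  by_contra hx
  exact hm (M.supp x hx m)

theorem iso_zeroMod (M : RMod P k D I) (h : ∀ x, ∀ m : M.M x, m = 0) :
    RModIso (zeroMod P k D I) M := by
  refine ⟨⟨fun x => 0, fun f => by simp⟩, fun x => ⟨fun _ _ _ => rfl, fun m => ⟨0, ?_⟩⟩⟩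
  rw [h x m, map_zero]

theorem exists_idempotent_split (hD : D.Finite) (M : RMod P k D I)
    (hfd : ∀ x, FiniteDimensional k (M.M x)) (hnz : M.Nonzero) (hM : ¬ M.Indec) :
    ∃ A B : RMod P k D I, (∀ x, FiniteDimensional k (A.M x)) ∧
      (∀ x, FiniteDimensional k (B.M x)) ∧
      A.totalDim hD < M.totalDim hD ∧ B.totalDim hD < M.totalDim hD ∧
      RModIso (A.prodMod B) M := by
  simp only [Indec, hnz, true_and, not_forall, not_or] at hM
  obtain ⟨e, he, ⟨u, hu⟩, ⟨v, hv⟩⟩ := hM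
  have hrk : ∀ x, Module.finrank k (LinearMap.range (e.app x)) +
      Module.finrank k (LinearMap.ker (e.app x)) = Module.finrank k (M.M x) :=
    fun x => LinearMap.finrank_range_add_finrank_ker _
  have hmem : ∀ x (f : M.M x →ₗ[k] M.M x), f ≠ 0 → x ∈ hD.toFinset := by
    intro x f hf
    rw [Set.Finite.mem_toFinset]
    by_contra hx
    exact hf (LinearMap.ext fun m => (M.supp x hx _).trans (M.supp x hx _).symm)
  have hu' : LinearMap.range (e.app u) ≠ ⊥ := fun h => hu (LinearMap.range_eq_bot.1 h)
  have hv' : LinearMap.ker (e.app v) ≠ ⊥ := fun h => hv (by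
    ext m
    have := LinearMap.congr_fun (he v) m
    exact LinearMap.ker_eq_bot.1 h this)
  have hcompl : ∀ x, IsCompl (LinearMap.range (e.app x)) (LinearMap.ker (e.app x)) :=
    fun x => (LinearMap.IsIdempotentElem.isCompl (f := e.app x) (he x))
  refine ⟨M.subMod (fun x => LinearMap.range (e.app x)) ?_,
    M.subMod (fun x => LinearMap.ker (e.app x)) ?_, fun x => ?_, fun x => ?_, ?_, ?_, ?_⟩
  · rintro x y f _ ⟨m, rfl⟩
    exact ⟨M.act f m, (e.natural_apply f m).symm⟩
  · intro x y f m hm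
    rw [LinearMap.mem_ker] at hm ⊢
    rw [← e.natural_apply, hm, map_zero]
  · exact inferInstanceAs (FiniteDimensional k (LinearMap.range (e.app x)))
  · exact inferInstanceAs (FiniteDimensional k (LinearMap.ker (e.app x)))
  · refine Finset.sum_lt_sum (fun x _ => ?_) ⟨v, hmem v (e.app v - LinearMap.id) ?_, ?_⟩
    · exact Submodule.finrank_le _
    · exact sub_ne_zero.2 hv
    · have := Submodule.one_le_finrank_iff.2 hv'
      have := hrk v
      change Module.finrank k (LinearMap.range (e.app v)) < _
      omega
  · refine Finset.sum_lt_sum (fun x _ => ?_) ⟨u, hmem u (e.app u) hu, ?_⟩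
    · exact Submodule.finrank_le _
    · have := Submodule.one_le_finrank_iff.2 hu'
      have := hrk u
      change Module.finrank k (LinearMap.ker (e.app u)) < _
      omega
  · refine ⟨⟨fun x => (Submodule.prodEquivOfIsCompl _ _ (hcompl x)).toLinearMap,
      fun {x y} f => ?_⟩, fun x => (Submodule.prodEquivOfIsCompl _ _ (hcompl x)).bijective⟩
    refine LinearMap.ext fun m => ?_
    exact map_add (M.act f) _ _

/-- Over a representation-finite full subcategory with finitely many points there are only
finitely many modules of each total dimension. -/
theorem exists_finite_reps (hR : RepFin P D I) (hD : D.Finite) (N : ℕ) :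
    ∃ (ι : Type) (_ : Finite ι) (rep : ι → RMod P k D I),
      ∀ M : RMod P k D I, (∀ x, FiniteDimensional k (M.M x)) → M.totalDim hD ≤ N →
        ∃ i, RModIso (rep i) M := by
  choose ι0 hι0 rep0 hrep0 using hR k
  induction N with
  | zero =>
    refine ⟨Unit, inferInstance, fun _ => zeroMod P k D I, fun M hfd hM => ⟨(), ?_⟩⟩
    refine iso_zeroMod M fun x m => ?_
    by_cases hx : x ∈ D
    · have h0 : Module.finrank k (M.M x) = 0 :=
        Finset.sum_eq_zero_iff.1 (Nat.le_zero.1 hM) x (hD.mem_toFinset.2 hx)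
      have := hfd x
      have := Module.finrank_zero_iff.1 h0
      exact Subsingleton.elim _ _
    · exact M.supp x hx m
  | succ N ih =>
    obtain ⟨ι, hι, rep, hrep⟩ := ih
    have : Finite D := hD
    refine ⟨Unit ⊕ (Σ x : Fin hD.toFinset.card, ι0 (hD.toFinset.equivFin.symm x)) ⊕ (ι × ι), inferInstance,
      Sum.elim (fun _ => zeroMod P k D I) (Sum.elim (fun i => rep0 _ i.2)
        fun i => (rep i.1).prodMod (rep i.2)), fun M hfd hM => ?_⟩
    by_cases hnz : M.Nonzero
    · by_cases hind : M.Indec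
      · obtain ⟨x, m, hm⟩ := hnz
        have hx : x ∈ hD.toFinset := by
          rw [hD.mem_toFinset]
          by_contra hx
          exact hm (M.supp x hx m)
        obtain ⟨i, hi⟩ := hrep0 (hD.toFinset.equivFin.symm (hD.toFinset.equivFin ⟨x, hx⟩)) M
          (M.finDim_of_finite hD hfd) hind (by
            rw [Equiv.symm_apply_apply]; exact ⟨m, hm⟩)
        exact ⟨Sum.inr (Sum.inl ⟨_, i⟩), hi⟩
      · obtain ⟨A, B, hA, hB, hA', hB', hAB⟩ := M.exists_idempotent_split hD hfd hnz hind
        obtain ⟨i, hi⟩ := hrep A hA (by omega)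
        obtain ⟨j, hj⟩ := hrep B hB (by omega)
        exact ⟨Sum.inr (Sum.inr (i, j)), (hi.prodMod hj).trans hAB⟩
    · refine ⟨Sum.inl (), iso_zeroMod M fun x m => ?_⟩
      by_contra hm
      exact hnz ⟨x, m, hm⟩

end RMod

namespace RMod

section Extension

variable {P : RayCategory} {k : Type} [Field k] {D D0 : Set P.Obj}
  {I : ∀ a b : P.Obj, P.Hom a b → Prop}

/-- the ambient space of the extension at `z` -/
abbrev ExtAmb (M : RMod P k D0 I) (z : P.Obj) : Type :=
  ∀ d : D0, P.Hom z d → M.M d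

/-- the element `g ↦ M(g ⊙ h) m` -/
def extElem (M : RMod P k D0 I) {c z : P.Obj} (h : P.Hom c z) : M.M c →ₗ[k] M.ExtAmb z :=
  LinearMap.pi fun d => LinearMap.pi fun g => M.act (g ⊙ h)

/-- restriction along `f` -/
def extRes (M : RMod P k D0 I) {z z' : P.Obj} (f : P.Hom z z') :
    M.ExtAmb z →ₗ[k] M.ExtAmb z' where
  toFun v d g := v d (g ⊙ f)
  map_add' _ _ := rfl
  map_smul' _ _ := rfl

theorem extElem_apply (M : RMod P k D0 I) {c z : P.Obj} (h : P.Hom c z) (m : M.M c) (d : D0)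
    (g : P.Hom z d) : M.extElem h m d g = M.act (g ⊙ h) m := rfl

theorem extRes_apply (M : RMod P k D0 I) {z z' : P.Obj} (f : P.Hom z z') (v : M.ExtAmb z)
    (d : D0) (g : P.Hom z' d) : M.extRes f v d g = v d (g ⊙ f) := rfl

theorem extRes_extElem (M : RMod P k D0 I) {c z z' : P.Obj} (h : P.Hom c z) (f : P.Hom z z')
    (m : M.M c) : M.extRes f (M.extElem h m) = M.extElem (f ⊙ h) m := by
  funext d g
  rw [extRes_apply, extElem_apply, extElem_apply, P.assoc]

/-- the spanning set of the extension at `z` -/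
def extGen (D : Set P.Obj) (M : RMod P k D0 I) (z : P.Obj) : Set (M.ExtAmb z) :=
  {v | z ∈ D ∧ ∃ c ∈ D0, ∃ (h : P.Hom c z) (m : M.M c), v = M.extElem h m}

/-- the space of the extension at `z` -/
def extSpace (D : Set P.Obj) (M : RMod P k D0 I) (z : P.Obj) : Submodule k (M.ExtAmb z) :=
  Submodule.span k (extGen D M z)

theorem extRes_mem (M : RMod P k D0 I) {z z' : P.Obj} (hz : z' ∈ D) (f : P.Hom z z') :
    ∀ v ∈ extSpace D M z, M.extRes f v ∈ extSpace D M z' := by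
  intro v hv
  induction hv using Submodule.span_induction with
  | mem v hv =>
    obtain ⟨-, c, hc, h, m, rfl⟩ := hv
    exact Submodule.subset_span ⟨hz, c, hc, _, m, M.extRes_extElem h f m⟩
  | zero => rw [map_zero]; exact Submodule.zero_mem _
  | add v w _ _ hv hw => rw [map_add]; exact Submodule.add_mem _ hv hw
  | smul r v _ hv => rw [map_smul]; exact Submodule.smul_mem _ r hv

theorem eq_zero_of_extGen (M : RMod P k D0 I) {z z' : P.Obj} (T : M.ExtAmb z →ₗ[k] M.ExtAmb z')
    (hT : ∀ c ∈ D0, ∀ (h : P.Hom c z) (m : M.M c), T (M.extElem h m) = 0) :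
    ∀ v ∈ extSpace D M z, T v = 0 := by
  intro v hv
  induction hv using Submodule.span_induction with
  | mem v hv =>
    obtain ⟨-, c, hc, h, m, rfl⟩ := hv
    exact hT c hc h m
  | zero => rw [map_zero]
  | add v w _ _ hv hw => rw [map_add, hv, hw, add_zero]
  | smul r v _ hv => rw [map_smul, hv, smul_zero]

open Classical in
/-- the action on the extension -/
noncomputable def extAct (D : Set P.Obj) (M : RMod P k D0 I) {z z' : P.Obj} (f : P.Hom z z') :
    extSpace D M z →ₗ[k] extSpace D M z' :=
  if hz : z' ∈ D then (M.extRes f).restrict (M.extRes_mem hz f) else 0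

theorem extAct_coe (M : RMod P k D0 I) {z z' : P.Obj} (hz : z' ∈ D) (f : P.Hom z z')
    (v : extSpace D M z) : (extAct D M f v : M.ExtAmb z') = M.extRes f v := by
  rw [extAct, dif_pos hz]; rfl

/-- the extension of a module on a full subcategory to a bigger one -/
noncomputable def ext (hI1 : ∀ {a b c : P.Obj} (g : P.Hom b c) (f : P.Hom a b), I a b f →
      I a c (g ⊙ f))
    (hI2 : ∀ {a b c : P.Obj} (g : P.Hom b c) (f : P.Hom a b), I b c g → I a c (g ⊙ f))
    (M : RMod P k D0 I) : RMod P k D I where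
  M z := extSpace D M z
  act f := extAct D M f
  act_id z hz := by
    refine LinearMap.ext fun v => Subtype.ext ?_
    rw [extAct_coe M hz]
    funext d g
    rw [extRes_apply, P.comp_id]; rfl
  act_comp hx hy hz g f := by
    refine LinearMap.ext fun v => Subtype.ext ?_
    rw [extAct_coe M hz, LinearMap.comp_apply, extAct_coe M hz, extAct_coe M hy]
    funext d h
    rw [extRes_apply, extRes_apply, extRes_apply, P.assoc]
  act_zero {x y} hx hy := by
    refine LinearMap.ext fun v => Subtype.ext ?_
    rw [extAct_coe M hy]
    refine eq_zero_of_extGen (D := D) M (M.extRes (P.zero x y)) (fun c hc h m => ?_) v v.2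
    funext d g
    rw [extRes_apply, extElem_apply, P.comp_zero, P.zero_comp, M.act_zero hc d.2]; rfl
  supp z hz v := by
    have : extGen D M z = ∅ := Set.eq_empty_of_forall_notMem fun v hv => hz hv.1
    have hv : (v : M.ExtAmb z) ∈ Submodule.span k (extGen D M z) := v.2
    rw [this, Submodule.span_empty, Submodule.mem_bot] at hv
    exact Subtype.ext hv
  killed {a b} f hf := by
    by_cases hb : b ∈ D
    · refine LinearMap.ext fun v => Subtype.ext ?_
      rw [extAct_coe M hb]
      refine eq_zero_of_extGen (D := D) M (M.extRes f) (fun c hc h m => ?_) v v.2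
      funext d g
      rw [extRes_apply, extElem_apply, M.killed _ (hI2 _ _ (hI1 _ _ hf))]; rfl
    · rw [extAct, dif_neg hb]

/-- the space of `M` at a point `c` of the subcategory inside the extension -/
noncomputable def extUnit (hD : D0 ⊆ D) (M : RMod P k D0 I) {c : P.Obj} (hc : c ∈ D0) :
    M.M c →ₗ[k] extSpace D M c :=
  (M.extElem (P.id c)).codRestrict _ fun m =>
    Submodule.subset_span ⟨hD hc, c, hc, P.id c, m, rfl⟩

theorem extUnit_bijective (hD : D0 ⊆ D) (M : RMod P k D0 I) {c : P.Obj} (hc : c ∈ D0) :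
    Function.Bijective (extUnit hD M hc) := by
  constructor
  · intro m m' h
    have := congrFun (congrFun (congrArg Subtype.val h) ⟨c, hc⟩) (P.id c)
    change M.act (P.id c ⊙ P.id c) m = M.act (P.id c ⊙ P.id c) m' at this
    rwa [P.comp_id, M.act_id c hc] at this
  · rintro ⟨v, hv⟩
    have : ∃ m, M.extElem (P.id c) m = v := by
      induction hv using Submodule.span_induction with
      | mem v hv =>
        obtain ⟨-, b, hb, h, m, rfl⟩ := hv
        refine ⟨M.act h m, ?_⟩
        funext d g
        rw [extElem_apply, extElem_apply, P.comp_id, M.act_comp hb hc d.2]; rfl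
      | zero => exact ⟨0, map_zero _⟩
      | add v w _ _ hv hw =>
        obtain ⟨m, rfl⟩ := hv
        obtain ⟨n, rfl⟩ := hw
        exact ⟨m + n, map_add _ _ _⟩
      | smul r v _ hv =>
        obtain ⟨m, rfl⟩ := hv
        exact ⟨r • m, map_smul _ _ _⟩
    obtain ⟨m, hm⟩ := this
    exact ⟨m, Subtype.ext hm⟩

theorem extAct_extUnit (hD : D0 ⊆ D) (M : RMod P k D0 I) {c d : P.Obj} (hc : c ∈ D0)
    (hd : d ∈ D0) (f : P.Hom c d) (m : M.M c) :
    extAct D M f (extUnit hD M hc m) = extUnit hD M hd (M.act f m) := by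
  refine Subtype.ext ?_
  rw [extAct_coe M (hD hd)]
  change M.extRes f (M.extElem _ m) = M.extElem _ (M.act f m)
  rw [extRes_extElem]
  funext e g
  rw [extElem_apply, extElem_apply, P.comp_id, P.comp_id, M.act_comp hc hd e.2]; rfl

theorem iso_of_ext_iso (hD : D0 ⊆ D) (hI1 : ∀ {a b c : P.Obj} (g : P.Hom b c) (f : P.Hom a b),
      I a b f → I a c (g ⊙ f))
    (hI2 : ∀ {a b c : P.Obj} (g : P.Hom b c) (f : P.Hom a b), I b c g → I a c (g ⊙ f))
    {M N : RMod P k D0 I} (h : RModIso (M.ext (D := D) hI1 hI2) (N.ext hI1 hI2)) :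
    RModIso M N := by
  classical
  obtain ⟨φ, hφ⟩ := h
  have hφ' : ∀ c, Function.Bijective (show extSpace D M c →ₗ[k] extSpace D N c from φ.app c) := hφ
  have hnat : ∀ {c d : P.Obj} (f : P.Hom c d) (v : extSpace D M c),
      extAct D N f ((show extSpace D M c →ₗ[k] extSpace D N c from φ.app c) v) =
      (show extSpace D M d →ₗ[k] extSpace D N d from φ.app d) (extAct D M f v) :=
    fun f v => φ.natural_apply f v
  generalize hψ : (fun c => (show extSpace D M c →ₗ[k] extSpace D N c from φ.app c)) = ψ at *
  have hψ' : ∀ c, (show extSpace D M c →ₗ[k] extSpace D N c from φ.app c) = ψ c :=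
    fun c => congrFun hψ c
  simp only [hψ'] at hφ' hnat
  let u := fun {c : P.Obj} (hc : c ∈ D0) => LinearEquiv.ofBijective _ (extUnit_bijective hD N hc)
  let χ : ∀ c, M.M c →ₗ[k] N.M c := fun c =>
    if hc : c ∈ D0 then (u hc).symm.toLinearMap.comp ((ψ c).comp (extUnit hD M hc)) else 0
  have hχ : ∀ {c} (hc : c ∈ D0) (m : M.M c), extUnit hD N hc (χ c m) = ψ c (extUnit hD M hc m) := by
    intro c hc m
    simp only [χ, dif_pos hc]
    exact (u hc).apply_symm_apply _
  refine ⟨⟨χ, fun {c d} f => LinearMap.ext fun m => ?_⟩, fun c => ?_⟩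
  · by_cases hc : c ∈ D0
    · by_cases hd : d ∈ D0
      · apply (extUnit_bijective hD N hd).1
        rw [LinearMap.comp_apply, LinearMap.comp_apply, hχ hd, ← extAct_extUnit hD N hc hd,
          ← extAct_extUnit hD M hc hd, hχ hc, hnat]
      · rw [N.supp d hd ((χ d ∘ₗ M.act f) m), N.supp d hd ((N.act f ∘ₗ χ c) m)]
    · rw [M.supp c hc m, map_zero, map_zero]
  · by_cases hc : c ∈ D0
    · constructor
      · intro m m' h
        have := congrArg (extUnit hD N hc) h
        rw [hχ, hχ] at this
        exact (extUnit_bijective hD M hc).1 ((hφ' c).1 this)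
      · intro n
        obtain ⟨v, hv⟩ := (hφ' c).2 (extUnit hD N hc n)
        obtain ⟨m, rfl⟩ := (extUnit_bijective hD M hc).2 v
        exact ⟨m, (extUnit_bijective hD N hc).1 (by rw [hχ, hv])⟩
    · exact ⟨fun m m' _ => (M.supp c hc m).trans (M.supp c hc m').symm,
        fun n => ⟨0, (N.supp c hc _).trans (N.supp c hc n).symm⟩⟩

theorem finrank_extSpace_le (hD0 : D0.Finite) (M : RMod P k D0 I) {n : ℕ}
    (hfd : ∀ x, FiniteDimensional k (M.M x)) (hn : ∀ x, Module.finrank k (M.M x) ≤ n)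
    (z : P.Obj) : FiniteDimensional k (extSpace D M z) ∧
      Module.finrank k (extSpace D M z) ≤ Nat.card (Σ c : D0, P.Hom c z) * n := by
  classical
  have : Finite D0 := hD0
  have : ∀ c : D0, Finite (P.Hom c z) := fun c => P.finite_hom c z
  have := Fintype.ofFinite (Σ c : D0, P.Hom c z)
  let T : (∀ i : (Σ c : D0, P.Hom c z), M.M i.1) →ₗ[k] M.ExtAmb z :=
    ∑ i, (M.extElem i.2).comp (LinearMap.proj i)
  have hle : extSpace D M z ≤ LinearMap.range T := by
    refine Submodule.span_le.2 ?_
    rintro _ ⟨-, c, hc, h, m, rfl⟩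
    refine ⟨Pi.single (⟨⟨c, hc⟩, h⟩ : Σ c : D0, P.Hom c z) m, ?_⟩
    simp only [T, LinearMap.sum_apply, LinearMap.comp_apply, LinearMap.proj_apply]
    rw [Finset.sum_eq_single ⟨⟨c, hc⟩, h⟩]
    · rw [Pi.single_eq_same]
    · intro i _ hi
      rw [Pi.single_eq_of_ne hi, map_zero]
    · intro h; exact absurd (Finset.mem_univ _) h
  refine ⟨Submodule.finiteDimensional_of_le hle, (Submodule.finrank_mono hle).trans ?_⟩
  refine (LinearMap.finrank_range_le T).trans ?_
  rw [Module.finrank_pi_fintype, Nat.card_eq_fintype_card]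
  refine (Finset.sum_le_card_nsmul _ _ n fun i _ => hn _).trans ?_
  rw [Finset.card_univ, smul_eq_mul]

end Extension

/-- A finite representation-finite full subcategory carries no infinite family of pairwise
non-isomorphic modules of bounded dimension on any full subcategory. -/
theorem no_infinite_family {P : RayCategory} {D D0 : Set P.Obj}
    {I : ∀ a b : P.Obj, P.Hom a b → Prop} (hR : RepFin P D I) (hD : D.Finite) (hsub : D0 ⊆ D)
    (hI1 : ∀ {a b c : P.Obj} (g : P.Hom b c) (f : P.Hom a b), I a b f → I a c (g ⊙ f))
    (hI2 : ∀ {a b c : P.Obj} (g : P.Hom b c) (f : P.Hom a b), I b c g → I a c (g ⊙ f))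
    (M : ℚ → RMod P ℚ D0 I) (n : ℕ) (hfd : ∀ l x, FiniteDimensional ℚ ((M l).M x))
    (hn : ∀ l x, Module.finrank ℚ ((M l).M x) ≤ n)
    (hiso : ∀ l m, RModIso (M l) (M m) → l = m) : False := by
  have hfin := fun l x => finrank_extSpace_le (D := D) (hD.subset hsub) (M l) (hfd l) (hn l) x
  obtain ⟨ι, hι, rep, hrep⟩ := exists_finite_reps (k := ℚ) hR hD
    (∑ x ∈ hD.toFinset, Nat.card (Σ c : D0, P.Hom c x) * n)
  choose i hi using fun l => hrep ((M l).ext hI1 hI2) (fun x => (hfin l x).1)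
    (Finset.sum_le_sum fun x _ => (hfin l x).2)
  obtain ⟨l, m, hlm, he⟩ := Finite.exists_ne_map_eq_of_infinite i
  refine hlm (hiso l m (iso_of_ext_iso hsub hI1 hI2 ((hi l).symm.trans ?_)))
  rw [he]
  exact hi m

end RMod

/-- A grid: finitely many points lying over points of `D0`, with a relation telling which points
are linked by which morphisms, compatibly with composition. -/
structure Grid (P : RayCategory) (D0 : Set P.Obj) (I : ∀ a b : P.Obj, P.Hom a b → Prop)
    (T : Type) where
  obj : T → P.Obj
  deg : T → ℤ
  le : T → T → Prop
  Lab : ∀ {c d : P.Obj}, P.Hom c d → T → T → Prop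
  obj_mem : ∀ t, obj t ∈ D0
  obj_deg_inj : ∀ s t, obj s = obj t → deg s = deg t → s = t
  lab_src : ∀ {c d : P.Obj} {f : P.Hom c d} {s t : T}, Lab f s t → obj s = c
  lab_tgt : ∀ {c d : P.Obj} {f : P.Hom c d} {s t : T}, Lab f s t → obj t = d
  lab_le : ∀ {c d : P.Obj} {f : P.Hom c d} {s t : T}, Lab f s t → le s t
  lab_deg : ∀ {c d : P.Obj} {f : P.Hom c d} {s t s' t' : T}, Lab f s t → Lab f s' t' →
    deg s - deg t = deg s' - deg t'
  lab_ex : ∀ s t, le s t → ∃ f : P.Hom (obj s) (obj t), Lab f s t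
  lab_id : ∀ (c : P.Obj) (s t : T), Lab (P.id c) s t ↔ s = t ∧ obj s = c
  lab_comp : ∀ {c d z : P.Obj}, c ∈ D0 → d ∈ D0 → z ∈ D0 → ∀ (g : P.Hom d z) (f : P.Hom c d)
    (s u : T), Lab (g ⊙ f) s u ↔ ∃ t, Lab f s t ∧ Lab g t u
  lab_zero : ∀ (c d : P.Obj) (s t : T), ¬ Lab (P.zero c d) s t
  lab_kill : ∀ {c d : P.Obj} (f : P.Hom c d) (s t : T), I c d f → ¬ Lab f s t

/-- Families of idempotents on the points of a grid whose associated modules are rigid. -/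
structure Shape {T : Type} (le : T → T → Prop) (W : Type) [AddCommGroup W] [Module ℚ W]
    (e : ℚ → T → W →ₗ[ℚ] W) : Prop where
  idem : ∀ l t w, e l t (e l t w) = e l t w
  ne : ∀ l t, e l t ≠ 0
  compat : ∀ l s t u, le s t → le t u → ∀ w, e l u (e l t (e l s w)) = e l u (e l s w)
  rigid : ∀ (l m : ℚ) (φ : T → W →ₗ[ℚ] W), (∀ t w, e m t (φ t w) = φ t w) →
    (∀ t w, φ t (e l t w) = φ t w) → (∀ s t, le s t → ∀ w, φ t (e l s w) = e m t (φ s w)) →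
    (l ≠ m → ∀ t, φ t = 0) ∧ (l = m → ∃ c : ℚ, ∀ t, φ t = c • e l t)

namespace Grid

variable {P : RayCategory} {D0 : Set P.Obj} {I : ∀ a b : P.Obj, P.Hom a b → Prop}
  {T : Type} (G : Grid P D0 I T)

theorem lab_right_unique {c d : P.Obj} {f : P.Hom c d} {s t t' : T} (h : G.Lab f s t)
    (h' : G.Lab f s t') : t = t' := by
  refine G.obj_deg_inj _ _ ((G.lab_tgt h).trans (G.lab_tgt h').symm) ?_
  have := G.lab_deg h h'
  omega

theorem lab_left_unique {c d : P.Obj} {f : P.Hom c d} {s s' t : T} (h : G.Lab f s t)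
    (h' : G.Lab f s' t) : s = s' := by
  refine G.obj_deg_inj _ _ ((G.lab_src h).trans (G.lab_src h').symm) ?_
  have := G.lab_deg h h'
  omega

variable [Fintype T] {W : Type} [AddCommGroup W] [Module ℚ W]
  (e : ℚ → T → W →ₗ[ℚ] W)

/-- the space of the module of a grid at the point `c` -/
def space (l : ℚ) (c : P.Obj) : Submodule ℚ (T → W) where
  carrier := {w | ∀ t, e l t (w t) = w t ∧ (G.obj t ≠ c → w t = 0)}
  add_mem' {v w} hv hw t := by
    refine ⟨?_, fun h => ?_⟩
    · rw [Pi.add_apply, map_add, (hv t).1, (hw t).1]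
    · rw [Pi.add_apply, (hv t).2 h, (hw t).2 h, add_zero]
  zero_mem' t := ⟨map_zero _, fun _ => rfl⟩
  smul_mem' r v hv t := by
    refine ⟨?_, fun h => ?_⟩
    · rw [Pi.smul_apply, map_smul, (hv t).1]
    · rw [Pi.smul_apply, (hv t).2 h, smul_zero]

open Classical in
/-- the action of a morphism on the module of a grid -/
noncomputable def actFun (l : ℚ) {c d : P.Obj} (f : P.Hom c d) : (T → W) →ₗ[ℚ] (T → W) :=
  LinearMap.pi fun u => ∑ s, if G.Lab f s u then (e l u).comp (LinearMap.proj s) else 0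

open Classical in
theorem actFun_apply (l : ℚ) {c d : P.Obj} (f : P.Hom c d) (w : T → W) (u : T) :
    G.actFun e l f w u = ∑ s, if G.Lab f s u then e l u (w s) else 0 := by
  simp only [actFun, LinearMap.pi_apply, LinearMap.sum_apply]
  refine Finset.sum_congr rfl fun s _ => ?_
  split_ifs <;> rfl

theorem actFun_of_lab (l : ℚ) {c d : P.Obj} {f : P.Hom c d} (w : T → W) {s u : T}
    (h : G.Lab f s u) : G.actFun e l f w u = e l u (w s) := by
  classical
  rw [actFun_apply, Finset.sum_eq_single s]
  · rw [if_pos h]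
  · intro s' _ hs
    rw [if_neg fun h' => hs (G.lab_left_unique h' h)]
  · intro h; exact absurd (Finset.mem_univ _) h

theorem actFun_of_not_lab (l : ℚ) {c d : P.Obj} {f : P.Hom c d} (w : T → W) {u : T}
    (h : ∀ s, ¬ G.Lab f s u) : G.actFun e l f w u = 0 := by
  classical
  rw [actFun_apply]
  exact Finset.sum_eq_zero fun s _ => if_neg (h s)

variable {e}

theorem actFun_mem (hS : Shape G.le W e) (l : ℚ) {c d : P.Obj} (f : P.Hom c d) :
    ∀ w ∈ G.space e l c, G.actFun e l f w ∈ G.space e l d := by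
  intro w _ u
  by_cases h : ∃ s, G.Lab f s u
  · obtain ⟨s, hs⟩ := h
    rw [G.actFun_of_lab e l w hs]
    exact ⟨hS.idem _ _ _, fun hu => absurd (G.lab_tgt hs) hu⟩
  · push Not at h
    rw [G.actFun_of_not_lab e l w h]
    exact ⟨map_zero _, fun _ => rfl⟩

/-- the module of a grid -/
noncomputable def toRMod (hS : Shape G.le W e) (l : ℚ) : RMod P ℚ D0 I where
  M c := G.space e l c
  act f := (G.actFun e l f).restrict (G.actFun_mem hS l f)
  act_id c _ := by
    refine LinearMap.ext fun w => Subtype.ext (funext fun u => ?_)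
    change G.actFun e l (P.id c) w.1 u = w.1 u
    by_cases hu : G.obj u = c
    · rw [G.actFun_of_lab e l w.1 ((G.lab_id c u u).2 ⟨rfl, hu⟩), (w.2 u).1]
    · rw [(w.2 u).2 hu, G.actFun_of_not_lab]
      intro s hs
      exact hu (G.lab_tgt hs)
  act_comp hx hy hz g f := by
    refine LinearMap.ext fun w => Subtype.ext (funext fun u => ?_)
    change G.actFun e l (g ⊙ f) w.1 u = G.actFun e l g (G.actFun e l f w.1) u
    by_cases h : ∃ t, G.Lab g t u
    · obtain ⟨t, ht⟩ := h
      rw [G.actFun_of_lab e l _ ht]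
      by_cases h' : ∃ s, G.Lab f s t
      · obtain ⟨s, hs⟩ := h'
        rw [G.actFun_of_lab e l _ hs, G.actFun_of_lab e l _ ((G.lab_comp hx hy hz g f s u).2
          ⟨t, hs, ht⟩), ← (w.2 s).1, hS.compat l s t u (G.lab_le hs) (G.lab_le ht)]
      · push Not at h'
        rw [G.actFun_of_not_lab e l _ h', map_zero, G.actFun_of_not_lab]
        intro s hs
        obtain ⟨t', h1, h2⟩ := (G.lab_comp hx hy hz g f s u).1 hs
        obtain rfl := G.lab_left_unique h2 ht
        exact h' s h1
    · push Not at h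
      rw [G.actFun_of_not_lab e l _ h, G.actFun_of_not_lab]
      intro s hs
      obtain ⟨t', h1, h2⟩ := (G.lab_comp hx hy hz g f s u).1 hs
      exact h t' h2
  act_zero _ _ := by
    refine LinearMap.ext fun w => Subtype.ext (funext fun u => ?_)
    exact G.actFun_of_not_lab e l w.1 fun s => G.lab_zero _ _ s u
  supp c hc w := Subtype.ext (funext fun t => (w.2 t).2 fun h => hc (h ▸ G.obj_mem t))
  killed f hf := by
    refine LinearMap.ext fun w => Subtype.ext (funext fun u => ?_)
    exact G.actFun_of_not_lab e l w.1 fun s => G.lab_kill f s u hf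

theorem single_mem [DecidableEq T] (l : ℚ) (t : T) (w : W) (hw : e l t w = w) :
    Pi.single t w ∈ G.space e l (G.obj t) := by
  intro u
  by_cases h : u = t
  · subst h
    rw [Pi.single_eq_same]
    exact ⟨hw, fun h => absurd rfl h⟩
  · rw [Pi.single_eq_of_ne h]
    exact ⟨map_zero _, fun _ => rfl⟩

theorem actFun_single [DecidableEq T] (l : ℚ) {c d : P.Obj} (f : P.Hom c d) {s t : T}
    (h : G.Lab f s t) (w : W) :
    G.actFun e l f (Pi.single s w) = Pi.single t (e l t w) := by
  funext u
  by_cases hu : u = t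
  · subst hu
    rw [G.actFun_of_lab e l _ h, Pi.single_eq_same, Pi.single_eq_same]
  · rw [Pi.single_eq_of_ne hu]
    by_cases h' : ∃ s', G.Lab f s' u
    · obtain ⟨s', hs'⟩ := h'
      rw [G.actFun_of_lab e l _ hs', Pi.single_eq_of_ne, map_zero]
      rintro rfl
      exact hu (G.lab_right_unique hs' h)
    · push Not at h'
      exact G.actFun_of_not_lab e l _ h'

theorem actFun_single_of_not_lab [DecidableEq T] (l : ℚ) {c d : P.Obj} (f : P.Hom c d) {s : T}
    (h : ∀ t, ¬ G.Lab f s t) (w : W) :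
    G.actFun e l f (Pi.single s w) = 0 := by
  funext u
  by_cases h' : ∃ s', G.Lab f s' u
  · obtain ⟨s', hs'⟩ := h'
    rw [G.actFun_of_lab e l _ hs', Pi.single_eq_of_ne, map_zero]; rfl
    rintro rfl
    exact h u hs'
  · push Not at h'
    exact G.actFun_of_not_lab e l _ h'

end Grid

namespace Grid

variable {P : RayCategory} {D0 : Set P.Obj} {I : ∀ a b : P.Obj, P.Hom a b → Prop}
  {T : Type} {G : Grid P D0 I T} [Fintype T] [DecidableEq T] {W : Type} [AddCommGroup W]
  [Module ℚ W] {e : ℚ → T → W →ₗ[ℚ] W} {hS : Shape G.le W e}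

/-- the element of the module of a grid concentrated at `t` -/
def pt (hS : Shape G.le W e) (l : ℚ) (t : T) : W →ₗ[ℚ] G.space e l (G.obj t) :=
  ((LinearMap.single ℚ (fun _ : T => W) t).comp (e l t)).codRestrict _ fun w =>
    G.single_mem l t _ (hS.idem l t w)

theorem pt_coe (l : ℚ) (t : T) (w : W) :
    (pt hS l t w : T → W) = Pi.single t (e l t w) := rfl

/-- a homomorphism between modules of a grid, at a point -/
def homAt {l m : ℚ} (φ : RModHom (G.toRMod hS l) (G.toRMod hS m)) (c : P.Obj) :
    G.space e l c →ₗ[ℚ] G.space e m c := φ.app c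

theorem homAt_natural {l m : ℚ} (φ : RModHom (G.toRMod hS l) (G.toRMod hS m)) {c d : P.Obj}
    (f : P.Hom c d) (v : G.space e l c) :
    G.actFun e m f (homAt φ c v : T → W) =
      (homAt φ d ((G.actFun e l f).restrict (G.actFun_mem hS l f) v) : T → W) :=
  congrArg Subtype.val (φ.natural_apply f v)

theorem homAt_congr {l m : ℚ} (φ : RModHom (G.toRMod hS l) (G.toRMod hS m)) {c : P.Obj}
    {v w : G.space e l c} (h : (v : T → W) = w) (t : T) :
    (homAt φ c v : T → W) t = (homAt φ c w : T → W) t := by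
  rw [Subtype.ext h]

/-- the matrix blocks of a homomorphism between modules of a grid -/
def block {l m : ℚ} (φ : RModHom (G.toRMod hS l) (G.toRMod hS m)) (s t : T) : W →ₗ[ℚ] W :=
  ((LinearMap.proj t).comp (G.space e m (G.obj s)).subtype).comp
    ((homAt φ (G.obj s)).comp (pt hS l s))

section

variable {l m : ℚ} (φ : RModHom (G.toRMod hS l) (G.toRMod hS m))

theorem block_apply (s t : T) (w : W) :
    block φ s t w = (homAt φ (G.obj s) (pt hS l s w) : T → W) t := rfl

theorem block_tgt (s t : T) (w : W) : e m t (block φ s t w) = block φ s t w :=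
  ((homAt φ (G.obj s) (pt hS l s w)).2 t).1

theorem block_src (s t : T) (w : W) : block φ s t (e l s w) = block φ s t w := by
  rw [block_apply, block_apply]
  exact homAt_congr φ (by rw [pt_coe, pt_coe, hS.idem]) t

theorem block_ne {s t : T} (h : G.obj t ≠ G.obj s) (w : W) : block φ s t w = 0 :=
  ((homAt φ (G.obj s) (pt hS l s w)).2 t).2 h

theorem act_pt {d : P.Obj} {s t : T} {f : P.Hom (G.obj s) d} (h : G.Lab f s t) (w : W) :
    ((G.actFun e l f).restrict (G.actFun_mem hS l f) (pt hS l s w) : T → W) =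
      Pi.single t (e l t (e l s w)) :=
  G.actFun_single l f h _

theorem block_natural {s t s' t' : T} {f : P.Hom (G.obj s) (G.obj t)} (h : G.Lab f s t)
    (h' : G.Lab f s' t') (w : W) :
    block φ t t' (e l s w) = e m t' (block φ s s' w) := by
  have := congrFun (homAt_natural φ f (pt hS l s w)) t'
  rw [G.actFun_of_lab e m _ h'] at this
  rw [block_apply, block_apply, this]
  exact homAt_congr φ (act_pt h w).symm t'

theorem block_natural_of_not_lab_left {s t t' : T} {f : P.Hom (G.obj s) (G.obj t)}
    (h : G.Lab f s t) (h' : ∀ s', ¬ G.Lab f s' t') (w : W) :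
    block φ t t' (e l s w) = 0 := by
  have := congrFun (homAt_natural φ f (pt hS l s w)) t'
  rw [G.actFun_of_not_lab e m _ h'] at this
  rw [block_apply]
  exact (homAt_congr φ (act_pt h w).symm t').trans this.symm

theorem block_natural_of_not_lab_right {s t s' : T} {d : P.Obj} {f : P.Hom (G.obj s') d}
    (h : G.Lab f s t) (h' : ∀ t', ¬ G.Lab f s' t') (w : W) :
    e m t (block φ s' s w) = 0 := by
  have := congrFun (homAt_natural φ f (pt hS l s' w)) t
  rw [G.actFun_of_lab e m _ h] at this
  rw [block_apply, this]
  have h0 : (G.actFun e l f).restrict (G.actFun_mem hS l f) (pt hS l s' w) = 0 :=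
    Subtype.ext (G.actFun_single_of_not_lab l f h' _)
  rw [h0, map_zero]; rfl

theorem homAt_eq_sum (c : P.Obj) (v : G.space e l c) (t : T) :
    (homAt φ c v : T → W) t = ∑ s, block φ s t ((v : T → W) s) := by
  have hmem : ∀ s, (Pi.single s ((v : T → W) s) : T → W) ∈ G.space e l c := by
    intro s
    by_cases hs : G.obj s = c
    · subst hs; exact G.single_mem l s _ (v.2 s).1
    · rw [(v.2 s).2 hs, Pi.single_zero]; exact Submodule.zero_mem _
  have hv : v = ∑ s, ⟨Pi.single s ((v : T → W) s), hmem s⟩ := by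
    apply Subtype.ext
    rw [AddSubmonoidClass.coe_finsetSum]
    exact (Finset.univ_sum_single (v : T → W)).symm
  conv_lhs => rw [hv]
  rw [map_sum, AddSubmonoidClass.coe_finsetSum, Finset.sum_apply]
  refine Finset.sum_congr rfl fun s _ => ?_
  by_cases hs : G.obj s = c
  · subst hs
    rw [block_apply]
    exact homAt_congr φ (by rw [pt_coe, (v.2 s).1]) t
  · have h0 : (⟨Pi.single s ((v : T → W) s), hmem s⟩ : G.space e l c) = 0 :=
      Subtype.ext ((congrArg (Pi.single s) ((v.2 s).2 hs)).trans (Pi.single_zero s))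
    rw [h0, map_zero, (v.2 s).2 hs, map_zero]; rfl

end

variable {l m : ℚ}

/-- the homogeneous components of the composite of two homomorphisms -/
noncomputable def hcomp (φ : RModHom (G.toRMod hS l) (G.toRMod hS m))
    (ψ : RModHom (G.toRMod hS m) (G.toRMod hS l)) (j : ℤ) (t : T) : W →ₗ[ℚ] W :=
  ∑ t', if G.deg t' = G.deg t - j then (block ψ t' t).comp (block φ t t') else 0

theorem hcomp_apply (φ : RModHom (G.toRMod hS l) (G.toRMod hS m))
    (ψ : RModHom (G.toRMod hS m) (G.toRMod hS l)) (j : ℤ) (t : T) (w : W) :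
    hcomp φ ψ j t w = ∑ t', if G.deg t' = G.deg t - j then block ψ t' t (block φ t t' w)
      else 0 := by
  rw [hcomp, LinearMap.sum_apply]
  refine Finset.sum_congr rfl fun s _ => ?_
  split_ifs <;> rfl

theorem hcomp_of_partner (φ : RModHom (G.toRMod hS l) (G.toRMod hS m))
    (ψ : RModHom (G.toRMod hS m) (G.toRMod hS l)) {j : ℤ} {t t' : T} (h : G.obj t' = G.obj t)
    (hj : G.deg t' = G.deg t - j) (w : W) :
    hcomp φ ψ j t w = block ψ t' t (block φ t t' w) := by
  rw [hcomp_apply, Finset.sum_eq_single t']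
  · rw [if_pos hj]
  · intro u _ hu
    split_ifs with h1
    · rw [block_ne φ, map_zero]
      intro h2
      exact hu (G.obj_deg_inj _ _ (h2.trans h.symm) (h1.trans hj.symm))
    · rfl
  · intro h; exact absurd (Finset.mem_univ _) h

theorem hcomp_of_no_partner (φ : RModHom (G.toRMod hS l) (G.toRMod hS m))
    (ψ : RModHom (G.toRMod hS m) (G.toRMod hS l)) {j : ℤ} {t : T}
    (h : ∀ t', G.obj t' = G.obj t → G.deg t' ≠ G.deg t - j) (w : W) :
    hcomp φ ψ j t w = 0 := by
  rw [hcomp_apply]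
  refine Finset.sum_eq_zero fun u _ => ?_
  split_ifs with h1
  · rw [block_ne φ, map_zero]
    exact fun h2 => h u h2 h1
  · rfl

theorem hcomp_natural (φ : RModHom (G.toRMod hS l) (G.toRMod hS m))
    (ψ : RModHom (G.toRMod hS m) (G.toRMod hS l)) (j : ℤ) {s t : T} (hst : G.le s t) (w : W) :
    hcomp φ ψ j t (e l s w) = e l t (hcomp φ ψ j s w) := by
  obtain ⟨f, hf⟩ := G.lab_ex s t hst
  by_cases ht : ∃ t', G.obj t' = G.obj t ∧ G.deg t' = G.deg t - j
  · obtain ⟨t', h1, h2⟩ := ht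
    rw [hcomp_of_partner φ ψ h1 h2]
    by_cases hs : ∃ s', G.obj s' = G.obj s ∧ G.deg s' = G.deg s - j
    · obtain ⟨s', h3, h4⟩ := hs
      rw [hcomp_of_partner φ ψ h3 h4]
      by_cases hl : G.Lab f s' t'
      · rw [block_natural φ hf hl, block_src]
        -- transport `f` along the equalities of objects
        have key : ∀ (c d : P.Obj) (f : P.Hom c d), G.obj s' = c → G.obj t' = d →
            G.Lab f s' t' → G.Lab f s t → ∀ v,
            block ψ t' t (e m s' v) = e l t (block ψ s' s v) := by
          rintro c d f rfl rfl h h' v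
          exact block_natural ψ h h' v
        have := key _ _ f h3 h1 hl hf (block φ s s' w)
        rwa [block_tgt] at this
      · rw [block_natural_of_not_lab_left φ hf, map_zero]
        · have key : ∀ (c d : P.Obj) (f : P.Hom c d), G.obj s' = c →
              (∀ u, ¬ G.Lab f s' u) → G.Lab f s t → ∀ v,
              e l t (block ψ s' s v) = 0 := by
            rintro c d f rfl h h' v
            exact block_natural_of_not_lab_right ψ h' h v
          refine (key _ _ f h3 (fun u hu => hl ?_) hf _).symm
          have := G.lab_deg hu hf
          rwa [G.obj_deg_inj t' u (h1.trans (G.lab_tgt hu).symm) (by omega)]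
        · intro u hu
          refine hl ?_
          have := G.lab_deg hu hf
          rwa [G.obj_deg_inj s' u (h3.trans (G.lab_src hu).symm) (by omega)]
    · push Not at hs
      rw [hcomp_of_no_partner φ ψ hs, map_zero, block_natural_of_not_lab_left φ hf, map_zero]
      intro u hu
      have := G.lab_deg hu hf
      exact hs u (G.lab_src hu) (by omega)
  · push Not at ht
    rw [hcomp_of_no_partner φ ψ ht]
    by_cases hs : ∃ s', G.obj s' = G.obj s ∧ G.deg s' = G.deg s - j
    · obtain ⟨s', h3, h4⟩ := hs
      rw [hcomp_of_partner φ ψ h3 h4]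
      have key : ∀ (c d : P.Obj) (f : P.Hom c d), G.obj s' = c →
          (∀ u, ¬ G.Lab f s' u) → G.Lab f s t → ∀ v,
          e l t (block ψ s' s v) = 0 := by
        rintro c d f rfl h h' v
        exact block_natural_of_not_lab_right ψ h' h v
      refine (key _ _ f h3 (fun u hu => ?_) hf _).symm
      have := G.lab_deg hu hf
      exact ht u (G.lab_tgt hu) (by omega)
    · push Not at hs
      rw [hcomp_of_no_partner φ ψ hs, map_zero]

theorem hcomp_src (φ : RModHom (G.toRMod hS l) (G.toRMod hS m))
    (ψ : RModHom (G.toRMod hS m) (G.toRMod hS l)) (j : ℤ) (t : T) (w : W) :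
    hcomp φ ψ j t (e l t w) = hcomp φ ψ j t w := by
  rw [hcomp_apply, hcomp_apply]
  exact Finset.sum_congr rfl fun u _ => by rw [block_src]

theorem hcomp_tgt (φ : RModHom (G.toRMod hS l) (G.toRMod hS m))
    (ψ : RModHom (G.toRMod hS m) (G.toRMod hS l)) (j : ℤ) (t : T) (w : W) :
    e l t (hcomp φ ψ j t w) = hcomp φ ψ j t w := by
  rw [hcomp_apply, map_sum]
  refine Finset.sum_congr rfl fun u _ => ?_
  split_ifs
  · rw [block_tgt]
  · rw [map_zero]

/-- The modules of a grid for different parameters are not isomorphic. -/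
theorem eq_of_iso [Nonempty T] (h : RModIso (G.toRMod hS l) (G.toRMod hS m)) : l = m := by
  by_contra hlm
  obtain ⟨φ, hφ⟩ := h
  let E := fun c => LinearEquiv.ofBijective (φ.app c) (hφ c)
  let ψ : RModHom (G.toRMod hS m) (G.toRMod hS l) := ⟨fun c => (E c).symm.toLinearMap, by
    intro c d f
    ext n
    obtain ⟨v, rfl⟩ := (E c).surjective n
    have : (G.toRMod hS m).act f (E c v) = E d ((G.toRMod hS l).act f v) := φ.natural_apply f v
    simp [this]⟩
  have hψφ : ∀ c (v : G.space e l c), homAt ψ c (homAt φ c v) = v :=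
    fun c v => (E c).symm_apply_apply v
  have hdiag : ∀ t, block φ t t = 0 := by
    refine (hS.rigid l m (fun t => block φ t t) (fun t w => block_tgt φ t t w)
      (fun t w => block_src φ t t w) fun s t hst w => ?_).1 hlm
    obtain ⟨f, hf⟩ := G.lab_ex s t hst
    exact block_natural φ hf hf w
  have hzero : ∀ j t, hcomp φ ψ j t = 0 := by
    intro j
    by_cases hj : j = 0
    · subst hj
      intro t
      ext w
      rw [hcomp_of_partner φ ψ rfl (sub_zero _).symm, hdiag]; simp
    · obtain ⟨c, hc⟩ := (hS.rigid l l (hcomp φ ψ j) (fun t w => hcomp_tgt φ ψ j t w)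
        (fun t w => hcomp_src φ ψ j t w) fun s t hst w => hcomp_natural φ ψ j hst w).2 rfl
      have hex : ∃ t, ∀ t', G.deg t' ≠ G.deg t - j := by
        rcases lt_or_gt_of_ne hj with hj | hj
        · obtain ⟨t, -, ht⟩ := Finset.exists_max_image Finset.univ G.deg Finset.univ_nonempty
          exact ⟨t, fun t' => by have := ht t' (Finset.mem_univ _); omega⟩
        · obtain ⟨t, -, ht⟩ := Finset.exists_min_image Finset.univ G.deg Finset.univ_nonempty
          exact ⟨t, fun t' => by have := ht t' (Finset.mem_univ _); omega⟩
      obtain ⟨t, ht⟩ := hex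
      have h0 : hcomp φ ψ j t = 0 := by
        ext w
        rw [hcomp_of_no_partner φ ψ fun t' _ => ht t']; rfl
      rw [hc t] at h0
      have hc0 : c = 0 := (smul_eq_zero.1 h0).resolve_right (hS.ne l t)
      intro t
      rw [hc t, hc0, zero_smul]
  obtain ⟨t⟩ := ‹Nonempty T›
  refine hS.ne l t (LinearMap.ext fun w => ?_)
  have h1 := congrArg (fun v : G.space e l (G.obj t) => (v : T → W) t)
    (hψφ (G.obj t) (pt hS l t w))
  rw [homAt_eq_sum, pt_coe, Pi.single_eq_same] at h1
  rw [← h1]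
  refine Finset.sum_eq_zero fun u _ => ?_
  rw [← block_apply]
  by_cases hu : G.obj u = G.obj t
  · rw [← hcomp_of_partner φ ψ (j := G.deg t - G.deg u) hu (by omega), hzero]; rfl
  · rw [block_ne φ hu, map_zero]

theorem not_repFin [Nonempty T] [FiniteDimensional ℚ W] (G : Grid P D0 I T)
    (hS : Shape G.le W e) {D : Set P.Obj}
    (hD : D.Finite) (hsub : D0 ⊆ D)
    (hI1 : ∀ {a b c : P.Obj} (g : P.Hom b c) (f : P.Hom a b), I a b f → I a c (g ⊙ f))
    (hI2 : ∀ {a b c : P.Obj} (g : P.Hom b c) (f : P.Hom a b), I b c g → I a c (g ⊙ f)) :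
    ¬ RepFin P D I := fun hR =>
  RMod.no_infinite_family hR hD hsub hI1 hI2 (fun l => G.toRMod hS l)
    (Module.finrank ℚ (T → W))
    (fun l c => inferInstanceAs (FiniteDimensional ℚ (G.space e l c)))
    (fun l c => Submodule.finrank_le (G.space e l c)) (fun _ _ h => eq_of_iso h)

end Grid

/-- the kinds of points in shapes of type `D̃` and `Ã` -/
inductive Kind
  | full
  | sub (i : Fin 4)
  | quot (i : Fin 4)
  deriving DecidableEq

namespace Kind

/-- projections onto four lines of the plane with cross-ratio depending on `l` -/
def line (l : ℚ) : Fin 4 → (ℚ × ℚ) →ₗ[ℚ] ℚ × ℚ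
  | 0 => (LinearMap.fst ℚ ℚ ℚ).prod 0
  | 1 => LinearMap.prod 0 (LinearMap.snd ℚ ℚ ℚ)
  | 2 => (LinearMap.fst ℚ ℚ ℚ).prod (LinearMap.fst ℚ ℚ ℚ)
  | 3 => (LinearMap.fst ℚ ℚ ℚ).prod (l • LinearMap.fst ℚ ℚ ℚ)

/-- the idempotent attached to a kind -/
def proj (l : ℚ) : Kind → (ℚ × ℚ) →ₗ[ℚ] ℚ × ℚ
  | full => LinearMap.id
  | sub i => line l i
  | quot i => LinearMap.id - line l i

theorem line_zero (l : ℚ) (w : ℚ × ℚ) : line l 0 w = (w.1, 0) := rfl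
theorem line_one (l : ℚ) (w : ℚ × ℚ) : line l 1 w = (0, w.2) := rfl
theorem line_two (l : ℚ) (w : ℚ × ℚ) : line l 2 w = (w.1, w.1) := rfl
theorem line_three (l : ℚ) (w : ℚ × ℚ) : line l 3 w = (w.1, l * w.1) := rfl

theorem line_line (l : ℚ) (i : Fin 4) (w : ℚ × ℚ) : line l i (line l i w) = line l i w := by
  fin_cases i <;> rfl

theorem proj_proj (l : ℚ) (κ : Kind) (w : ℚ × ℚ) : proj l κ (proj l κ w) = proj l κ w := by
  cases κ with
  | full => rfl
  | sub i => exact line_line l i w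
  | quot i => simp [proj, line_line]

theorem proj_full (l : ℚ) (w : ℚ × ℚ) : proj l full w = w := rfl
theorem proj_sub (l : ℚ) (i : Fin 4) (w : ℚ × ℚ) : proj l (sub i) w = line l i w := rfl
theorem proj_quot (l : ℚ) (i : Fin 4) (w : ℚ × ℚ) : proj l (quot i) w = w - line l i w := rfl

theorem proj_ne_zero (l : ℚ) (κ : Kind) : proj l κ ≠ 0 := by
  intro h
  have h1 := LinearMap.congr_fun h (1, 0)
  have h2 := LinearMap.congr_fun h (0, 1)
  cases κ with
  | full => simp [proj_full] at h1
  | sub i => fin_cases i <;> simp [proj_sub, line_zero, line_one, line_two, line_three] at h1 h2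
  | quot i => fin_cases i <;> simp [proj_quot, line_zero, line_one, line_two, line_three] at h1 h2

theorem compat_of {T : Type} {le : T → T → Prop} {κ : T → Kind}
    (h : ∀ s t u, le s t → le t u → κ t = full ∨ κ t = κ s ∨ κ t = κ u) (l : ℚ) (s t u : T)
    (hst : le s t) (htu : le t u) (w : ℚ × ℚ) :
    proj l (κ u) (proj l (κ t) (proj l (κ s) w)) = proj l (κ u) (proj l (κ s) w) := by
  rcases h s t u hst htu with h | h | h
  · rw [h, proj_full]
  · rw [h, proj_proj]
  · rw [h, proj_proj]

/-- Four lines in general position and a plane. -/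
theorem shape_of_root {T : Type} {le : T → T → Prop} (κ : T → Kind)
    (hc : ∀ s t u, le s t → le t u → κ t = full ∨ κ t = κ s ∨ κ t = κ u) (r : T)
    (hfull : ∀ t, κ t = full → le r t ∨ le t r)
    (hsub : ∀ t i, κ t = sub i → (∃ v, κ v = full ∧ le t v) ∨
      ∃ s v, κ s = sub i ∧ κ v = full ∧ le s t ∧ le s v)
    (hquot : ∀ t i, κ t = quot i → ∃ v, κ v = full ∧ le v t) (hr : κ r = full)
    (hline : ∀ i, ∃ t, κ t = sub i ∨ κ t = quot i) :
    Shape le (ℚ × ℚ) (fun l t => proj l (κ t)) where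
  idem l t w := proj_proj l _ w
  ne l t := proj_ne_zero l _
  compat l s t u := compat_of hc l s t u
  rigid l m φ h1 h2 h3 := by
    have hV : ∀ t, κ t = full → ∀ w, φ t w = φ r w := by
      intro t ht w
      rcases hfull t ht with h | h
      · have := h3 _ _ h w
        simpa only [hr, ht, proj_full] using this
      · have := h3 _ _ h w
        simpa only [hr, ht, proj_full] using this.symm
    have hS0 : ∀ t v i, κ t = sub i → κ v = full → le t v → ∀ w, φ t w = φ r (line l i w) := by
      intro t v i ht hv hle w
      have := h3 _ _ hle w
      rw [ht, hv, proj_sub, proj_full, hV v hv] at this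
      exact this.symm
    have hS : ∀ t i, κ t = sub i → ∀ w, φ t w = φ r (line l i w) := by
      intro t i ht w
      rcases hsub t i ht with ⟨v, hv, hle⟩ | ⟨s, v, hs, hv, hst, hsv⟩
      · exact hS0 t v i ht hv hle w
      · have e1 := h3 _ _ hst w
        have e2 := h2 t w
        have e3 := h1 s w
        simp only [ht, hs] at e1 e2 e3
        rw [e3, e2] at e1
        rw [e1]
        exact hS0 s v i hs hv hsv w
    have hQ : ∀ t i, κ t = quot i → ∀ w, φ t w = φ r w - line m i (φ r w) := by
      intro t i ht w
      obtain ⟨v, hv, hle⟩ := hquot t i ht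
      have := h3 _ _ hle w
      rwa [ht, hv, proj_quot, proj_full, hV v hv] at this
    have hL : ∀ i w, line m i (φ r (line l i w)) = φ r (line l i w) := by
      intro i w
      obtain ⟨t, ht | ht⟩ := hline i
      · have := h1 t w
        rwa [hS t i ht, ht] at this
      · have := h2 t w
        simp only [ht] at this
        rw [hQ t i ht, hQ t i ht, proj_quot, map_sub, map_sub] at this
        have h' : φ r (line l i w) - line m i (φ r (line l i w)) = 0 := by
          rw [sub_sub_sub_comm] at this
          exact sub_eq_self.1 this
        exact (sub_eq_zero.1 h').symm
    have hA : ∃ c : ℚ, (∀ w, φ r w = c • w) ∧ c * l = c * m := by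
      have a0 := hL 0 (1, 0)
      have a1 := hL 1 (0, 1)
      have a2 := hL 2 (1, 0)
      have a3 := hL 3 (1, 0)
      simp only [line_zero, line_one, line_two, line_three, mul_one] at a0 a1 a2 a3
      have dec : ∀ w : ℚ × ℚ, φ r w = w.1 • φ r (1, 0) + w.2 • φ r (0, 1) := by
        intro w
        rw [← map_smul, ← map_smul, ← map_add]
        congr 1
        ext <;> simp
      have b0 : (φ r (1, 0)).2 = 0 := by rw [← a0]
      have b1 : (φ r (0, 1)).1 = 0 := by rw [← a1]
      have b2 := congrArg Prod.snd a2
      have b3 := congrArg Prod.snd a3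
      rw [dec (1, 1)] at b2
      rw [dec (1, l)] at b3
      simp [b0, b1] at b2 b3
      refine ⟨(φ r (1, 0)).1, fun w => ?_, ?_⟩
      · rw [dec w]
        ext
        · simp [b1, mul_comm]
        · simp [b0, b2, mul_comm]
      · rw [mul_comm _ m, b3, ← b2, mul_comm]
    obtain ⟨c, hA, hc⟩ := hA
    have hall : ∀ t w, φ t w = c • proj l (κ t) w ∨ (c = 0 ∧ φ t w = 0) := by
      intro t w
      by_cases h0 : c = 0
      · refine Or.inr ⟨h0, ?_⟩
        cases h : κ t with
        | full => rw [hV t h, hA, h0, zero_smul]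
        | sub i => rw [hS t i h, hA, h0, zero_smul]
        | quot i => rw [hQ t i h, hA, h0, zero_smul, map_zero, sub_zero]
      · obtain rfl := mul_left_cancel₀ h0 hc
        left
        cases h : κ t with
        | full => rw [hV t h, hA, proj_full]
        | sub i => rw [hS t i h, hA, proj_sub]
        | quot i => rw [hQ t i h, hA, map_smul, proj_quot, smul_sub]
    constructor
    · intro hlm t
      have h0 : c = 0 := by
        by_contra h0
        exact hlm (mul_left_cancel₀ h0 hc)
      refine LinearMap.ext fun w => ?_
      rcases hall t w with h | h
      · rw [h, h0, zero_smul]; rfl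
      · exact h.2
    · intro _
      refine ⟨c, fun t => LinearMap.ext fun w => ?_⟩
      rcases hall t w with h | h
      · exact h
      · rw [h.2, h.1, zero_smul]; rfl

/-- the kinds of the four points of a shape of type `Ã₃` -/
def fourKind (t : Fin 4) : Kind := if t.val < 2 then sub t else quot t

/-- Two lines mapped to two quotients of a plane. -/
theorem shape_four {le : Fin 4 → Fin 4 → Prop}
    (hle : ∀ s t, le s t ↔ s = t ∨ (s.val < 2 ∧ 2 ≤ t.val)) :
    Shape le (ℚ × ℚ) (fun l t => proj l (fourKind t)) where
  idem l t w := proj_proj l _ w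
  ne l t := proj_ne_zero l _
  compat l s t u hst htu := by
    have : s = t ∨ t = u := by
      rw [hle] at hst htu
      omega
    intro w; rcases this with rfl | rfl <;> rw [proj_proj]
  rigid l m φ h1 h2 h3 := by
    have k0 : fourKind 0 = sub 0 := rfl
    have k1 : fourKind 1 = sub 1 := rfl
    have k2 : fourKind 2 = quot 2 := rfl
    have k3 : fourKind 3 = quot 3 := rfl
    have l02 : le 0 2 := (hle _ _).2 (by decide)
    have l12 : le 1 2 := (hle _ _).2 (by decide)
    have l03 : le 0 3 := (hle _ _).2 (by decide)
    have l13 : le 1 3 := (hle _ _).2 (by decide)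
    have dec : ∀ (ψ : (ℚ × ℚ) →ₗ[ℚ] ℚ × ℚ) (w : ℚ × ℚ),
        ψ w = w.1 • ψ (1, 0) + w.2 • ψ (0, 1) := by
      intro ψ w
      rw [← map_smul, ← map_smul, ← map_add]
      congr 1
      ext <;> simp
    have a0 := h1 0 (1, 0)
    have a0' := h2 0 (0, 1)
    have a1 := h1 1 (0, 1)
    have a1' := h2 1 (1, 0)
    have b02 := h3 0 2 l02 (1, 0)
    have b12 := h3 1 2 l12 (0, 1)
    have b03 := h3 0 3 l03 (1, 0)
    have b13 := h3 1 3 l13 (0, 1)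
    have c2 := h2 2 (1, 0)
    have c3 := h2 3 (1, 0)
    simp only [k0, k1, k2, k3, proj_sub, proj_quot, line_zero, line_one, line_two, line_three,
      mul_one] at a0 a0' a1 a1' b02 b12 b03 b13 c2 c3
    have z0 : φ 0 (0, 1) = 0 := by rw [← a0']; exact map_zero _
    have z1 : φ 1 (1, 0) = 0 := by rw [← a1']; exact map_zero _
    obtain ⟨a, ha⟩ : ∃ a : ℚ, φ 0 (1, 0) = (a, 0) := ⟨_, a0.symm⟩
    obtain ⟨b, hb⟩ : ∃ b : ℚ, φ 1 (0, 1) = (0, b) := ⟨_, a1.symm⟩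
    rw [ha] at b02 b03
    rw [hb] at b12 b13
    rw [dec, b02, b12] at c2
    rw [dec, b03, b13] at c3
    simp [Prod.ext_iff] at c2 c3
    have hab : b = a := by linarith
    subst hab
    have hc : b * l = b * m := by linarith
    have hall : ∀ t w, φ t w = b • proj m (fourKind t) w := by
      intro t w
      rw [dec]
      fin_cases t
      · simp [ha, z0, k0, proj_sub, line_zero, mul_comm]
      · simp [hb, z1, k1, proj_sub, line_one, mul_comm]
      · simp [b02, b12, k2, proj_quot, line_two, Prod.ext_iff]; ring
      · simp [b03, b13, k3, proj_quot, line_three, Prod.ext_iff]; ring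
    constructor
    · intro hlm t
      have h0 : b = 0 := by
        by_contra h0
        exact hlm (mul_left_cancel₀ h0 hc)
      refine LinearMap.ext fun w => ?_
      rw [hall, h0, zero_smul]; rfl
    · rintro rfl
      exact ⟨b, fun t => LinearMap.ext fun w => hall t w⟩

end Kind

namespace EShape

/-- the strict order relations of the shape of type `Ẽ₇` -/
def up : Fin 8 → List (Fin 8)
  | 0 => [1, 2, 3, 4]
  | 1 => [2, 3, 4]
  | 2 => [3, 4]
  | 3 => [4]
  | 5 => [2, 3, 4, 6, 7]
  | 6 => [4, 7]
  | _ => []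

/-- the plane with one parameter in the shape of type `Ẽ₇` -/
def plane (l : ℚ) : (ℚ × ℚ × ℚ) →ₗ[ℚ] ℚ × ℚ × ℚ where
  toFun w := (w.1, w.2.1, w.1 + l * (w.2.1 - w.1))
  map_add' v w := by ext <;> simp; ring
  map_smul' r w := by ext <;> simp; ring

/-- the line with one parameter in the shape of type `Ẽ₇` -/
def ray (l : ℚ) : (ℚ × ℚ × ℚ) →ₗ[ℚ] ℚ × ℚ × ℚ where
  toFun w := (0, w.2.1 - w.1, l * (w.2.1 - w.1))
  map_add' v w := by ext <;> simp <;> ring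
  map_smul' r w := by ext <;> simp <;> ring

/-- the coordinate line -/
def cline : (ℚ × ℚ × ℚ) →ₗ[ℚ] ℚ × ℚ × ℚ where
  toFun w := (w.1, 0, 0)
  map_add' v w := by ext <;> simp
  map_smul' r w := by ext <;> simp

/-- the coordinate plane -/
def cplane : (ℚ × ℚ × ℚ) →ₗ[ℚ] ℚ × ℚ × ℚ where
  toFun w := (w.1, w.2.1, 0)
  map_add' v w := by ext <;> simp
  map_smul' r w := by ext <;> simp

/-- the idempotents of the shape of type `Ẽ₇` -/
def proj (l : ℚ) : Fin 8 → (ℚ × ℚ × ℚ) →ₗ[ℚ] ℚ × ℚ × ℚ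
  | 0 => cline
  | 1 => cplane
  | 2 => LinearMap.id
  | 3 => cplane
  | 4 => cline
  | 5 => plane l
  | 6 => plane l
  | 7 => ray l

theorem plane_apply (l : ℚ) (w : ℚ × ℚ × ℚ) :
    plane l w = (w.1, w.2.1, w.1 + l * (w.2.1 - w.1)) := rfl

theorem ray_apply (l : ℚ) (w : ℚ × ℚ × ℚ) :
    ray l w = (0, w.2.1 - w.1, l * (w.2.1 - w.1)) := rfl

theorem cline_apply (w : ℚ × ℚ × ℚ) : cline w = (w.1, 0, 0) := rfl

theorem cplane_apply (w : ℚ × ℚ × ℚ) : cplane w = (w.1, w.2.1, 0) := rfl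

theorem proj_proj (l : ℚ) (t : Fin 8) (w : ℚ × ℚ × ℚ) : proj l t (proj l t w) = proj l t w := by
  fin_cases t <;> simp [proj, plane_apply, ray_apply, cline_apply, cplane_apply]

theorem shape {le : Fin 8 → Fin 8 → Prop} (hle : ∀ s t, le s t ↔ s = t ∨ t ∈ up s) :
    Shape le (ℚ × ℚ × ℚ) proj where
  idem := proj_proj
  ne l t h := by
    have h1 := LinearMap.congr_fun h (0, 1, 0)
    have h2 := LinearMap.congr_fun h (1, 0, 0)
    fin_cases t <;> simp [proj, plane_apply, ray_apply, cline_apply, cplane_apply] at h1 h2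
  compat l s t u hst htu w := by
    have key : ∀ s t u : Fin 8, (s = t ∨ t ∈ up s) → (t = u ∨ u ∈ up t) →
        s = t ∨ t = u ∨ t = 2 ∨ (s = 0 ∧ t = 1) ∨ (t = 3 ∧ u = 4) ∨ (s = 5 ∧ t = 6) := by
      decide
    rcases key s t u ((hle _ _).1 hst) ((hle _ _).1 htu) with
      rfl | rfl | rfl | ⟨rfl, rfl⟩ | ⟨rfl, rfl⟩ | ⟨rfl, rfl⟩
    · rw [proj_proj]
    · rw [proj_proj]
    · rfl
    · rfl
    · rfl
    · rw [show proj l 5 = proj l 6 from rfl, proj_proj]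
  rigid l m φ h1 h2 h3 := by
    have up' : ∀ s t, t ∈ up s → le s t := fun s t h => (hle _ _).2 (Or.inr h)
    have f0 : ∀ w, φ 2 (cline w) = φ 0 w := h3 0 2 (up' _ _ (by decide))
    have f1 : ∀ w, φ 2 (cplane w) = φ 1 w := h3 1 2 (up' _ _ (by decide))
    have f3 : ∀ w, φ 3 w = cplane (φ 2 w) := h3 2 3 (up' _ _ (by decide))
    have f4 : ∀ w, φ 4 w = cline (φ 2 w) := h3 2 4 (up' _ _ (by decide))
    have f5 : ∀ w, φ 2 (plane l w) = φ 5 w := h3 5 2 (up' _ _ (by decide))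
    have f6 : ∀ w, φ 6 w = φ 5 w := by
      intro w
      rw [← h2 6 w, ← h1 5 w]
      exact h3 5 6 (up' _ _ (by decide)) w
    have f7 : ∀ w, φ 7 (plane l w) = ray m (φ 5 w) := h3 5 7 (up' _ _ (by decide))
    have dec : ∀ w : ℚ × ℚ × ℚ, φ 2 w =
        w.1 • φ 2 (1, 0, 0) + w.2.1 • φ 2 (0, 1, 0) + w.2.2 • φ 2 (0, 0, 1) := by
      intro w
      rw [← map_smul, ← map_smul, ← map_smul, ← map_add, ← map_add]
      congr 1
      ext <;> simp
    have e0 : cline (φ 0 (1, 0, 0)) = φ 0 (1, 0, 0) := h1 0 _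
    have e1 : cplane (φ 1 (0, 1, 0)) = φ 1 (0, 1, 0) := h1 1 _
    have e3 : φ 3 (cplane (0, 0, 1)) = φ 3 (0, 0, 1) := h2 3 _
    have e4 : φ 4 (cline (0, 1, 0)) = φ 4 (0, 1, 0) := h2 4 _
    have e5 : plane m (φ 5 (1, 0, 0)) = φ 5 (1, 0, 0) := h1 5 _
    have e5' : plane m (φ 5 (0, 1, 0)) = φ 5 (0, 1, 0) := h1 5 _
    have e7 : φ 7 (ray l (plane l (1, 1, 0))) = φ 7 (plane l (1, 1, 0)) := h2 7 _
    rw [← f0] at e0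
    rw [← f1] at e1
    rw [f3, f3] at e3
    rw [f4, f4] at e4
    rw [← f5, dec (plane l _)] at e5 e5'
    rw [f7, ← f5, dec (plane l _)] at e7
    simp only [cline_apply, cplane_apply, plane_apply, ray_apply, sub_zero, zero_sub, mul_one,
      mul_neg, zero_add, sub_self, mul_zero, add_zero, zero_smul, one_smul] at e0 e1 e3 e4 e5 e5' e7
    obtain ⟨a, ha⟩ : ∃ a : ℚ, φ 2 (1, 0, 0) = (a, 0, 0) := ⟨_, e0.symm⟩
    obtain ⟨b, b', hb⟩ : ∃ b b' : ℚ, φ 2 (0, 1, 0) = (b', b, 0) := ⟨_, _, e1.symm⟩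
    obtain ⟨c, c1, c2, hc⟩ : ∃ c c1 c2 : ℚ, φ 2 (0, 0, 1) = (c1, c2, c) := ⟨_, _, _, rfl⟩
    have z : φ 2 (0, 0, 0) = 0 := map_zero _
    have z7 : φ 7 (0, 0, 0) = 0 := map_zero _
    simp only [ha, hb, hc, z, z7] at e3 e4 e5 e5' e7
    simp [Prod.ext_iff] at e3 e4 e5 e5' e7
    obtain ⟨rfl, rfl⟩ : c1 = 0 ∧ c2 = 0 := ⟨by linarith [e3.1], by linarith [e3.2]⟩
    obtain rfl : b' = 0 := by linarith
    obtain rfl : b = a := by linarith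
    have hc0 : c = b := by linarith
    subst hc0
    have hlm : c * l = c * m := by linarith
    have hall : ∀ w, φ 2 w = c • w := by
      intro w
      rw [dec, ha, hb, hc]
      ext <;> simp [mul_comm]
    have hray : ∀ w, plane l (ray l w) = ray l w := by
      intro w
      simp [plane_apply, ray_apply]
    have h7 : ∀ w, φ 7 w = ray m (c • ray l w) := by
      intro w
      rw [← hall, ← hray, f5, ← f7, hray]
      exact (h2 7 w).symm
    constructor
    · intro hne t
      have h0 : c = 0 := by
        by_contra h0
        exact hne (mul_left_cancel₀ h0 hlm)
      refine LinearMap.ext fun w => ?_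
      fin_cases t <;> simp [h7, f6, f3, f4, ← f0, ← f1, ← f5, hall, h0]
    · rintro rfl
      refine ⟨c, fun t => LinearMap.ext fun w => ?_⟩
      have hr : ray l (ray l w) = ray l w := proj_proj l 7 w
      fin_cases t <;> simp [proj, h7, f6, f3, f4, ← f0, ← f1, ← f5, hall, hr]

end EShape

section

variable {P : RayCategory} {D : Set P.Obj} {I : ∀ a b : P.Obj, P.Hom a b → Prop} {k n : ℕ}
  {o : Fin k → P.Obj} {Dg : ∀ {c d : P.Obj}, P.Hom c d → ℕ → Prop}
  {ob : Fin n → Fin k} {deg : Fin n → ℕ} {le : Fin n → Fin n → Prop}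

/-- A grid of points placed by means of a degree function for morphisms. -/
def Grid.ofDeg (ho : Function.Injective o)
    (uniq : ∀ i j (f : P.Hom (o i) (o j)) p q, Dg f p → Dg f q → p = q)
    (zero : ∀ c d p, ¬ Dg (P.zero c d) p) (hid : ∀ i, Dg (P.id (o i)) 0)
    (inj : ∀ s t, ob s = ob t → deg s = deg t → s = t) (refl : ∀ t, le t t)
    (trans : ∀ s t u, le s t → le t u → le s u)
    (hE : ∀ s t, le s t → ∃ (f : P.Hom (o (ob s)) (o (ob t))) (p : ℕ),
      deg s = deg t + p ∧ Dg f p)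
    (fact : ∀ s u j (f : P.Hom (o (ob s)) (o j)) (g : P.Hom (o j) (o (ob u))) (p : ℕ), le s u →
      deg s = deg u + p → Dg (g ⊙ f) p → ∃ (t : Fin n) (q r : ℕ), ob t = j ∧ le s t ∧ le t u ∧
        deg s = deg t + q ∧ deg t = deg u + r ∧ Dg f q ∧ Dg g r)
    (comp : ∀ s t u (f : P.Hom (o (ob s)) (o (ob t))) (g : P.Hom (o (ob t)) (o (ob u))) (p q : ℕ),
      le s t → le t u → deg s = deg t + p → deg t = deg u + q → Dg f p → Dg g q →
        Dg (g ⊙ f) (p + q))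
    (kill : ∀ s t (f : P.Hom (o (ob s)) (o (ob t))) (p : ℕ), le s t → deg s = deg t + p →
      Dg f p → ¬ I _ _ f) :
    Grid P (Set.range o) I (Fin n) where
  obj t := o (ob t)
  deg t := deg t
  le := le
  Lab {c d} f s t := o (ob s) = c ∧ o (ob t) = d ∧ le s t ∧ ∃ p : ℕ, deg s = deg t + p ∧ Dg f p
  obj_mem t := ⟨ob t, rfl⟩
  obj_deg_inj s t h1 h2 := inj s t (ho h1) (by exact_mod_cast h2)
  lab_src h := h.1
  lab_tgt h := h.2.1
  lab_le h := h.2.2.1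
  lab_deg := by
    rintro c d f s t s' t' ⟨rfl, rfl, -, p, h1, h2⟩ ⟨-, -, -, p', h3, h4⟩
    have := uniq _ _ _ _ _ h2 h4
    omega
  lab_ex s t h := by
    obtain ⟨f, p, h1, h2⟩ := hE s t h
    exact ⟨f, rfl, rfl, h, p, h1, h2⟩
  lab_id := by
    intro c s t
    constructor
    · rintro ⟨rfl, h, -, p, h1, h2⟩
      obtain rfl := uniq _ _ _ _ _ h2 (hid _)
      exact ⟨inj _ _ (ho h.symm) (by omega), rfl⟩
    · rintro ⟨rfl, rfl⟩
      exact ⟨rfl, rfl, refl s, 0, rfl, hid _⟩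
  lab_comp := by
    rintro c d z - ⟨j, rfl⟩ - g f s u
    constructor
    · rintro ⟨rfl, rfl, hle, p, h1, h2⟩
      obtain ⟨t, q, r, rfl, h3, h4, h5, h6, h7, h8⟩ := fact s u j f g p hle h1 h2
      exact ⟨t, ⟨rfl, rfl, h3, q, h5, h7⟩, rfl, rfl, h4, r, h6, h8⟩
    · rintro ⟨t, ⟨rfl, h, h3, q, h5, h7⟩, -, rfl, h4, r, h6, h8⟩
      obtain rfl := ho h
      exact ⟨rfl, rfl, trans _ _ _ h3 h4, q + r, by omega, comp s t u f g q r h3 h4 h5 h6 h7 h8⟩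
  lab_zero := by
    rintro c d s t ⟨-, -, -, p, -, h⟩
    exact zero _ _ _ h
  lab_kill := by
    rintro c d f s t hI ⟨rfl, rfl, hle, p, h1, h2⟩
    exact kill s t f p hle h1 h2 hI

variable {W : Type} [AddCommGroup W] [Module ℚ W] [FiniteDimensional ℚ W]
  {e : ℚ → Fin n → W →ₗ[ℚ] W}

/-- Representation-infiniteness from a degree function and a table of possible degrees. -/
theorem not_repFin_of_deg [Nonempty (Fin n)] (hD : D.Finite)
    (hI1 : ∀ (a b c : P.Obj) (g : P.Hom b c) (f : P.Hom a b), I a b f → I a c (g ⊙ f))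
    (hI2 : ∀ (a b c : P.Obj) (g : P.Hom b c) (f : P.Hom a b), I b c g → I a c (g ⊙ f))
    (ho : Function.Injective o) (hoD : ∀ i, o i ∈ D)
    (uniq : ∀ i j (f : P.Hom (o i) (o j)) p q, Dg f p → Dg f q → p = q)
    (zero : ∀ c d p, ¬ Dg (P.zero c d) p) (hid : ∀ i, Dg (P.id (o i)) 0)
    (inj : ∀ s t, ob s = ob t → deg s = deg t → s = t) (refl : ∀ t, le t t)
    (trans : ∀ s t u, le s t → le t u → le s u)
    (hE : ∀ s t, le s t → ∃ (f : P.Hom (o (ob s)) (o (ob t))) (p : ℕ),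
      deg s = deg t + p ∧ Dg f p)
    (hadd : ∀ s u j (f : P.Hom (o (ob s)) (o j)) (g : P.Hom (o j) (o (ob u))) (p : ℕ), le s u →
      deg s = deg u + p → Dg (g ⊙ f) p → ∃ q r : ℕ, p = q + r ∧ Dg f q ∧ Dg g r)
    (comp : ∀ s t u (f : P.Hom (o (ob s)) (o (ob t))) (g : P.Hom (o (ob t)) (o (ob u))) (p q : ℕ),
      le s t → le t u → deg s = deg t + p → deg t = deg u + q → Dg f p → Dg g q →
        Dg (g ⊙ f) (p + q))
    (kill : ∀ s t (f : P.Hom (o (ob s)) (o (ob t))) (p : ℕ), le s t → deg s = deg t + p →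
      Dg f p → ¬ I _ _ f)
    (ok : Fin k → Fin k → ℕ → Prop)
    (hok : ∀ i j (f : P.Hom (o i) (o j)) (p : ℕ), Dg f p → ok i j p)
    (conv : ∀ s u j q r, le s u → deg s = deg u + (q + r) → ok (ob s) j q → ok j (ob u) r →
      ∃ t, ob t = j ∧ le s t ∧ le t u ∧ deg t = deg u + r)
    (hS : Shape le W e) : ¬ RepFin P D I := by
  refine Grid.not_repFin (Grid.ofDeg ho uniq zero hid inj refl trans hE ?_ comp kill) hS hD ?_
    (fun g f => hI1 _ _ _ g f) (fun g f => hI2 _ _ _ g f)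
  · intro s u j f g p hle h1 h2
    obtain ⟨q, r, rfl, h3, h4⟩ := hadd s u j f g p hle h1 h2
    obtain ⟨t, h5, h6, h7, h8⟩ := conv s u j q r hle h1 (hok _ _ _ _ h3) (hok _ _ _ _ h4)
    exact ⟨t, q, r, h5, h6, h7, by omega, h8, h3, h4⟩
  · rintro _ ⟨i, rfl⟩
    exact hoD i

end

namespace RayCategory

variable {P : RayCategory} {y : P.Obj}

/-- every morphism from `c` to `y` is obtained from `G c` by an endomorphism of `y` -/
def LeftCyclic (G : ∀ c, P.Hom c y) (c : P.Obj) : Prop :=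
  ∀ f : P.Hom c y, ∃ i, f = P.pipow y i ⊙ G c

/-- the degree of a morphism with respect to chosen morphisms to `y` -/
def HasDeg (G : ∀ c, P.Hom c y) {c d : P.Obj} (f : P.Hom c d) (p : ℕ) : Prop :=
  G d ⊙ f = P.pipow y p ⊙ G c ∧ G d ⊙ f ≠ P.zero c y

/-- there is a morphism of degree `p` from `c` to `d` -/
def ExDeg (G : ∀ c, P.Hom c y) (c d : P.Obj) (p : ℕ) : Prop := ∃ f : P.Hom c d, HasDeg G f p

variable {G : ∀ c, P.Hom c y}

theorem HasDeg.uniq {c d : P.Obj} {f : P.Hom c d} {p q : ℕ} (h : HasDeg G f p)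
    (h' : HasDeg G f q) : p = q :=
  pipow_comp_inj (h.1.symm.trans h'.1) (h.1 ▸ h.2)

theorem not_hasDeg_zero (c d : P.Obj) (p : ℕ) : ¬ HasDeg G (P.zero c d) p :=
  fun h => h.2 (P.comp_zero _)

theorem hasDeg_id {c : P.Obj} (h : G c ≠ P.zero c y) : HasDeg G (P.id c) 0 := by
  refine ⟨?_, ?_⟩
  · rw [P.comp_id, P.pipow_zero, P.id_comp]
  · rwa [P.comp_id]

theorem HasDeg.nz {c d : P.Obj} {f : P.Hom c d} {p : ℕ} (h : HasDeg G f p) :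
    P.pipow y p ⊙ G c ≠ P.zero c y := h.1 ▸ h.2

theorem LeftCyclic.exists_hasDeg {c d : P.Obj} (hc : LeftCyclic G c) {f : P.Hom c d}
    (h : G d ⊙ f ≠ P.zero c y) : ∃ p, HasDeg G f p := by
  obtain ⟨p, hp⟩ := hc (G d ⊙ f)
  exact ⟨p, hp, h⟩

theorem HasDeg.comp_eq {c d z : P.Obj} {f : P.Hom c d} {g : P.Hom d z} {p q : ℕ}
    (hf : HasDeg G f p) (hg : HasDeg G g q) : G z ⊙ (g ⊙ f) = P.pipow y (p + q) ⊙ G c := by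
  rw [← P.assoc, hg.1, P.assoc, hf.1, pipow_comp_pipow_comp, add_comm]

theorem HasDeg.comp {c d z : P.Obj} {f : P.Hom c d} {g : P.Hom d z} {p q : ℕ}
    (hf : HasDeg G f p) (hg : HasDeg G g q) (h : P.pipow y (p + q) ⊙ G c ≠ P.zero c y) :
    HasDeg G (g ⊙ f) (p + q) :=
  ⟨hf.comp_eq hg, by rwa [hf.comp_eq hg]⟩

theorem ExDeg.comp {c d z : P.Obj} {p q : ℕ} (hf : ExDeg G c d p) (hg : ExDeg G d z q)
    (h : P.pipow y (p + q) ⊙ G c ≠ P.zero c y) : ExDeg G c z (p + q) := by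
  obtain ⟨f, hf⟩ := hf
  obtain ⟨g, hg⟩ := hg
  exact ⟨_, hf.comp hg h⟩

theorem HasDeg.split {c d z : P.Obj} (hc : LeftCyclic G c) (hd : LeftCyclic G d)
    {f : P.Hom c d} {g : P.Hom d z} {r : ℕ} (h : HasDeg G (g ⊙ f) r) :
    ∃ p q, r = p + q ∧ HasDeg G f p ∧ HasDeg G g q := by
  have h1 := h.2
  rw [← P.assoc] at h1
  obtain ⟨q, hq⟩ := hd.exists_hasDeg (left_ne_zero h1)
  have h2 := h1
  rw [hq.1, P.assoc] at h2
  obtain ⟨p, hp⟩ := hc.exists_hasDeg (right_ne_zero h2)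
  refine ⟨p, q, ?_, hp, hq⟩
  have h3 := hp.comp_eq hq
  exact pipow_comp_inj (h.1.symm.trans h3) h.nz

variable {D : Set P.Obj} {I : ∀ a b : P.Obj, P.Hom a b → Prop} {k n : ℕ}
  {o : Fin k → P.Obj} {W : Type} [AddCommGroup W] [Module ℚ W] [FiniteDimensional ℚ W]
  {e : ℚ → Fin n → W →ₗ[ℚ] W}

/-- Representation-infiniteness from a table of possible degrees of morphisms. -/
theorem not_repFin_of_hasDeg [Nonempty (Fin n)] (hD : D.Finite)
    (hI1 : ∀ (a b c : P.Obj) (g : P.Hom b c) (f : P.Hom a b), I a b f → I a c (g ⊙ f))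
    (hI2 : ∀ (a b c : P.Obj) (g : P.Hom b c) (f : P.Hom a b), I b c g → I a c (g ⊙ f))
    (ho : Function.Injective o) (hoD : ∀ i, o i ∈ D) (hL : ∀ i, LeftCyclic G (o i))
    (hG0 : ∀ i, G (o i) ≠ P.zero (o i) y)
    (ob : Fin n → Fin k) (deg : Fin n → ℕ) (up : Fin n → List (Fin n))
    (cov : Fin n → Fin n → Prop) (N : Fin k → ℕ) (ok : Fin k → Fin k → ℕ → Prop)
    (hN : ∀ i, P.pipow y (N i) ⊙ G (o i) ≠ P.zero (o i) y)
    (inj : ∀ s t, ob s = ob t → deg s = deg t → s = t)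
    (trans : ∀ s, ∀ t ∈ up s, ∀ u ∈ up t, u ∈ up s)
    (hcov : ∀ s, ∀ u ∈ up s, cov s u ∨
      ∃ t, cov s t ∧ u ∈ up t ∧ (up t).length < (up s).length)
    (hdeg : ∀ s, ∀ u ∈ up s, deg u ≤ deg s ∧ deg s ≤ deg u + N (ob s))
    (hE : ∀ s t, cov s t → t ∈ up s ∧ ∃ p, deg s = deg t + p ∧ ExDeg G (o (ob s)) (o (ob t)) p)
    (kill : ∀ s t, s = t ∨ t ∈ up s → ∀ (f : P.Hom (o (ob s)) (o (ob t))) (p : ℕ),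
      deg s = deg t + p → HasDeg G f p → ¬ I _ _ f)
    (hok : ∀ i j (p : ℕ), ExDeg G (o i) (o j) p → ok i j p)
    (conv : ∀ s u j q r, s = u ∨ u ∈ up s → deg s = deg u + (q + r) → ok (ob s) j q →
      ok j (ob u) r → ∃ t, ob t = j ∧ (s = t ∨ t ∈ up s) ∧ (t = u ∨ u ∈ up t) ∧
        deg t = deg u + r)
    (hS : Shape (fun s t => s = t ∨ t ∈ up s) W e) : ¬ RepFin P D I := by
  have hnz : ∀ i p, p ≤ N i → P.pipow y p ⊙ G (o i) ≠ P.zero (o i) y := by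
    intro i p hp
    have := hN i
    obtain ⟨m, hm⟩ := Nat.exists_eq_add_of_le' hp
    rw [hm, ← pipow_comp_pipow_comp] at this
    exact right_ne_zero this
  have hE' : ∀ m s u, (up s).length = m → u ∈ up s →
      ExDeg G (o (ob s)) (o (ob u)) (deg s - deg u) := by
    intro m
    induction m using Nat.strong_induction_on with
    | _ m ih =>
      intro s u hm hu
      rcases hcov s u hu with h | ⟨t, h1, h2, h3⟩
      · obtain ⟨-, p, h1, h2⟩ := hE _ _ h
        rwa [h1, Nat.add_sub_cancel_left]
      · obtain ⟨h4, p, h5, h6⟩ := hE _ _ h1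
        have h7 := ih _ (hm ▸ h3) t u rfl h2
        have h8 := hdeg _ _ hu
        have h9 := hdeg _ _ h2
        have h10 : deg s - deg u = p + (deg t - deg u) := by omega
        rw [h10]
        exact h6.comp h7 (hnz _ _ (by omega))
  have hE2 : ∀ s t, s = t ∨ t ∈ up s → ∃ (f : P.Hom (o (ob s)) (o (ob t))) (p : ℕ),
      deg s = deg t + p ∧ HasDeg G f p := by
    rintro s t (rfl | h)
    · exact ⟨P.id _, 0, rfl, hasDeg_id (hG0 _)⟩
    · obtain ⟨f, hf⟩ := hE' _ s t rfl h
      have := hdeg _ _ h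
      exact ⟨f, deg s - deg t, by omega, hf⟩
  have htr : ∀ s t u, s = t ∨ t ∈ up s → t = u ∨ u ∈ up t → s = u ∨ u ∈ up s := by
    rintro s t u (rfl | h) (rfl | h')
    · exact Or.inl rfl
    · exact Or.inr h'
    · exact Or.inr h
    · exact Or.inr (trans _ _ h _ h')
  refine not_repFin_of_deg (Dg := fun f p => HasDeg G f p) hD hI1 hI2 ho hoD
    (fun i j f p q h h' => h.uniq h') not_hasDeg_zero (fun i => hasDeg_id (hG0 i)) inj
    (fun t => Or.inl rfl) htr hE2 ?_ ?_ (fun s t f p hle hp hf => kill s t hle f p hp hf) ok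
    (fun i j f p h => hok i j p ⟨f, h⟩) conv hS
  · intro s u j f g p hle h1 h2
    exact h2.split (hL _) (hL _)
  · intro s t u f g p q h1 h2 h3 h4 h5 h6
    refine h5.comp h6 ?_
    rcases htr _ _ _ h1 h2 with rfl | h
    · exact hnz _ _ (by omega)
    · exact hnz _ _ (by have := hdeg _ _ h; omega)

/-- Bounded version of the table conditions, suitable for decision procedures. -/
theorem conv_of_bounded {ob : Fin n → Fin k} {deg : Fin n → ℕ} {up : Fin n → List (Fin n)}
    {lo : Fin k → Fin k → ℕ}
    (h : ∀ s u, s = u ∨ u ∈ up s → ∀ j, ∀ r ∈ List.range (deg s - deg u + 1),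
      ((ob s = j ∧ deg s - deg u - r = 0) ∨ lo (ob s) j ≤ deg s - deg u - r) →
      ((j = ob u ∧ r = 0) ∨ lo j (ob u) ≤ r) →
      ∃ t, ob t = j ∧ (s = t ∨ t ∈ up s) ∧ (t = u ∨ u ∈ up t) ∧ deg t = deg u + r)
    (s u : Fin n) (j : Fin k) (q r : ℕ) (h1 : s = u ∨ u ∈ up s) (h2 : deg s = deg u + (q + r))
    (h3 : (ob s = j ∧ q = 0) ∨ lo (ob s) j ≤ q) (h4 : (j = ob u ∧ r = 0) ∨ lo j (ob u) ≤ r) :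
    ∃ t, ob t = j ∧ (s = t ∨ t ∈ up s) ∧ (t = u ∨ u ∈ up t) ∧ deg t = deg u + r := by
  refine h s u h1 j r (List.mem_range.2 (by omega)) ?_ h4
  rwa [show deg s - deg u - r = q by omega]

end RayCategory

namespace RayCategory

variable {P : RayCategory}

section

variable {D : Set P.Obj} {I : ∀ a b : P.Obj, P.Hom a b → Prop} {k n : ℕ}
  {o : Fin k → P.Obj} {W : Type} [AddCommGroup W] [Module ℚ W] [FiniteDimensional ℚ W]
  {e : ℚ → Fin n → W →ₗ[ℚ] W}

/-- Representation-infiniteness from a list of standard morphisms of all possible degrees. -/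
theorem not_repFin_of_std [Nonempty (Fin n)] (hD : D.Finite)
    (hI1 : ∀ (a b c : P.Obj) (g : P.Hom b c) (f : P.Hom a b), I a b f → I a c (g ⊙ f))
    (hI2 : ∀ (a b c : P.Obj) (g : P.Hom b c) (f : P.Hom a b), I b c g → I a c (g ⊙ f))
    (ho : Function.Injective o) (hoD : ∀ i, o i ∈ D)
    (S : ∀ s t : P.Obj, ℕ → P.Hom s t)
    (total : ∀ i j (f : P.Hom (o i) (o j)), f ≠ P.zero _ _ → ∃ p, f = S _ _ p)
    (sinj : ∀ i j p q, S (o i) (o j) p = S (o i) (o j) q → S (o i) (o j) p ≠ P.zero _ _ → p = q)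
    (sid : ∀ i, S (o i) (o i) 0 = P.id _)
    (scomp : ∀ i j m p q, S (o i) (o j) p ≠ P.zero _ _ → S (o j) (o m) q ≠ P.zero _ _ →
      S (o j) (o m) q ⊙ S (o i) (o j) p = S (o i) (o m) (p + q))
    {ob : Fin n → Fin k} {deg : Fin n → ℕ} {le : Fin n → Fin n → Prop}
    (inj : ∀ s t, ob s = ob t → deg s = deg t → s = t) (refl : ∀ t, le t t)
    (trans : ∀ s t u, le s t → le t u → le s u)
    (hE : ∀ s t, le s t → deg t ≤ deg s ∧
      S (o (ob s)) (o (ob t)) (deg s - deg t) ≠ P.zero _ _ ∧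
      ¬ I _ _ (S (o (ob s)) (o (ob t)) (deg s - deg t)))
    (ok : Fin k → Fin k → ℕ → Prop)
    (hok : ∀ i j (p : ℕ), S (o i) (o j) p ≠ P.zero _ _ → ok i j p)
    (conv : ∀ s u j q r, le s u → deg s = deg u + (q + r) → ok (ob s) j q → ok j (ob u) r →
      ∃ t, ob t = j ∧ le s t ∧ le t u ∧ deg t = deg u + r)
    (hS : Shape le W e) : ¬ RepFin P D I := by
  refine not_repFin_of_deg (Dg := fun {s t} f p => f = S s t p ∧ f ≠ P.zero s t) hD hI1 hI2 ho hoD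
    ?_ ?_ ?_ inj refl trans ?_ ?_ ?_ ?_ ok ?_ conv hS
  · rintro i j f p q ⟨rfl, h0⟩ ⟨h1, -⟩
    exact sinj _ _ _ _ h1 h0
  · exact fun c d p h => h.2 rfl
  · exact fun i => ⟨(sid i).symm, id_ne_zero _⟩
  · intro s t h
    obtain ⟨h1, h2, -⟩ := hE s t h
    exact ⟨_, deg s - deg t, by omega, rfl, h2⟩
  · rintro s u j f g p - - ⟨h1, h2⟩
    obtain ⟨q, rfl⟩ := total _ _ f (right_ne_zero h2)
    obtain ⟨r, rfl⟩ := total _ _ g (left_ne_zero h2)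
    have hf := right_ne_zero h2
    have hg := left_ne_zero h2
    refine ⟨q, r, ?_, ⟨rfl, hf⟩, ⟨rfl, hg⟩⟩
    rw [scomp _ _ _ _ _ hf hg] at h1 h2
    exact (sinj _ _ _ _ h1 h2).symm
  · rintro s t u f g p q h1 h2 h3 h4 ⟨rfl, h5⟩ ⟨rfl, h6⟩
    rw [scomp _ _ _ _ _ h5 h6]
    refine ⟨rfl, ?_⟩
    obtain ⟨h7, h8, -⟩ := hE _ _ (trans _ _ _ h1 h2)
    rwa [show deg s - deg u = p + q by omega] at h8
  · rintro s t f p h1 h2 ⟨rfl, -⟩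
    have := (hE _ _ h1).2.2
    rwa [show deg s - deg t = p by omega] at this
  · rintro i j f p ⟨rfl, h⟩
    exact hok _ _ _ h

end

theorem exists_table {c y : P.Obj} (hne : c ≠ y) (A : ℕ → P.Hom c c) (B : ℕ → P.Hom c y)
    (C : ℕ → P.Hom y c) (E : ℕ → P.Hom y y) : ∃ S : ∀ s t : P.Obj, ℕ → P.Hom s t,
      S c c = A ∧ S c y = B ∧ S y c = C ∧ S y y = E := by
  classical
  refine ⟨fun s t m => if h : s = c ∧ t = c then h.1 ▸ h.2 ▸ A m
    else if h : s = c ∧ t = y then h.1 ▸ h.2 ▸ B m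
    else if h : s = y ∧ t = c then h.1 ▸ h.2 ▸ C m
    else if h : s = y ∧ t = y then h.1 ▸ h.2 ▸ E m else P.zero s t, ?_, ?_, ?_, ?_⟩ <;>
    · funext m
      simp [hne, hne.symm]

variable {c y : P.Obj} {f : P.Hom c y} {h : P.Hom y c}

/-- powers move across a relation `ρ f = f π^l` -/
theorem pipow_comp_swap {l : ℕ} (hl : P.pi y ⊙ f = f ⊙ P.pipow c l) (k : ℕ) :
    P.pipow y k ⊙ f = f ⊙ P.pipow c (l * k) := by
  induction k with
  | zero => rw [Nat.mul_zero, P.pipow_zero, P.pipow_zero, P.id_comp, P.comp_id]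
  | succ k ih =>
    rw [Nat.add_comm, ← pipow_comp_pipow, P.assoc, ih, ← P.assoc]
    rw [show P.pipow y 1 = P.pi y from rfl, hl, P.assoc, pipow_comp_pipow]
    congr 2
    ring

/-- an irreducible morphism is a generator of the cyclic set containing it -/
theorem eq_of_irred_left (hf : P.IsIrreducible f) (hne : c ≠ y) {g : P.Hom c y} {i : ℕ}
    (h : f = P.pipow y i ⊙ g) : f = g := by
  rcases hf.2.2 _ _ _ h with h1 | h1
  · rw [h, isId_endo.1 h1, P.id_comp]
  · exact absurd h1.1 hne

theorem eq_of_irred_right (hf : P.IsIrreducible f) (hne : c ≠ y) {g : P.Hom c y} {i : ℕ}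
    (h : f = g ⊙ P.pipow c i) : f = g := by
  rcases hf.2.2 _ _ _ h with h1 | h1
  · exact absurd h1.1 hne
  · rw [h, isId_endo.1 h1, P.comp_id]

theorem pi_def (y : P.Obj) : P.pi y = P.pipow y 1 := rfl

/-- The situation in which an irreducible morphism into `y` is right but not left cyclic. -/
structure RightSetup (f : P.Hom c y) (h : P.Hom y c) (l : ℕ) : Prop where
  ne : c ≠ y
  gen : ∀ g : P.Hom c y, ∃ i, g = f ⊙ P.pipow c i
  two_le : 2 ≤ l
  swap : P.pi y ⊙ f = f ⊙ P.pipow c l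
  fh : f ⊙ h = P.pi y
  sq : P.pipow y 2 ≠ P.zero y y

namespace RightSetup

variable {l : ℕ}

theorem sq' (H : RightSetup f h l) : f ⊙ h ⊙ f ⊙ h ≠ P.zero y y := by
  rw [← P.assoc, H.fh, pi_def, pipow_comp_pipow]
  exact H.sq

theorem nzl (H : RightSetup f h l) : f ⊙ P.pipow c l ≠ P.zero c y := by
  rw [← H.swap, ← H.fh, P.assoc]
  have := H.sq'
  rw [← P.assoc h, ← P.assoc f] at this
  exact left_ne_zero this

theorem hf (H : RightSetup f h l) : h ⊙ f = P.pipow c l := by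
  have h1 : f ⊙ (h ⊙ f) = f ⊙ P.pipow c l := by rw [← P.assoc, H.fh, H.swap]
  exact cancel_left h1 (h1 ▸ H.nzl)

theorem not_id (H : RightSetup f h l) (g : P.Hom y c) : f ⊙ g ≠ P.id y :=
  fun h => H.ne (isId_of_comp_eq_id h).1.1.symm

theorem eq_zero_of_eq_pi (H : RightSetup f h l) {g : P.Hom y c} {j : ℕ}
    (hg : f ⊙ P.pipow c j ⊙ g = P.pi y) : j = 0 := by
  obtain ⟨s, hs⟩ := P.endo_cyclic y (f ⊙ g)
  obtain ⟨r, hr⟩ := P.endo_cyclic c (g ⊙ f)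
  have h1 : f ⊙ P.pipow c (j + r) = f ⊙ P.pipow c l := by
    rw [← H.swap, ← hg, ← pipow_comp_pipow, ← hr]
    simp only [P.assoc]
  have h2 := comp_pipow_inj h1 (h1 ▸ H.nzl)
  have h3 : f ⊙ P.pipow c r = f ⊙ P.pipow c (l * s) := by
    rw [← hr, ← P.assoc, hs, pipow_comp_swap H.swap]
  have h4 : f ⊙ P.pipow c r ≠ P.zero c y := by
    have := H.nzl
    rw [← h2, add_comm, pipow_add, ← P.assoc] at this
    exact left_ne_zero this
  have h5 := comp_pipow_inj h3 h4
  rcases s with _ | _ | s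
  · exact absurd (hs.trans (P.pipow_zero y)) (H.not_id g)
  · omega
  · have : l * (s + 1 + 1) = l * s + l + l := by ring
    have := H.two_le
    omega

theorem h_pipow (H : RightSetup f h l) (k : ℕ) :
    h ⊙ P.pipow y k = P.pipow c (l * k) ⊙ h := by
  induction k with
  | zero => rw [Nat.mul_zero, P.pipow_zero, P.pipow_zero, P.id_comp, P.comp_id]
  | succ k ih =>
    rw [← pipow_comp_pipow, ← P.assoc, ih, ← pi_def, ← H.fh, P.assoc, ← P.assoc h, H.hf,
      pipow_comp_pipow_comp]
    rfl

theorem gen_back (H : RightSetup f h l) (g : P.Hom y c) : ∃ i, g = P.pipow c i ⊙ h := by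
  obtain ⟨g', h1 | h1⟩ := P.hom_cyclic y c
  · obtain ⟨j, hj⟩ := h1 h
    have h2 : f ⊙ P.pipow c j ⊙ g' = P.pi y := by rw [← hj, H.fh]
    obtain rfl := H.eq_zero_of_eq_pi h2
    rw [P.pipow_zero, P.id_comp] at hj
    rw [hj]
    exact h1 g
  · exfalso
    obtain ⟨j, hj⟩ := h1 h
    obtain ⟨s, hs⟩ := P.endo_cyclic y (f ⊙ g')
    have h2 : P.pipow y (s + j) = P.pipow y 1 := by
      rw [pipow_add, ← hs, P.assoc, ← hj, H.fh, pi_def]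
    have h3 := pipow_inj h2 (h2 ▸ pipow_ne_zero_of_le (by omega) H.sq)
    have h4 : s ≠ 0 := by
      rintro rfl
      exact H.not_id g' (hs.trans (P.pipow_zero y))
    obtain rfl : j = 0 := by omega
    rw [P.pipow_zero, P.comp_id] at hj
    subst hj
    obtain ⟨s, hs⟩ := h1 (P.pipow c 1 ⊙ h)
    have h5 : ∀ m, P.pipow c m ⊙ h = h ⊙ P.pipow y (s * m) := by
      intro m
      induction m with
      | zero => rw [Nat.mul_zero, P.pipow_zero, P.pipow_zero, P.id_comp, P.comp_id]
      | succ m ih =>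
        rw [← pipow_comp_pipow, P.assoc, hs, ← P.assoc, ih, P.assoc, pipow_comp_pipow]
        rfl
    have h6 := h5 l
    have h7 := H.h_pipow 1
    rw [mul_one, h6] at h7
    have h8 : h ⊙ P.pipow y 1 ≠ P.zero y c := by
      have := H.sq'
      rw [← P.assoc, H.fh, ← H.fh, P.assoc, H.fh, pi_def] at this
      exact right_ne_zero this
    have h9 := comp_pipow_inj h7 h8
    have := H.two_le
    have := Nat.eq_one_of_mul_eq_one_left h9.symm
    omega

theorem comp_zero_of_not_dvd (H : RightSetup f h l) {r : ℕ} (hr : ¬ l ∣ r) :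
    f ⊙ P.pipow c r ⊙ h = P.zero y y := by
  by_contra h0
  obtain ⟨k, hk⟩ := P.endo_cyclic y (f ⊙ P.pipow c r ⊙ h)
  have h1 : f ⊙ P.pipow c (r + l) = f ⊙ P.pipow c (l * k) := by
    rw [← pipow_comp_swap H.swap, ← hk, ← pipow_comp_pipow, ← H.hf]
    simp only [P.assoc]
  by_cases h2 : f ⊙ P.pipow c (r + l) = P.zero c y
  · have h3 : P.pipow y (k + 1) = P.zero y y := by
      rw [pipow_add, ← pi_def, ← H.fh, ← P.assoc, pipow_comp_swap H.swap, ← h1, h2, P.zero_comp]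
    obtain ⟨k, rfl⟩ : ∃ k', k = k' + 1 := by
      refine Nat.exists_eq_succ_of_ne_zero ?_
      rintro rfl
      exact pipow_ne_zero_of_le (by omega) H.sq h3
    have h4 : f ⊙ (P.pipow c r ⊙ h) = f ⊙ (P.pipow c (l * k) ⊙ h) := by
      rw [hk, ← H.h_pipow, ← P.assoc, H.fh, pi_def, pipow_comp_pipow, add_comm]
    have h5 := cancel_left h4 h0
    exact hr ⟨k, pipow_comp_inj h5 (right_ne_zero h0)⟩
  · have := comp_pipow_inj h1 h2
    exact hr ((Nat.dvd_add_left (dvd_refl l)).1 ⟨k, this⟩)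

end RightSetup

end RayCategory

namespace RayCategory

variable {P : RayCategory}

/-- the order on the points of the family attached to a right cyclic arrow -/
def rightLe (l : ℕ) (s t : Fin 6) : Prop :=
  s = t ∨ (s = 0 ∧ (t = 2 ∨ t = 3 ∨ t = 4)) ∨ (s = 1 ∧ (t = 2 ∨ t = 3 ∨ t = 4 ∨ t = 5)) ∨
    (s = 2 ∧ (t = 3 ∨ t = 4)) ∨ (s = 5 ∧ t = 4 ∧ l = 2)

def rightKind : Fin 6 → Kind :=
  ![.sub 0, .sub 1, .full, .quot 2, .quot 3, .sub 1]

def rightOb : Fin 6 → Fin 2 := ![1, 0, 0, 1, 0, 1]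

def rightDeg (l : ℕ) : Fin 6 → ℕ := ![l + 1, 2, 1, 1, 0, 2]

theorem rightShape (l : ℕ) :
    Shape (rightLe l) (ℚ × ℚ) (fun q t => Kind.proj q (rightKind t)) := by
  refine Kind.shape_of_root rightKind ?_ 2 ?_ ?_ ?_ rfl ?_
  · intro s t u h1 h2
    unfold rightLe at h1 h2
    fin_cases s <;> fin_cases t <;> simp at h1 <;> fin_cases u <;>
      simp [rightKind] at h2 ⊢
  · intro t h
    fin_cases t <;> simp [rightKind, rightLe] at h ⊢
  · intro t i h
    fin_cases t <;> simp [rightKind] at h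
    · exact Or.inl ⟨2, rfl, by simp [rightLe]⟩
    · exact Or.inl ⟨2, rfl, by simp [rightLe]⟩
    · exact Or.inr ⟨1, 2, by simp [rightKind, h], rfl, by simp [rightLe], by simp [rightLe]⟩
  · intro t i h
    fin_cases t <;> simp [rightKind] at h
    · exact ⟨2, rfl, by simp [rightLe]⟩
    · exact ⟨2, rfl, by simp [rightLe]⟩
  · intro i
    fin_cases i
    · exact ⟨0, by simp [rightKind]⟩
    · exact ⟨1, by simp [rightKind]⟩
    · exact ⟨3, by simp [rightKind]⟩
    · exact ⟨4, by simp [rightKind]⟩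


theorem rightConv {l : ℕ} (hl : 2 ≤ l) (s u : Fin 6) (j : Fin 2) (q r : ℕ) (hle : rightLe l s u)
    (h1 : rightDeg l s = rightDeg l u + (q + r))
    (h2 : (rightOb s = 1 ∧ j = 0 → l ≤ q) ∧ (rightOb s = 1 ∧ j = 1 → q = 0 ∨ l ≤ q))
    (h3 : (j = 1 ∧ rightOb u = 0 → l ≤ r) ∧ (j = 1 ∧ rightOb u = 1 → r = 0 ∨ l ≤ r)) :
    ∃ t, rightOb t = j ∧ rightLe l s t ∧ rightLe l t u ∧ rightDeg l t = rightDeg l u + r := by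
  have hr : r = 0 ∨ r = 1 ∨ r = 2 ∨ 3 ≤ r := by omega
  have hq : q = 0 ∨ q = 1 ∨ q = 2 ∨ 3 ≤ q := by omega
  have hl2 : l = 2 ∨ 3 ≤ l := by omega
  unfold rightLe at hle
  fin_cases s <;> fin_cases u <;> simp at hle <;> fin_cases j <;>
    simp [rightOb] at h2 h3 <;> simp [rightDeg] at h1 <;>
    rcases hl2 with rfl | hl2 <;> rcases hr with rfl | rfl | rfl | hr <;>
    rcases hq with rfl | rfl | rfl | hq <;>
    first
    | omega
    | (refine ⟨0, rfl, ?_, ?_, ?_⟩ <;> simp [rightLe, rightDeg] <;> omega)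
    | (refine ⟨1, rfl, ?_, ?_, ?_⟩ <;> simp [rightLe, rightDeg] <;> omega)
    | (refine ⟨2, rfl, ?_, ?_, ?_⟩ <;> simp [rightLe, rightDeg] <;> omega)
    | (refine ⟨3, rfl, ?_, ?_, ?_⟩ <;> simp [rightLe, rightDeg] <;> omega)
    | (refine ⟨4, rfl, ?_, ?_, ?_⟩ <;> simp [rightLe, rightDeg] <;> omega)
    | (refine ⟨5, rfl, ?_, ?_, ?_⟩ <;> simp [rightLe, rightDeg] <;> omega)

theorem RightSetup.not_repFin {c y : P.Obj} {f : P.Hom c y} {h : P.Hom y c} {l : ℕ}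
    {D : Set P.Obj} {I : ∀ a b : P.Obj, P.Hom a b → Prop} (H : RightSetup f h l) (hD : D.Finite)
    (hI1 : ∀ (a b c : P.Obj) (g : P.Hom b c) (f : P.Hom a b), I a b f → I a c (g ⊙ f))
    (hI2 : ∀ (a b c : P.Obj) (g : P.Hom b c) (f : P.Hom a b), I b c g → I a c (g ⊙ f))
    (hI : ∀ (s t : P.Obj) (f : P.Hom s t), I s t f → ∃ (g : P.Hom y t) (e : P.Hom s y),
      f = g ⊙ P.pipow y 2 ⊙ e)
    (hc : c ∈ D) (hy : y ∈ D) : ¬ RepFin P D I := by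
  classical
  obtain ⟨S, h00, h01, h10, h11⟩ := exists_table H.ne (fun p => P.pipow c p)
    (fun p => f ⊙ P.pipow c p) (fun p => if l ≤ p then P.pipow c (p - l) ⊙ h else P.zero y c)
    (fun p => if l ∣ p then P.pipow y (p / l) else P.zero y y)
  have hl := H.two_le
  have l0 : 0 < l := by omega
  have s00 : ∀ p, S c c p = P.pipow c p := fun p => congrFun h00 p
  have s01 : ∀ p, S c y p = f ⊙ P.pipow c p := fun p => congrFun h01 p
  have s10' : ∀ p, S y c p = if l ≤ p then P.pipow c (p - l) ⊙ h else P.zero y c :=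
    fun p => congrFun h10 p
  have s11' : ∀ p, S y y p = if l ∣ p then P.pipow y (p / l) else P.zero y y :=
    fun p => congrFun h11 p
  have s10 : ∀ p, S y c (l + p) = P.pipow c p ⊙ h := by
    intro p
    rw [s10', if_pos (by omega), Nat.add_sub_cancel_left]
  have s11 : ∀ p, S y y (l * p) = P.pipow y p := by
    intro p
    rw [s11', if_pos ⟨p, rfl⟩, Nat.mul_div_cancel_left _ l0]
  have n10 : ∀ p, S y c p ≠ P.zero _ _ → ∃ j, p = l + j := by
    intro p hp
    rw [s10'] at hp
    by_cases h : l ≤ p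
    · exact ⟨p - l, by omega⟩
    · rw [if_neg h] at hp
      exact absurd rfl hp
  have n11 : ∀ p, S y y p ≠ P.zero _ _ → ∃ j, p = l * j := by
    intro p hp
    by_contra h
    rw [s11', if_neg (fun ⟨m, hm⟩ => h ⟨m, hm⟩)] at hp
    exact absurd rfl hp
  have t00 : ∀ g : P.Hom c c, g ≠ P.zero _ _ → ∃ p, g = S _ _ p := by
    intro g hg
    obtain ⟨p, hp⟩ := P.endo_cyclic _ g
    exact ⟨p, by rw [s00]; exact hp⟩
  have t01 : ∀ g : P.Hom c y, g ≠ P.zero _ _ → ∃ p, g = S _ _ p := by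
    intro g hg
    obtain ⟨p, hp⟩ := H.gen g
    exact ⟨p, by rw [s01]; exact hp⟩
  have t10 : ∀ g : P.Hom y c, g ≠ P.zero _ _ → ∃ p, g = S _ _ p := by
    intro g hg
    obtain ⟨p, hp⟩ := H.gen_back g
    exact ⟨l + p, by rw [s10]; exact hp⟩
  have t11 : ∀ g : P.Hom y y, g ≠ P.zero _ _ → ∃ p, g = S _ _ p := by
    intro g hg
    obtain ⟨p, hp⟩ := P.endo_cyclic _ g
    exact ⟨l * p, by rw [s11]; exact hp⟩
  have c000 : ∀ p q, S c c p ≠ P.zero _ _ → S c c q ≠ P.zero _ _ →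
      S c c q ⊙ S c c p = S c c (p + q) := by
    intro p q hp hq
    rw [s00, s00, s00, pipow_comp_pipow, add_comm]
  have c001 : ∀ p q, S c c p ≠ P.zero _ _ → S c y q ≠ P.zero _ _ →
      S c y q ⊙ S c c p = S c y (p + q) := by
    intro p q hp hq
    rw [s00, s01, s01, P.assoc, pipow_comp_pipow, add_comm]
  have c010 : ∀ p q, S c y p ≠ P.zero _ _ → S y c q ≠ P.zero _ _ →
      S y c q ⊙ S c y p = S c c (p + q) := by
    intro p q hp hq
    obtain ⟨q, rfl⟩ := n10 _ hq
    rw [s01, s10, s00, P.assoc, ← P.assoc h, H.hf, pipow_comp_pipow, pipow_comp_pipow]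
    congr 1
    omega
  have c011 : ∀ p q, S c y p ≠ P.zero _ _ → S y y q ≠ P.zero _ _ →
      S y y q ⊙ S c y p = S c y (p + q) := by
    intro p q hp hq
    obtain ⟨q, rfl⟩ := n11 _ hq
    rw [s01, s01, s11, ← P.assoc, pipow_comp_swap H.swap, P.assoc, pipow_comp_pipow, add_comm]
  have c100 : ∀ p q, S y c p ≠ P.zero _ _ → S c c q ≠ P.zero _ _ →
      S c c q ⊙ S y c p = S y c (p + q) := by
    intro p q hp hq
    obtain ⟨p, rfl⟩ := n10 _ hp
    rw [s10, s00, show l + p + q = l + (q + p) by omega, s10, pipow_comp_pipow_comp]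
  have c101 : ∀ p q, S y c p ≠ P.zero _ _ → S c y q ≠ P.zero _ _ →
      S c y q ⊙ S y c p = S y y (p + q) := by
    intro p q hp hq
    obtain ⟨p, rfl⟩ := n10 _ hp
    rw [s10, s01, P.assoc, pipow_comp_pipow_comp]
    by_cases hd : l ∣ q + p
    · obtain ⟨m, hm⟩ := hd
      rw [hm, show l + p + q = l * (m + 1) by rw [mul_add]; omega, s11, ← H.h_pipow, ← P.assoc,
        H.fh, pi_def, pipow_comp_pipow, add_comm]
    · rw [H.comp_zero_of_not_dvd hd, s11', if_neg]
      rwa [show l + p + q = l + (q + p) by omega, Nat.dvd_add_right (dvd_refl l)]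
  have c110 : ∀ p q, S y y p ≠ P.zero _ _ → S y c q ≠ P.zero _ _ →
      S y c q ⊙ S y y p = S y c (p + q) := by
    intro p q hp hq
    obtain ⟨p, rfl⟩ := n11 _ hp
    obtain ⟨q, rfl⟩ := n10 _ hq
    rw [s11, s10, show l * p + (l + q) = l + (q + l * p) by omega, s10, P.assoc, H.h_pipow,
      pipow_comp_pipow_comp]
  have c111 : ∀ p q, S y y p ≠ P.zero _ _ → S y y q ≠ P.zero _ _ →
      S y y q ⊙ S y y p = S y y (p + q) := by
    intro p q hp hq
    obtain ⟨p, rfl⟩ := n11 _ hp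
    obtain ⟨q, rfl⟩ := n11 _ hq
    rw [s11, s11, ← mul_add, s11, pipow_comp_pipow, add_comm]
  have j00 : ∀ p q, S c c p = S c c q → S c c p ≠ P.zero _ _ → p = q := by
    intro p q he h0
    rw [s00] at h0
    rw [s00, s00] at he
    exact pipow_inj he h0
  have j01 : ∀ p q, S c y p = S c y q → S c y p ≠ P.zero _ _ → p = q := by
    intro p q he h0
    rw [s01] at h0
    rw [s01, s01] at he
    exact comp_pipow_inj he h0
  have j10 : ∀ p q, S y c p = S y c q → S y c p ≠ P.zero _ _ → p = q := by
    intro p q he h0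
    obtain ⟨p, rfl⟩ := n10 _ h0
    obtain ⟨q, rfl⟩ := n10 _ (he ▸ h0)
    rw [s10] at h0
    rw [s10, s10] at he
    rw [pipow_comp_inj he h0]
  have j11 : ∀ p q, S y y p = S y y q → S y y p ≠ P.zero _ _ → p = q := by
    intro p q he h0
    obtain ⟨p, rfl⟩ := n11 _ h0
    obtain ⟨q, rfl⟩ := n11 _ (he ▸ h0)
    rw [s11] at h0
    rw [s11, s11] at he
    rw [pipow_inj he h0]
  have i0 : S c c 0 = P.id _ := (s00 0).trans (P.pipow_zero c)
  have i1 : S y y 0 = P.id _ := by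
    have := s11 0
    rw [mul_zero] at this
    exact this.trans (P.pipow_zero y)
  have hnl := H.nzl
  have ncl : P.pipow c l ≠ P.zero c c := right_ne_zero hnl
  have n0 : h ≠ P.zero y c := by
    have := H.sq'
    exact right_ne_zero (right_ne_zero (right_ne_zero this))
  have n1 : P.pipow c 1 ⊙ h ≠ P.zero y c := by
    have h1 : P.pipow c l ⊙ h ≠ P.zero y c := by
      have := H.sq'
      rw [← P.assoc h, H.hf] at this
      exact right_ne_zero this
    rw [show l = (l - 1) + 1 by omega, ← pipow_comp_pipow, P.assoc] at h1
    exact right_ne_zero h1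
  have nf : ∀ p, p ≤ l → f ⊙ P.pipow c p ≠ P.zero c y := by
    intro p hp
    rw [show l = p + (l - p) by omega, ← pipow_comp_pipow, ← P.assoc] at hnl
    exact left_ne_zero hnl
  have E00 : ∀ p, p ≤ 2 → S c c p ≠ P.zero _ _ := by
    intro p hp
    rw [s00]
    exact pipow_ne_zero_of_le (by omega) ncl
  have E01 : ∀ p, p ≤ 1 → S c y p ≠ P.zero _ _ := by
    intro p hp
    rw [s01]
    exact nf p (by omega)
  have E10 : S y c l ≠ P.zero _ _ := by
    have := s10 0
    rw [P.pipow_zero, P.id_comp, add_zero] at this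
    rw [this]
    exact n0
  have E10' : S y c (l + 1) ≠ P.zero _ _ := by
    rw [s10]
    exact n1
  have E11 : S y y l ≠ P.zero _ _ := by
    have := s11 1
    rw [mul_one] at this
    rw [this]
    exact pipow_ne_zero_of_le (by omega) H.sq
  have E11' : S y y 0 ≠ P.zero _ _ := by
    rw [i1]
    exact id_ne_zero _
  have sq0 : P.pipow y 2 = S y y (l * 2) := (s11 2).symm
  clear s00 s01 s10' s11' s10 s11 h00 h01 h10 h11 hnl ncl n0 n1 nf
  set o : Fin 2 → P.Obj := ![c, y] with ho
  have total : ∀ i j (g : P.Hom (o i) (o j)), g ≠ P.zero _ _ → ∃ p, g = S _ _ p := by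
    simp only [Fin.forall_fin_two]
    exact ⟨⟨t00, t01⟩, ⟨t10, t11⟩⟩
  have scomp : ∀ i j m p q, S (o i) (o j) p ≠ P.zero _ _ → S (o j) (o m) q ≠ P.zero _ _ →
      S (o j) (o m) q ⊙ S (o i) (o j) p = S (o i) (o m) (p + q) := by
    simp only [Fin.forall_fin_two]
    exact ⟨⟨⟨c000, c001⟩, ⟨c010, c011⟩⟩, ⟨⟨c100, c101⟩, ⟨c110, c111⟩⟩⟩
  have sinj : ∀ i j p q, S (o i) (o j) p = S (o i) (o j) q → S (o i) (o j) p ≠ P.zero _ _ →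
      p = q := by
    simp only [Fin.forall_fin_two]
    exact ⟨⟨j00, j01⟩, ⟨j10, j11⟩⟩
  have sid : ∀ i, S (o i) (o i) 0 = P.id _ := by
    simp only [Fin.forall_fin_two]
    exact ⟨i0, i1⟩
  have kill : ∀ i j p, S (o i) (o j) p ≠ P.zero _ _ → I _ _ (S (o i) (o j) p) → 2 * l ≤ p := by
    intro i j p h0 hp
    obtain ⟨g, e, he⟩ : ∃ (g : P.Hom (o 1) (o j)) (e : P.Hom (o i) (o 1)),
      S (o i) (o j) p = g ⊙ S (o 1) (o 1) (l * 2) ⊙ e := by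
      obtain ⟨g, e, he⟩ := hI _ _ _ hp
      exact ⟨g, e, sq0 ▸ he⟩
    have h1 := h0
    rw [he] at h1
    obtain ⟨q, rfl⟩ := total 1 j g (left_ne_zero h1)
    obtain ⟨r, rfl⟩ := total i 1 e (right_ne_zero (right_ne_zero h1))
    have h3 := right_ne_zero h1
    have h4 := right_ne_zero h3
    have h5 := left_ne_zero h3
    have h6 := left_ne_zero h1
    rw [scomp i 1 1 _ _ h4 h5] at h1 he h3
    rw [scomp i 1 j _ _ h3 h6] at h1 he
    have := sinj i j _ _ he h0
    omega
  refine not_repFin_of_std (o := o) (ob := rightOb) (deg := rightDeg l) hD hI1 hI2 ?_ ?_ S total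
    sinj sid scomp ?_ ?_ ?_ ?_
    (fun i j p => (i = 1 ∧ j = 0 → l ≤ p) ∧ (i = 1 ∧ j = 1 → p = 0 ∨ l ≤ p)) ?_ ?_ (rightShape l)
  · intro i j hij
    fin_cases i <;> fin_cases j
    · rfl
    · exact absurd hij H.ne
    · exact absurd hij.symm H.ne
    · rfl
  · simp only [Fin.forall_fin_two]
    exact ⟨hc, hy⟩
  · intro s t h1 h2
    fin_cases s <;> fin_cases t <;> simp [rightOb, rightDeg] at h1 h2 ⊢ <;> omega
  · exact fun t => Or.inl rfl
  · intro s t u h1 h2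
    unfold rightLe at h1 h2
    fin_cases s <;> fin_cases t <;> simp at h1 <;> fin_cases u <;> simp at h2 <;>
      simp [rightLe] <;> omega
  · intro s t hst
    have key : rightDeg l t ≤ rightDeg l s ∧ rightDeg l s - rightDeg l t < 2 * l ∧
        S (o (rightOb s)) (o (rightOb t)) (rightDeg l s - rightDeg l t) ≠ P.zero _ _ := by
      unfold rightLe at hst
      rcases hst with rfl | hst
      · refine ⟨le_rfl, by omega, ?_⟩
        rw [Nat.sub_self, sid]
        exact id_ne_zero _
      rcases hst with ⟨rfl, rfl | rfl | rfl⟩ | ⟨rfl, rfl | rfl | rfl | rfl⟩ | ⟨rfl, rfl | rfl⟩ |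
        ⟨rfl, rfl, rfl⟩
      · exact ⟨show 1 ≤ l + 1 by omega, show l + 1 - 1 < 2 * l by omega, E10⟩
      · exact ⟨show 1 ≤ l + 1 by omega, show l + 1 - 1 < 2 * l by omega, E11⟩
      · exact ⟨show 0 ≤ l + 1 by omega, show l + 1 - 0 < 2 * l by omega, E10'⟩
      · exact ⟨show 1 ≤ 2 by omega, show 2 - 1 < 2 * l by omega, E00 1 (by omega)⟩
      · exact ⟨show 1 ≤ 2 by omega, show 2 - 1 < 2 * l by omega, E01 1 (by omega)⟩
      · exact ⟨show 0 ≤ 2 by omega, show 2 - 0 < 2 * l by omega, E00 2 (by omega)⟩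
      · exact ⟨show 2 ≤ 2 by omega, show 2 - 2 < 2 * l by omega, E01 0 (by omega)⟩
      · exact ⟨show 1 ≤ 1 by omega, show 1 - 1 < 2 * l by omega, E01 0 (by omega)⟩
      · exact ⟨show 0 ≤ 1 by omega, show 1 - 0 < 2 * l by omega, E00 1 (by omega)⟩
      · exact ⟨show 0 ≤ 2 by omega, show 2 - 0 < 2 * 2 by omega, E10⟩
    refine ⟨key.1, key.2.2, fun h => ?_⟩
    have := kill _ _ _ key.2.2 h
    omega
  · intro i j p hp
    constructor
    · rintro ⟨rfl, rfl⟩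
      obtain ⟨m, rfl⟩ := n10 _ hp
      omega
    · rintro ⟨rfl, rfl⟩
      obtain ⟨m, rfl⟩ := n11 _ hp
      rcases m with _ | m
      · left; rfl
      · right; rw [mul_add]; omega
  · exact rightConv hl

end RayCategory

theorem forall_fin_three {p : Fin 3 → Prop} : (∀ i, p i) ↔ p 0 ∧ p 1 ∧ p 2 := by
  constructor
  · exact fun h => ⟨h 0, h 1, h 2⟩
  · rintro ⟨h0, h1, h2⟩ i
    fin_cases i
    · exact h0
    · exact h1
    · exact h2

namespace RayCategory

variable {P : RayCategory}

theorem exists_targets {a b y : P.Obj} (hab : a ≠ b) (hay : a ≠ y) (hby : b ≠ y)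
    (A : ℕ → P.Hom a y) (B : ℕ → P.Hom b y) (E : ℕ → P.Hom y y) :
    ∃ S : ∀ s : P.Obj, ℕ → P.Hom s y, S a = A ∧ S b = B ∧ S y = E := by
  classical
  refine ⟨fun s m => if h : s = a then h ▸ A m else if h : s = b then h ▸ B m
    else if h : s = y then h ▸ E m else P.zero s y, ?_, ?_, ?_⟩ <;>
    · funext m
      simp [hab.symm, hay.symm, hby.symm]

/-- Two arrows into `y`, a left cyclic one through which the generator `π(y)` factors and one
which is right but not left cyclic. The number `m` is the least degree of a morphism from the
second tail to the first one. -/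
structure MixedSetup {a b y : P.Obj} (alp : P.Hom a y) (bet : P.Hom b y) (om : P.Hom y a)
    (l m : ℕ) : Prop where
  hab : a ≠ b
  hay : a ≠ y
  hby : b ≠ y
  halp : P.IsIrreducible alp
  hbet : P.IsIrreducible bet
  gena : ∀ g : P.Hom a y, ∃ i, g = P.pipow y i ⊙ alp
  genb : ∀ g : P.Hom b y, ∃ i, g = bet ⊙ P.pipow b i
  two_le : 2 ≤ l
  swap : P.pi y ⊙ bet = bet ⊙ P.pipow b l
  fac : alp ⊙ om = P.pi y
  nofac : ∀ g : P.Hom y b, bet ⊙ g ≠ P.pi y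
  sq : P.pipow y 2 ≠ P.zero y y
  nz : P.pi y ⊙ bet ≠ P.zero b y
  exm : ∃ g : P.Hom b a, alp ⊙ g = bet ⊙ P.pipow b m ∧ alp ⊙ g ≠ P.zero b y
  minm : ∀ (g : P.Hom b a) (p : ℕ), alp ⊙ g = bet ⊙ P.pipow b p → alp ⊙ g ≠ P.zero b y → m ≤ p
  m_le : m ≤ l

/-- lower bounds for degrees of morphisms between the points of a mixed setup -/
def MixedOk (l m : ℕ) (i j : Fin 3) (p : ℕ) : Prop :=
  ((i = 0 ∨ i = 2) → (i = j ∨ j = 2) → p = 0 ∨ l ≤ p) ∧ (i = 0 → j = 1 → l ≤ p) ∧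
    (i = 1 → j = 0 → m ≤ p) ∧ (i = 2 → j = 0 → l ≤ p) ∧ (i = 2 → j = 1 → 2 * l ≤ p)

/-- some degrees of morphisms between the points of a mixed setup -/
def MixedEx (l m : ℕ) (i j : Fin 3) (p : ℕ) : Prop :=
  (i = j ∧ p = 0) ∨ (i = 1 ∧ j = 1 ∧ p ≤ 2) ∨
    (i = 1 ∧ j = 0 ∧ (p = m ∨ (p = m + 1 ∧ m + 1 ≤ l))) ∨ (i = 1 ∧ j = 2 ∧ p ≤ 1) ∨
    (i = 0 ∧ j = 2 ∧ p = 0) ∨ (i = 2 ∧ j = 0 ∧ p = l) ∨ (i = 0 ∧ j = 0 ∧ p = l)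

namespace MixedSetup

variable {a b y : P.Obj} {alp : P.Hom a y} {bet : P.Hom b y} {om : P.Hom y a} {l m : ℕ}

theorem not_factor_alp (H : MixedSetup alp bet om l m) (f : P.Hom a b) (g : P.Hom b y) :
    g ⊙ f ≠ alp := by
  intro h
  rcases H.halp.2.2 _ _ _ h.symm with h1 | h1
  · exact H.hby h1.1
  · exact H.hab h1.1

variable {D : Set P.Obj} {I : ∀ a b : P.Obj, P.Hom a b → Prop} {n : ℕ}
  {W : Type} [AddCommGroup W] [Module ℚ W] [FiniteDimensional ℚ W]
  {e : ℚ → Fin n → W →ₗ[ℚ] W}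

theorem not_repFin_of_table [Nonempty (Fin n)] (H : MixedSetup alp bet om l m) (hD : D.Finite)
    (hI1 : ∀ (a b c : P.Obj) (g : P.Hom b c) (f : P.Hom a b), I a b f → I a c (g ⊙ f))
    (hI2 : ∀ (a b c : P.Obj) (g : P.Hom b c) (f : P.Hom a b), I b c g → I a c (g ⊙ f))
    (hI : ∀ (s t : P.Obj) (f : P.Hom s t), I s t f → ∃ (g : P.Hom y t) (e : P.Hom s y),
      f = g ⊙ P.pipow y 2 ⊙ e)
    (ha : a ∈ D) (hb : b ∈ D) (hy : y ∈ D)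
    {ob : Fin n → Fin 3} {deg : Fin n → ℕ} {le : Fin n → Fin n → Prop}
    (inj : ∀ s t, ob s = ob t → deg s = deg t → s = t) (refl : ∀ t, le t t)
    (trans : ∀ s t u, le s t → le t u → le s u)
    (hE : ∀ s t, le s t → deg t ≤ deg s ∧ deg s ≤ deg t + l ∧
      MixedEx l m (ob s) (ob t) (deg s - deg t))
    (hmix : ∀ s u, le s u → ob s ≠ 1 → ob u ≠ 1 ∧ (deg s = deg u ∨ (deg s = deg u + l ∧
      ob u = 0 ∧ (ob s = 2 ∨ m = l))))
    (conv : ∀ s u j q r, le s u → deg s = deg u + (q + r) → MixedOk l m (ob s) j q →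
      MixedOk l m j (ob u) r → ∃ t, ob t = j ∧ le s t ∧ le t u ∧ deg t = deg u + r)
    (hS : Shape le W e) : ¬ RepFin P D I := by
  classical
  obtain ⟨S, h0, h1, h2⟩ := exists_targets H.hab H.hay H.hby
    (fun p => if l ∣ p then P.pipow y (p / l) ⊙ alp else P.zero a y)
    (fun p => bet ⊙ P.pipow b p)
    (fun p => if l ∣ p then P.pipow y (p / l) else P.zero y y)
  have hl := H.two_le
  have l0 : 0 < l := by omega
  have sb : ∀ p, S b p = bet ⊙ P.pipow b p := fun p => congrFun h1 p
  have sa : ∀ k, S a (l * k) = P.pipow y k ⊙ alp := by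
    intro k
    rw [h0]
    simp only
    rw [if_pos ⟨k, rfl⟩, Nat.mul_div_cancel_left _ l0]
  have sy : ∀ k, S y (l * k) = P.pipow y k := by
    intro k
    rw [h2]
    simp only
    rw [if_pos ⟨k, rfl⟩, Nat.mul_div_cancel_left _ l0]
  have na : ∀ p, S a p ≠ P.zero a y → ∃ k, p = l * k := by
    intro p hp
    by_contra h
    rw [h0] at hp
    simp only at hp
    rw [if_neg (fun ⟨m, hm⟩ => h ⟨m, hm⟩)] at hp
    exact hp rfl
  have ny : ∀ p, S y p ≠ P.zero y y → ∃ k, p = l * k := by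
    intro p hp
    by_contra h
    rw [h2] at hp
    simp only at hp
    rw [if_neg (fun ⟨m, hm⟩ => h ⟨m, hm⟩)] at hp
    exact hp rfl
  clear h0 h1 h2
  have sa0 : S a 0 = alp := by
    have := sa 0
    rwa [mul_zero, P.pipow_zero, P.id_comp] at this
  have sb0 : S b 0 = bet := by rw [sb, P.pipow_zero, P.comp_id]
  have sy0 : S y 0 = P.id y := by
    have := sy 0
    rwa [mul_zero, P.pipow_zero] at this
  have sa1 : S a l = P.pi y ⊙ alp := by
    have := sa 1
    rwa [mul_one] at this
  have sy1 : S y l = P.pi y := by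
    have := sy 1
    rwa [mul_one] at this
  have za1 : S a l ≠ P.zero a y := by
    have := H.sq
    rw [← pipow_comp_pipow y 1 1, ← pi_def] at this
    nth_rw 2 [← H.fac] at this
    rw [← P.assoc] at this
    rw [sa1]
    exact left_ne_zero this
  have za0 : S a 0 ≠ P.zero a y := by
    rw [sa1] at za1
    rw [sa0]
    exact right_ne_zero za1
  have zy1 : S y l ≠ P.zero y y := by
    rw [sy1]
    exact pipow_ne_zero_of_le (by omega) H.sq
  have zy0 : S y 0 ≠ P.zero y y := by
    rw [sy0]
    exact id_ne_zero _
  have zb : ∀ p, p ≤ l → S b p ≠ P.zero b y := by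
    intro p hp
    have := H.nz
    rw [H.swap, show l = p + (l - p) by omega, ← pipow_comp_pipow, ← P.assoc] at this
    rw [sb]
    exact left_ne_zero this
  set o : Fin 3 → P.Obj := ![a, b, y] with ho
  have oinj : Function.Injective o := by
    intro i j hij
    fin_cases i <;> fin_cases j
    · rfl
    · exact absurd hij H.hab
    · exact absurd hij H.hay
    · exact absurd hij.symm H.hab
    · rfl
    · exact absurd hij H.hby
    · exact absurd hij.symm H.hay
    · exact absurd hij.symm H.hby
    · rfl
  have z0 : ∀ i, S (o i) 0 ≠ P.zero (o i) y := by
    rw [forall_fin_three]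
    exact ⟨za0, zb 0 (by omega), zy0⟩
  have zl : ∀ i p, (i = 1 → p ≤ l) → (i ≠ 1 → p = 0 ∨ p = l) → S (o i) p ≠ P.zero (o i) y := by
    rw [forall_fin_three]
    refine ⟨fun p _ h => ?_, fun p h _ => zb p (h rfl), fun p _ h => ?_⟩
    · rcases h (by decide) with rfl | rfl
      · exact za0
      · exact za1
    · rcases h (by decide) with rfl | rfl
      · exact zy0
      · exact zy1
  have total : ∀ i (f : P.Hom (o i) y), f ≠ P.zero _ _ → ∃ p, f = S (o i) p := by
    rw [forall_fin_three]
    refine ⟨fun f _ => ?_, fun f _ => ?_, fun f _ => ?_⟩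
    · obtain ⟨k, hk⟩ := H.gena f
      exact ⟨l * k, hk.trans (sa k).symm⟩
    · obtain ⟨k, hk⟩ := H.genb f
      exact ⟨k, hk.trans (sb k).symm⟩
    · obtain ⟨k, hk⟩ := P.endo_cyclic _ f
      exact ⟨l * k, hk.trans (sy k).symm⟩
  have suniq : ∀ i p q, S (o i) p = S (o i) q → S (o i) p ≠ P.zero _ _ → p = q := by
    rw [forall_fin_three]
    refine ⟨fun p q he hz => ?_, fun p q he hz => ?_, fun p q he hz => ?_⟩
    · obtain ⟨p, rfl⟩ := na p hz
      obtain ⟨q, rfl⟩ := na q (he ▸ hz)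
      have h3 := (sa p).symm.trans (he.trans (sa q))
      rw [pipow_comp_inj h3 (fun h => hz ((sa p).trans h))]
    · have h3 := (sb p).symm.trans (he.trans (sb q))
      exact comp_pipow_inj h3 (fun h => hz ((sb p).trans h))
    · obtain ⟨p, rfl⟩ := ny p hz
      obtain ⟨q, rfl⟩ := ny q (he ▸ hz)
      have h3 := (sy p).symm.trans (he.trans (sy q))
      rw [pipow_inj h3 (fun h => hz ((sy p).trans h))]
  have shift : ∀ i k p, S (o i) p ≠ P.zero _ _ → P.pipow y k ⊙ S (o i) p = S (o i) (p + l * k) := by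
    rw [forall_fin_three]
    refine ⟨fun k p hz => ?_, fun k p hz => ?_, fun k p hz => ?_⟩
    · change P.pipow y k ⊙ S a p = S a (p + l * k)
      obtain ⟨p, rfl⟩ := na p hz
      rw [← mul_add, sa, sa, pipow_comp_pipow_comp, add_comm]
    · change P.pipow y k ⊙ S b p = S b (p + l * k)
      rw [sb, sb, ← P.assoc, pipow_comp_swap H.swap, P.assoc, pipow_comp_pipow, add_comm]
    · change P.pipow y k ⊙ S y p = S y (p + l * k)
      obtain ⟨p, rfl⟩ := ny p hz
      rw [← mul_add, sy, sy, pipow_comp_pipow, add_comm]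
  have base : ∀ j, j ≠ 1 → ∀ q, S (o j) q ≠ P.zero _ _ →
      ∃ k, q = l * k ∧ S (o j) q = P.pipow y k ⊙ S (o j) 0 := by
    rw [forall_fin_three]
    refine ⟨fun _ q hq => ?_, fun h => absurd rfl h, fun _ q hq => ?_⟩
    · obtain ⟨k, rfl⟩ := na q hq
      refine ⟨k, rfl, (sa k).trans ?_⟩
      exact congrArg (fun t => P.pipow y k ⊙ t) sa0.symm
    · obtain ⟨k, rfl⟩ := ny q hq
      refine ⟨k, rfl, (sy k).trans ?_⟩
      exact ((congrArg (fun t => P.pipow y k ⊙ t) sy0).trans (P.comp_id _)).symm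
  have act : ∀ i j, (j = 1 → i = 1) → ∀ (f : P.Hom (o i) (o j)) (p q : ℕ),
      S (o j) q ≠ P.zero _ _ → S (o j) 0 ⊙ f = S (o i) p → S (o j) 0 ⊙ f ≠ P.zero _ _ →
      S (o j) q ⊙ f = S (o i) (p + q) := by
    intro i j hij f p q hq hf hz
    by_cases hj : j = 1
    · obtain rfl := hij hj
      subst hj
      obtain ⟨k, hk⟩ := P.endo_cyclic b f
      change P.Hom b b at f
      change S b 0 ⊙ f = S b p at hf
      change S b 0 ⊙ f ≠ P.zero b y at hz
      change S b q ⊙ f = S b (p + q)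
      change f = P.pipow b k at hk
      subst hk
      rw [sb0] at hz
      rw [sb0, sb] at hf
      rw [sb, sb, P.assoc, pipow_comp_pipow, comp_pipow_inj hf hz, add_comm]
    · obtain ⟨k, rfl, hk⟩ := base j hj q hq
      rw [hk, P.assoc, hf, shift]
      rwa [hf] at hz
  have actz : ∀ i j, (j = 1 → i = 1) → ∀ (f : P.Hom (o i) (o j)) (q : ℕ),
      S (o j) q ⊙ f ≠ P.zero _ _ → S (o j) 0 ⊙ f ≠ P.zero _ _ := by
    intro i j hij f q hz
    by_cases hj : j = 1
    · obtain rfl := hij hj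
      subst hj
      obtain ⟨k, hk⟩ := P.endo_cyclic b f
      change P.Hom b b at f
      change S b q ⊙ f ≠ P.zero b y at hz
      change S b 0 ⊙ f ≠ P.zero b y
      change f = P.pipow b k at hk
      subst hk
      rw [sb, P.assoc, pipow_comp_pipow, add_comm, ← pipow_comp_pipow, ← P.assoc] at hz
      rw [sb0]
      exact left_ne_zero hz
    · obtain ⟨k, rfl, hk⟩ := base j hj q (left_ne_zero hz)
      rw [hk, P.assoc] at hz
      exact right_ne_zero hz
  obtain ⟨gm, hgm, hgm0⟩ := H.exm
  have ex : ∀ i j p, MixedEx l m i j p → ∃ f : P.Hom (o i) (o j),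
      S (o j) 0 ⊙ f = S (o i) p := by
    rintro i j p (⟨rfl, rfl⟩ | ⟨rfl, rfl, h⟩ | ⟨rfl, rfl, rfl | ⟨rfl, h⟩⟩ | ⟨rfl, rfl, h⟩ |
      ⟨rfl, rfl, rfl⟩ | ⟨rfl, rfl, rfl⟩ | ⟨rfl, rfl, rfl⟩)
    · exact ⟨P.id _, P.comp_id _⟩
    · refine ⟨P.pipow b p, ?_⟩
      change S b 0 ⊙ P.pipow b p = S b p
      rw [sb0, sb]
    · refine ⟨gm, ?_⟩
      change S a 0 ⊙ gm = S b p
      rw [sa0, sb, hgm]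
    · refine ⟨gm ⊙ P.pipow b 1, ?_⟩
      change S a 0 ⊙ gm ⊙ P.pipow b 1 = S b (m + 1)
      rw [sa0, ← P.assoc, hgm, sb, P.assoc, pipow_comp_pipow]
    · exact ⟨S b p, (congrArg (fun t => t ⊙ S b p) sy0).trans (P.id_comp _)⟩
    · exact ⟨alp, ((congrArg (fun t => t ⊙ alp) sy0).trans (P.id_comp _)).trans sa0.symm⟩
    · refine ⟨om, ?_⟩
      change S a 0 ⊙ om = S y p
      rw [sa0, sy1, H.fac]
    · refine ⟨om ⊙ alp, ?_⟩
      change S a 0 ⊙ om ⊙ alp = S a p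
      rw [sa0, sa1, ← P.assoc, H.fac]
  have exz : ∀ s t, le s t → S (o (ob s)) (deg s - deg t) ≠ P.zero _ _ := by
    intro s t hst
    have h3 := hE s t hst
    refine zl _ _ (fun _ => by omega) (fun h => ?_)
    have := (hmix s t hst h).2
    omega
  have excl : ∀ s u, le s u → ob s ≠ 1 → ∀ (f : P.Hom (o (ob s)) b) (g : P.Hom b (o (ob u))),
      S (o (ob u)) 0 ⊙ (g ⊙ f) ≠ S (o (ob s)) (deg s - deg u) := by
    intro s u hsu hs f g he
    obtain ⟨hu, h3⟩ := hmix s u hsu hs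
    have hs' : ob s = 0 ∨ ob s = 2 := by omega
    have hz := exz s u hsu
    rw [← P.assoc] at he
    obtain ⟨r, hr⟩ := H.genb (S (o (ob u)) 0 ⊙ g)
    rcases h3 with h3 | ⟨h3, h4, h5⟩
    · rw [show deg s - deg u = 0 by omega] at he
      generalize ob s = i at *
      rcases hs' with rfl | rfl
      · exact H.not_factor_alp f _ (he.trans sa0)
      · exact H.hby (isId_of_comp_eq_id (he.trans sy0)).1.1.symm
    · rw [show deg s - deg u = l by omega] at he hz
      generalize ob s = i at *
      rcases hs' with rfl | rfl
      · have h6 : m = l := by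
          rcases h5 with h5 | h5
          · exact absurd h5 (by decide)
          · exact h5
        generalize ob u = i at *
        subst h4
        change P.Hom a b at f
        change P.Hom b a at g
        have h7 : (alp ⊙ g) ⊙ f = P.pi y ⊙ alp := by
          rw [← sa1, ← sa0]
          exact he
        have h8 : alp ⊙ g = bet ⊙ P.pipow b r := by
          rw [← sa0]
          exact hr
        have h9 : (alp ⊙ g) ⊙ f ≠ P.zero a y := by
          rw [h7, ← sa1]
          exact hz
        have h10 := H.minm g r h8 (left_ne_zero h9)
        rw [h8, show r = l + (r - l) by omega, ← pipow_comp_pipow, ← P.assoc, ← H.swap, P.assoc,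
          P.assoc] at h7
        refine H.not_factor_alp f (bet ⊙ P.pipow b (r - l)) ?_
        rw [P.assoc]
        refine cancel_left h7 ?_
        rw [h7, ← sa1]
        exact hz
      · rw [hr, P.assoc] at he
        exact H.nofac _ (he.trans sy1)
  refine not_repFin_of_deg (o := o) (ob := ob) (deg := deg) (le := le) (e := e)
    (Dg := fun {c d} f p => S d 0 ⊙ f = S c p ∧ S d 0 ⊙ f ≠ P.zero c y)
    hD hI1 hI2 oinj ?_ ?_ ?_ ?_ inj refl trans ?_ ?_ ?_ ?_ (MixedOk l m) ?_ conv hS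
  · rw [forall_fin_three]
    exact ⟨ha, hb, hy⟩
  · rintro i j f p q ⟨h3, h4⟩ ⟨h5, -⟩
    exact suniq i p q (h3.symm.trans h5) (h3 ▸ h4)
  · exact fun c d p h => h.2 (P.comp_zero _)
  · intro i
    refine ⟨P.comp_id _, ?_⟩
    rw [P.comp_id]
    exact z0 i
  · intro s t hst
    obtain ⟨h3, -, h4⟩ := hE s t hst
    obtain ⟨f, hf⟩ := ex _ _ _ h4
    exact ⟨f, _, by omega, hf, hf ▸ exz s t hst⟩
  · rintro s u j f g p hle hd ⟨h3, h4⟩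
    by_cases hc : j = 1 → ob s = 1
    · rw [← P.assoc] at h3 h4
      obtain ⟨q, hq⟩ := total _ _ (left_ne_zero h4)
      have hq0 := left_ne_zero h4
      rw [hq] at h3 h4 hq0
      have h5 := actz _ _ hc f q h4
      obtain ⟨r, hr⟩ := total _ _ h5
      rw [act _ _ hc f r q hq0 hr h5] at h3 h4
      exact ⟨r, q, (suniq _ _ _ h3 h4).symm, ⟨hr, h5⟩, hq, hq ▸ hq0⟩
    · push Not at hc
      obtain ⟨rfl, hs⟩ := hc
      rw [show p = deg s - deg u by omega] at h3
      exact absurd h3 (excl s u hle hs f g)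
  · rintro s t u f g p q h3 h4 h5 h6 ⟨h7, h8⟩ ⟨h9, h10⟩
    have h11 := exz s u (trans _ _ _ h3 h4)
    have h12 : S (o (ob u)) 0 ⊙ (g ⊙ f) = S (o (ob s)) (p + q) := by
      rw [← P.assoc, h9]
      refine act _ _ (fun h => ?_) f p q (h9 ▸ h10) h7 h8
      by_contra h'
      exact (hmix s t h3 h').1 h
    rw [h12]
    refine ⟨rfl, ?_⟩
    rwa [show deg s - deg u = p + q by omega] at h11
  · rintro s t f p hle hd ⟨h3, h4⟩ hI'
    obtain ⟨g, e, rfl⟩ := hI _ _ _ hI'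
    obtain ⟨k, hk⟩ := P.endo_cyclic y (S (o (ob t)) 0 ⊙ g)
    rw [← P.assoc, hk, pipow_comp_pipow_comp] at h3 h4
    obtain ⟨r, rfl⟩ := total _ e (right_ne_zero h4)
    rw [shift _ _ _ (right_ne_zero h4)] at h3 h4
    have h5 := suniq _ _ _ h3 h4
    rw [mul_add] at h5
    have := (hE s t hle).2.1
    omega
  · rintro i j f p ⟨h3, h4⟩
    have hz : S (o i) p ≠ P.zero _ _ := h3 ▸ h4
    refine ⟨?_, ?_, ?_, ?_, ?_⟩
    · intro hi _
      obtain ⟨k, rfl, -⟩ := base i (by omega) p hz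
      rcases k with _ | k
      · exact Or.inl rfl
      · exact Or.inr (Nat.le_mul_of_pos_right _ (by omega))
    · rintro rfl rfl
      obtain ⟨k, rfl, -⟩ := base 0 (by decide) p hz
      rcases k with _ | k
      · exact absurd ((h3.trans sa0)) (H.not_factor_alp f _)
      · exact Nat.le_mul_of_pos_right _ (by omega)
    · rintro rfl rfl
      change S a 0 ⊙ f = S b p at h3
      change S a 0 ⊙ f ≠ P.zero b y at h4
      rw [sa0] at h3 h4
      exact H.minm f p (h3.trans (sb p)) h4
    · rintro rfl rfl
      obtain ⟨k, rfl, -⟩ := base 2 (by decide) p hz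
      rcases k with _ | k
      · exact absurd (isId_of_comp_eq_id (h3.trans sy0)).1.1.symm H.hay
      · exact Nat.le_mul_of_pos_right _ (by omega)
    · rintro rfl rfl
      obtain ⟨k, rfl, -⟩ := base 2 (by decide) p hz
      rcases k with _ | _ | k
      · exact absurd (isId_of_comp_eq_id (h3.trans sy0)).1.1.symm H.hby
      · refine absurd ?_ (H.nofac f)
        rw [← sb0]
        refine h3.trans ?_
        rw [zero_add, mul_one]
        exact sy1
      · rw [show l * (k + 1 + 1) = l * k + 2 * l by ring]
        omega

end MixedSetup

end RayCategory

namespace RayCategory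

/-- the order on the points of the family for a mixed setup with `m < l` -/
def lowLe (l m : ℕ) (s t : Fin 7) : Prop :=
  s = t ∨ (s = 0 ∧ t ≠ 0) ∨ (s = 1 ∧ (t = 2 ∨ t = 3 ∨ t = 4)) ∨ (s = 5 ∧ t = 2 ∧ m = 1) ∨
    (s = 6 ∧ t = 4 ∧ l = m + 1)

def lowKind : Fin 7 → Kind :=
  ![.sub 0, .full, .quot 1, .quot 2, .quot 3, .sub 0, .sub 0]

def lowOb : Fin 7 → Fin 3 := ![1, 1, 2, 1, 0, 0, 2]

def lowDeg (l m : ℕ) : Fin 7 → ℕ := ![l + 1, l, l, l - 1, l - m, l + 1 - m, l + 1]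

/-- the order on the points of the family for a mixed setup with `m = l` -/
def highLe (s t : Fin 7) : Prop :=
  s = t ∨ (s = 0 ∧ t ≠ 0 ∧ t ≠ 5) ∨ (s = 1 ∧ (t = 2 ∨ t = 3)) ∨ (s = 4 ∧ t = 6) ∨
    (s = 5 ∧ (t = 4 ∨ t = 6))

def highKind : Fin 7 → Kind :=
  ![.full, .full, .quot 1, .quot 2, .full, .sub 0, .quot 3]

def highOb : Fin 7 → Fin 3 := ![1, 1, 1, 2, 2, 0, 0]

def highDeg (l : ℕ) : Fin 7 → ℕ := ![l + 2, l + 1, l, l + 1, l + 2, l + 2, 2]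

theorem lowShape (l m : ℕ) :
    Shape (lowLe l m) (ℚ × ℚ) (fun q t => Kind.proj q (lowKind t)) := by
  refine Kind.shape_of_root lowKind ?_ 1 ?_ ?_ ?_ rfl ?_
  · intro s t u h1 h2
    unfold lowLe at h1 h2
    fin_cases s <;> fin_cases t <;> simp at h1 <;> fin_cases u <;>
      simp [lowKind] at h2 ⊢
  · intro t h
    fin_cases t <;> simp [lowKind, lowLe] at h ⊢
  · intro t i h
    fin_cases t <;> simp [lowKind] at h
    · exact Or.inl ⟨1, rfl, by simp [lowLe]⟩
    · exact Or.inr ⟨0, 1, by simp [lowKind, h], rfl, by simp [lowLe], by simp [lowLe]⟩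
    · exact Or.inr ⟨0, 1, by simp [lowKind, h], rfl, by simp [lowLe], by simp [lowLe]⟩
  · intro t i h
    fin_cases t <;> simp [lowKind] at h <;> exact ⟨1, rfl, by simp [lowLe]⟩
  · intro i
    fin_cases i
    · exact ⟨0, by simp [lowKind]⟩
    · exact ⟨2, by simp [lowKind]⟩
    · exact ⟨3, by simp [lowKind]⟩
    · exact ⟨4, by simp [lowKind]⟩

theorem highShape : Shape highLe (ℚ × ℚ) (fun q t => Kind.proj q (highKind t)) := by
  refine Kind.shape_of_root highKind ?_ 0 ?_ ?_ ?_ rfl ?_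
  · intro s t u h1 h2
    unfold highLe at h1 h2
    fin_cases s <;> fin_cases t <;> simp at h1 <;> fin_cases u <;>
      simp [highKind] at h2 ⊢
  · intro t h
    fin_cases t <;> simp [highKind, highLe] at h ⊢
  · intro t i h
    fin_cases t <;> simp [highKind] at h
    exact Or.inl ⟨4, rfl, by simp [highLe]⟩
  · intro t i h
    fin_cases t <;> simp [highKind] at h
    · exact ⟨1, rfl, by simp [highLe]⟩
    · exact ⟨1, rfl, by simp [highLe]⟩
    · exact ⟨4, rfl, by simp [highLe]⟩
  · intro i
    fin_cases i
    · exact ⟨5, by simp [highKind]⟩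
    · exact ⟨2, by simp [highKind]⟩
    · exact ⟨3, by simp [highKind]⟩
    · exact ⟨6, by simp [highKind]⟩

theorem lowConv {l m : ℕ} (hm : 1 ≤ m) (hml : m < l) (s u : Fin 7) (j : Fin 3) (q r : ℕ)
    (hle : lowLe l m s u) (h1 : lowDeg l m s = lowDeg l m u + (q + r))
    (h2 : MixedOk l m (lowOb s) j q) (h3 : MixedOk l m j (lowOb u) r) :
    ∃ t, lowOb t = j ∧ lowLe l m s t ∧ lowLe l m t u ∧ lowDeg l m t = lowDeg l m u + r := by
  have hr : r = 0 ∨ r = 1 ∨ r = 2 ∨ 3 ≤ r := by omega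
  have hq : q = 0 ∨ q = 1 ∨ q = 2 ∨ 3 ≤ q := by omega
  unfold lowLe at hle
  unfold MixedOk at h2 h3
  fin_cases s <;> fin_cases u <;> simp at hle <;> fin_cases j <;>
    simp [lowOb] at h2 h3 <;> simp [lowDeg] at h1 <;>
    first
    | omega
    | (rcases hr with rfl | rfl | rfl | hr <;>
    rcases hq with rfl | rfl | rfl | hq <;>
    first
    | omega
    | (refine ⟨0, rfl, ?_, ?_, ?_⟩ <;> simp [lowLe, lowDeg] <;> omega)
    | (refine ⟨1, rfl, ?_, ?_, ?_⟩ <;> simp [lowLe, lowDeg] <;> omega)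
    | (refine ⟨2, rfl, ?_, ?_, ?_⟩ <;> simp [lowLe, lowDeg] <;> omega)
    | (refine ⟨3, rfl, ?_, ?_, ?_⟩ <;> simp [lowLe, lowDeg] <;> omega)
    | (refine ⟨4, rfl, ?_, ?_, ?_⟩ <;> simp [lowLe, lowDeg] <;> omega)
    | (refine ⟨5, rfl, ?_, ?_, ?_⟩ <;> simp [lowLe, lowDeg] <;> omega)
    | (refine ⟨6, rfl, ?_, ?_, ?_⟩ <;> simp [lowLe, lowDeg] <;> omega))

theorem highConv {l : ℕ} (hl : 2 ≤ l) (s u : Fin 7) (j : Fin 3) (q r : ℕ)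
    (hle : highLe s u) (h1 : highDeg l s = highDeg l u + (q + r))
    (h2 : MixedOk l l (highOb s) j q) (h3 : MixedOk l l j (highOb u) r) :
    ∃ t, highOb t = j ∧ highLe s t ∧ highLe t u ∧ highDeg l t = highDeg l u + r := by
  have hr : r = 0 ∨ r = 1 ∨ r = 2 ∨ 3 ≤ r := by omega
  have hq : q = 0 ∨ q = 1 ∨ q = 2 ∨ 3 ≤ q := by omega
  unfold highLe at hle
  unfold MixedOk at h2 h3
  fin_cases s <;> fin_cases u <;> simp at hle <;> fin_cases j <;>
    simp [highOb] at h2 h3 <;> simp [highDeg] at h1 <;>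
    first
    | omega
    | (rcases hr with rfl | rfl | rfl | hr <;>
    rcases hq with rfl | rfl | rfl | hq <;>
    first
    | omega
    | (refine ⟨0, rfl, ?_, ?_, ?_⟩ <;> simp [highLe, highDeg] <;> omega)
    | (refine ⟨1, rfl, ?_, ?_, ?_⟩ <;> simp [highLe, highDeg] <;> omega)
    | (refine ⟨2, rfl, ?_, ?_, ?_⟩ <;> simp [highLe, highDeg] <;> omega)
    | (refine ⟨3, rfl, ?_, ?_, ?_⟩ <;> simp [highLe, highDeg] <;> omega)
    | (refine ⟨4, rfl, ?_, ?_, ?_⟩ <;> simp [highLe, highDeg] <;> omega)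
    | (refine ⟨5, rfl, ?_, ?_, ?_⟩ <;> simp [highLe, highDeg] <;> omega)
    | (refine ⟨6, rfl, ?_, ?_, ?_⟩ <;> simp [highLe, highDeg] <;> omega))

theorem lowLe_trans (l m : ℕ) (s t u : Fin 7) (h1 : lowLe l m s t) (h2 : lowLe l m t u) :
    lowLe l m s u := by
  unfold lowLe at *
  fin_cases s <;> fin_cases t <;> simp at h1 <;> fin_cases u <;> simp at h2 ⊢ <;> omega

theorem highLe_trans (s t u : Fin 7) (h1 : highLe s t) (h2 : highLe t u) : highLe s u := by
  unfold highLe at *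
  fin_cases s <;> fin_cases t <;> simp at h1 <;> fin_cases u <;> simp at h2 ⊢

namespace MixedSetup

variable {P : RayCategory} {a b y : P.Obj} {alp : P.Hom a y} {bet : P.Hom b y} {om : P.Hom y a}
  {l m : ℕ}

theorem one_le (H : MixedSetup alp bet om l m) : 1 ≤ m := by
  by_contra h
  obtain rfl : m = 0 := by omega
  obtain ⟨g, h1, -⟩ := H.exm
  rw [P.pipow_zero, P.comp_id] at h1
  rcases H.hbet.2.2 _ _ _ h1.symm with h2 | h2
  · exact H.hay h2.1
  · exact H.hab h2.1.symm

theorem not_repFin (H : MixedSetup alp bet om l m) {D : Set P.Obj}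
    {I : ∀ a b : P.Obj, P.Hom a b → Prop} (hD : D.Finite)
    (hI1 : ∀ (a b c : P.Obj) (g : P.Hom b c) (f : P.Hom a b), I a b f → I a c (g ⊙ f))
    (hI2 : ∀ (a b c : P.Obj) (g : P.Hom b c) (f : P.Hom a b), I b c g → I a c (g ⊙ f))
    (hI : ∀ (s t : P.Obj) (f : P.Hom s t), I s t f → ∃ (g : P.Hom y t) (e : P.Hom s y),
      f = g ⊙ P.pipow y 2 ⊙ e)
    (ha : a ∈ D) (hb : b ∈ D) (hy : y ∈ D) : ¬ RepFin P D I := by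
  have hl := H.two_le
  have hm := H.one_le
  rcases H.m_le.lt_or_eq with hml | rfl
  · refine H.not_repFin_of_table hD hI1 hI2 hI ha hb hy (ob := lowOb) (deg := lowDeg l m) ?_
      (fun t => Or.inl rfl) (lowLe_trans l m) ?_ ?_ (lowConv hm hml) (lowShape l m)
    · intro s t h1 h2
      fin_cases s <;> fin_cases t <;> simp [lowOb, lowDeg] at h1 h2 ⊢ <;> omega
    · intro s t hst
      unfold lowLe at hst
      unfold MixedEx
      fin_cases s <;> fin_cases t <;> simp at hst <;> simp [lowOb, lowDeg] <;> omega
    · intro s t hst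
      unfold lowLe at hst
      fin_cases s <;> fin_cases t <;> simp at hst <;> simp [lowOb, lowDeg] <;> omega
  · refine H.not_repFin_of_table hD hI1 hI2 hI ha hb hy (ob := highOb) (deg := highDeg m) ?_
      (fun t => Or.inl rfl) highLe_trans ?_ ?_ (highConv hl) highShape
    · intro s t h1 h2
      fin_cases s <;> fin_cases t <;> simp [highOb, highDeg] at h1 h2 ⊢ <;> omega
    · intro s t hst
      unfold highLe at hst
      unfold MixedEx
      fin_cases s <;> fin_cases t <;> simp at hst <;> simp [highOb, highDeg] <;> omega
    · intro s t hst
      unfold highLe at hst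
      fin_cases s <;> fin_cases t <;> simp at hst <;> simp [highOb, highDeg] <;> omega

end MixedSetup

end RayCategory

namespace RayCategory

variable {P : RayCategory} {x y a b c : P.Obj}

theorem not_isId_pi (h : P.pi y ≠ P.zero y y) : ¬ P.IsId (P.pi y) := by
  intro h1
  have h2 : P.pipow y 1 = P.pipow y 0 := by rw [P.pipow_zero]; exact isId_endo.1 h1
  exact one_ne_zero (pipow_inj h2 h)

/-- the only possible loop at `y` in the quiver is `π(y)` -/
theorem IsIrreducible.eq_pi {f : P.Hom y y} (hf : P.IsIrreducible f) : f = P.pi y := by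
  obtain ⟨i, rfl⟩ := P.endo_cyclic y f
  obtain ⟨h0, h1, h2⟩ := hf
  match i with
  | 0 => exact absurd (isId_endo.2 (P.pipow_zero y)) h1
  | 1 => rfl
  | i + 2 =>
    exfalso
    have h3 : P.pi y ≠ P.zero y y := pipow_ne_zero_of_le (by omega) h0
    rcases h2 _ (P.pipow y 1) (P.pipow y (i + 1)) (P.pipow_succ y (i + 1)) with h | h
    · exact not_isId_pi h3 h
    · have h4 : P.pipow y (i + 1) = P.pipow y 0 := by rw [P.pipow_zero]; exact isId_endo.1 h
      exact Nat.succ_ne_zero i (pipow_inj h4 (pipow_ne_zero_of_le (by omega) h0))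

/-- An irreducible morphism is a left generator or a right generator of highly nonsymmetric
type. -/
theorem IsIrreducible.left_or_right {f : P.Hom c y} (hf : P.IsIrreducible f) (hne : c ≠ y)
    (h0 : P.pi y ⊙ f ≠ P.zero c y) : (∀ g : P.Hom c y, ∃ i, g = P.pipow y i ⊙ f) ∨
      ∃ l, 2 ≤ l ∧ (∀ g : P.Hom c y, ∃ i, g = f ⊙ P.pipow c i) ∧
        P.pi y ⊙ f = f ⊙ P.pipow c l := by
  obtain ⟨g, hg | hg⟩ := P.hom_cyclic c y
  · obtain ⟨i, hi⟩ := hg f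
    obtain rfl := eq_of_irred_left hf hne hi
    exact Or.inl hg
  · obtain ⟨i, hi⟩ := hg f
    obtain rfl := eq_of_irred_right hf hne hi
    obtain ⟨l, hl⟩ := hg (P.pi y ⊙ f)
    match l with
    | 0 =>
      exfalso
      rw [P.pipow_zero, P.comp_id] at hl
      refine not_isId_pi (left_ne_zero h0) (isId_endo.2 (isId_of_comp_eq_self_left hl hf.1))
    | 1 =>
      left
      intro g
      obtain ⟨k, rfl⟩ := hg g
      exact ⟨k, by rw [pipow_comp_swap hl, one_mul]⟩
    | l + 2 => exact Or.inr ⟨l + 2, by omega, hg, hl⟩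

/-- The data of a mild contour violating the conclusion of the main theorem. -/
structure Setup (alp : P.Hom a y) (bet : P.Hom b y) (om : P.Hom y a) (xi : P.Hom x y)
    (del : P.Hom x b) (I : ∀ a b : P.Obj, P.Hom a b → Prop) : Prop where
  halp : P.IsIrreducible alp
  hbet : P.IsIrreducible bet
  hab : a ≠ b
  hom : alp ⊙ om = P.pi y
  hnid : ¬ P.IsId om
  heq : P.pi y ⊙ xi = bet ⊙ del
  nz : P.pipow y 2 ⊙ xi ≠ P.zero x y
  tr : ∃ e, (P.pi y ⊙ xi) ⊙ P.pi x = P.pipow y e ⊙ P.pi y ⊙ xi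
  princ : ∀ (c : P.Obj) (F : P.Hom x c) (G : P.Hom c b) (G' : P.Hom c a), del = G ⊙ F →
    bet ⊙ G = alp ⊙ G' → P.IsId F
  hI1 : ∀ (a b c : P.Obj) (g : P.Hom b c) (f : P.Hom a b), I a b f → I a c (g ⊙ f)
  hI2 : ∀ (a b c : P.Obj) (g : P.Hom b c) (f : P.Hom a b), I b c g → I a c (g ⊙ f)
  hI : ∀ (s t : P.Obj) (f : P.Hom s t), I s t f → ∃ (g : P.Hom y t) (e : P.Hom s x),
    f = g ⊙ P.pipow y 2 ⊙ xi ⊙ e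
  rf : RepFin P {x, y, a, b} I

namespace Setup

variable {alp : P.Hom a y} {bet : P.Hom b y} {om : P.Hom y a} {xi : P.Hom x y}
  {del : P.Hom x b} {I : ∀ a b : P.Obj, P.Hom a b → Prop}

theorem sq (H : Setup alp bet om xi del I) : P.pipow y 2 ≠ P.zero y y := left_ne_zero H.nz

theorem pi_ne (H : Setup alp bet om xi del I) : P.pi y ≠ P.zero y y :=
  pipow_ne_zero_of_le (by omega) H.sq

theorem a_ne (H : Setup alp bet om xi del I) : a ≠ y := by
  rintro rfl
  have h := H.hom
  rw [H.halp.eq_pi] at h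
  exact H.hnid (isId_endo.2 (isId_of_comp_eq_self_right h H.pi_ne))

theorem b_ne (H : Setup alp bet om xi del I) : b ≠ y := by
  rintro rfl
  have h := H.hbet
  rw [h.eq_pi, ← H.hom] at h
  rcases h.2.2 _ _ _ rfl with h | h
  · exact H.halp.2.1 h
  · exact H.hnid h

theorem pi_alp (H : Setup alp bet om xi del I) : P.pi y ⊙ alp ≠ P.zero a y := by
  have h := H.sq
  rw [← pipow_comp_pipow y 1 1, ← pi_def] at h
  nth_rw 2 [← H.hom] at h
  rw [← P.assoc] at h
  exact left_ne_zero h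

theorem pi_bet (H : Setup alp bet om xi del I) : P.pi y ⊙ bet ≠ P.zero b y := by
  have h := H.nz
  rw [← pipow_comp_pipow_comp 1 1, ← pi_def, H.heq, ← P.assoc] at h
  exact left_ne_zero h

theorem finite_points : ({x, y, a, b} : Set P.Obj).Finite := Set.toFinite _

theorem hI' (H : Setup alp bet om xi del I) (s t : P.Obj) (f : P.Hom s t) (h : I s t f) :
    ∃ (g : P.Hom y t) (e : P.Hom s y), f = g ⊙ P.pipow y 2 ⊙ e := by
  obtain ⟨g, e, rfl⟩ := H.hI s t f h
  exact ⟨g, xi ⊙ e, rfl⟩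

theorem left_of_factor (H : Setup alp bet om xi del I) {f : P.Hom c y} (hf : P.IsIrreducible f)
    (hne : c ≠ y) (hc : c ∈ ({x, y, a, b} : Set P.Obj)) (h0 : P.pi y ⊙ f ≠ P.zero c y)
    {k : P.Hom y c} (hk : f ⊙ k = P.pi y) (g : P.Hom c y) : ∃ i, g = P.pipow y i ⊙ f := by
  rcases hf.left_or_right hne h0 with h | ⟨l, h2, hg, hl⟩
  · exact h g
  · exact absurd H.rf (RightSetup.not_repFin ⟨hne, hg, h2, hl, hk, H.sq⟩ finite_points H.hI1
      H.hI2 H.hI' hc (by simp))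

theorem left_alp (H : Setup alp bet om xi del I) (g : P.Hom a y) :
    ∃ i, g = P.pipow y i ⊙ alp :=
  H.left_of_factor H.halp H.a_ne (by simp) H.pi_alp H.hom g

theorem left_bet (H : Setup alp bet om xi del I) (g : P.Hom b y) :
    ∃ i, g = P.pipow y i ⊙ bet := by
  classical
  by_cases hk : ∃ k : P.Hom y b, bet ⊙ k = P.pi y
  · obtain ⟨k, hk⟩ := hk
    exact H.left_of_factor H.hbet H.b_ne (by simp) H.pi_bet hk g
  rcases H.hbet.left_or_right H.b_ne H.pi_bet with h | ⟨l, h2, hg, hl⟩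
  · exact h g
  exfalso
  have hex : ∃ p, ∃ g : P.Hom b a, alp ⊙ g = bet ⊙ P.pipow b p ∧ alp ⊙ g ≠ P.zero b y := by
    refine ⟨l, om ⊙ bet, ?_, ?_⟩
    · rw [← P.assoc, H.hom, hl]
    · rw [← P.assoc, H.hom]
      exact H.pi_bet
  have hex' : ∃ g : P.Hom b a, alp ⊙ g = bet ⊙ P.pipow b l ∧ alp ⊙ g ≠ P.zero b y := by
    refine ⟨om ⊙ bet, ?_, ?_⟩
    · rw [← P.assoc, H.hom, hl]
    · rw [← P.assoc, H.hom]
      exact H.pi_bet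
  have M : MixedSetup alp bet om l (Nat.find hex) :=
    { hab := H.hab, hay := H.a_ne, hby := H.b_ne, halp := H.halp, hbet := H.hbet
      gena := H.left_alp, genb := hg, two_le := h2, swap := hl, fac := H.hom
      nofac := fun g h => hk ⟨g, h⟩, sq := H.sq, nz := H.pi_bet, exm := Nat.find_spec hex
      minm := fun g p h1 h2 => Nat.find_min' hex ⟨g, h1, h2⟩
      m_le := Nat.find_min' hex hex' }
  exact M.not_repFin finite_points H.hI1 H.hI2 H.hI' (by simp) (by simp) (by simp) H.rf

/-- the hypothesis of transitivity makes the morphisms from `x` to `y` left cyclic -/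
theorem exists_left_gen (H : Setup alp bet om xi del I) :
    ∃ g : P.Hom x y, ∀ f : P.Hom x y, ∃ i, f = P.pipow y i ⊙ g := by
  obtain ⟨g, hg | hg⟩ := P.hom_cyclic x y
  · exact ⟨g, hg⟩
  obtain ⟨i, hi⟩ := hg xi
  obtain ⟨m, hm⟩ := hg (P.pi y ⊙ g)
  obtain ⟨e, he⟩ := H.tr
  have hz := H.nz
  have h1 : P.pi y ⊙ xi = g ⊙ P.pipow x (m + i) := by
    rw [hi, ← P.assoc, hm, P.assoc, pipow_comp_pipow]
  have h2 : P.pipow y 2 ⊙ xi = g ⊙ P.pipow x (m * 2 + i) := by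
    rw [hi, ← P.assoc, pipow_comp_swap hm, P.assoc, pipow_comp_pipow]
  rw [h1, ← P.assoc, pipow_comp_swap hm, P.assoc, P.assoc, pi_def, pipow_comp_pipow,
    pipow_comp_pipow] at he
  rw [h2] at hz
  have hm0 : m ≠ 0 := by
    rintro rfl
    rw [P.pipow_zero, P.comp_id] at hm
    exact not_isId_pi H.pi_ne (isId_endo.2 (isId_of_comp_eq_self_left hm (left_ne_zero hz)))
  have h3 : g ⊙ P.pipow x (m + i + 1) ≠ P.zero x y := by
    rw [show m * 2 + i = (m + i + 1) + (m - 1) by omega, ← pipow_comp_pipow, ← P.assoc] at hz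
    exact left_ne_zero hz
  have h4 := comp_pipow_inj he h3
  have h5 : m * e = 1 := by omega
  obtain rfl : m = 1 := Nat.eq_one_of_mul_eq_one_right h5
  refine ⟨g, fun f => ?_⟩
  obtain ⟨j, rfl⟩ := hg f
  exact ⟨j, by rw [pipow_comp_swap hm, one_mul]⟩

theorem exists_targets (H : Setup alp bet om xi del I) : ∃ G : ∀ c, P.Hom c y,
    G y = P.id y ∧ G a = alp ∧ G b = bet ∧ LeftCyclic G a ∧ LeftCyclic G b ∧
      LeftCyclic G x ∧ LeftCyclic G y := by
  classical
  obtain ⟨S, h1, h2, h3⟩ := RayCategory.exists_targets H.hab H.a_ne H.b_ne (fun _ => alp)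
    (fun _ => bet) (fun _ => P.id y)
  replace h1 := congrFun h1 0
  replace h2 := congrFun h2 0
  replace h3 := congrFun h3 0
  generalize hG : (fun s => S s 0 : ∀ c, P.Hom c y) = G
  replace h1 : G a = alp := by rw [← hG]; exact h1
  replace h2 : G b = bet := by rw [← hG]; exact h2
  replace h3 : G y = P.id y := by rw [← hG]; exact h3
  have hy : LeftCyclic G y := fun f => by
    obtain ⟨i, rfl⟩ := P.endo_cyclic y f
    exact ⟨i, by rw [h3, P.comp_id]⟩
  have ha : LeftCyclic G a := fun f => by rw [h1]; exact H.left_alp f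
  have hb : LeftCyclic G b := fun f => by rw [h2]; exact H.left_bet f
  by_cases hx : x = y ∨ x = a ∨ x = b
  · refine ⟨G, h3, h1, h2, ha, hb, ?_, hy⟩
    rcases hx with rfl | rfl | rfl <;> assumption
  · push Not at hx
    obtain ⟨g, hg⟩ := H.exists_left_gen
    refine ⟨Function.update G x g, ?_, ?_, ?_, ?_, ?_, ?_, ?_⟩
    · rw [Function.update_of_ne hx.1.symm, h3]
    · rw [Function.update_of_ne hx.2.1.symm, h1]
    · rw [Function.update_of_ne hx.2.2.symm, h2]
    · intro f
      rw [Function.update_of_ne hx.2.1.symm]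
      exact ha f
    · intro f
      rw [Function.update_of_ne hx.2.2.symm]
      exact hb f
    · intro f
      rw [Function.update_self]
      exact hg f
    · intro f
      rw [Function.update_of_ne hx.1.symm]
      exact hy f

end Setup

end RayCategory

namespace RayCategory

variable {P : RayCategory} {x y a b c : P.Obj}

/-- The degree calculus attached to a mild contour violating the main theorem: degrees are
measured by morphisms to `y`, and the contour has degree `i + 1`. -/
structure Graded (x y a b : P.Obj) (G : ∀ c, P.Hom c y)
    (I : ∀ a b : P.Obj, P.Hom a b → Prop) (i : ℕ) : Prop where
  hab : a ≠ b
  hay : a ≠ y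
  hby : b ≠ y
  Gy : G y = P.id y
  Lx : LeftCyclic G x
  La : LeftCyclic G a
  Lb : LeftCyclic G b
  Ly : LeftCyclic G y
  ia : P.IsIrreducible (G a)
  ib : P.IsIrreducible (G b)
  nzx : P.pipow y (i + 2) ⊙ G x ≠ P.zero x y
  nza : P.pipow y (i + 1) ⊙ G a ≠ P.zero a y
  nzb : P.pipow y 1 ⊙ G b ≠ P.zero b y
  exa : ExDeg G y a 1
  exb : ExDeg G x b (i + 1)
  princ : ∀ (c : P.Obj) (p q : ℕ), ExDeg G x c p → ExDeg G c b q → 1 ≤ q → p + q = i + 1 →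
    p = 0 ∧ c = x
  kill : ∀ (s t : P.Obj) (f : P.Hom s t) (m : ℕ), LeftCyclic G s → I s t f → HasDeg G f m →
    i + 2 ≤ m ∧ (m = i + 2 → t = y ∧ ExDeg G s x 0)
  hI1 : ∀ (a b c : P.Obj) (g : P.Hom b c) (f : P.Hom a b), I a b f → I a c (g ⊙ f)
  hI2 : ∀ (a b c : P.Obj) (g : P.Hom b c) (f : P.Hom a b), I b c g → I a c (g ⊙ f)
  rf : RepFin P {x, y, a, b} I

theorem Setup.exists_graded {alp : P.Hom a y} {bet : P.Hom b y} {om : P.Hom y a}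
    {xi : P.Hom x y} {del : P.Hom x b} {I : ∀ a b : P.Obj, P.Hom a b → Prop}
    (H : Setup alp bet om xi del I) : ∃ G i, Graded x y a b G I i := by
  obtain ⟨G, hy, ha, hb, La, Lb, Lx, Ly⟩ := H.exists_targets
  obtain ⟨i, hi⟩ := Lx xi
  have nzx : P.pipow y (i + 2) ⊙ G x ≠ P.zero x y := by
    have := H.nz
    rwa [hi, pipow_comp_pipow_comp, Nat.add_comm] at this
  have hdel : G b ⊙ del = P.pipow y (i + 1) ⊙ G x := by
    rw [hb, ← H.heq, hi, pi_def, pipow_comp_pipow_comp, Nat.add_comm]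
  have hdel0 : G b ⊙ del ≠ P.zero x y := by
    rw [hdel]
    rw [Nat.add_comm i 2, show 2 + i = 1 + (i + 1) by omega, ← pipow_comp_pipow_comp] at nzx
    exact right_ne_zero nzx
  refine ⟨G, i, H.hab, H.a_ne, H.b_ne, hy, Lx, La, Lb, Ly, ha ▸ H.halp, hb ▸ H.hbet, nzx,
    ?_, ?_, ?_, ⟨del, hdel, hdel0⟩, ?_, ?_, H.hI1, H.hI2, H.rf⟩
  · rw [show i + 2 = (i + 1) + 1 by omega, ← pipow_comp_pipow_comp, ← pi_def, ← H.hom,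
      P.assoc, ← P.assoc] at nzx
    rw [ha]
    exact left_ne_zero nzx
  · rw [hb]
    exact H.pi_bet
  · refine ⟨om, ?_, ?_⟩
    · rw [ha, H.hom, hy, P.comp_id, pi_def]
    · rw [ha, H.hom]
      exact H.pi_ne
  · rintro c p q ⟨F, hF⟩ ⟨K, hK⟩ hq hpq
    have h1 : G b ⊙ del = G b ⊙ (K ⊙ F) := by
      rw [hdel, hF.comp_eq hK, hpq]
    have h2 : del = K ⊙ F := cancel_left h1 hdel0
    have h3 : P.IsId F := by
      refine H.princ c F K (om ⊙ P.pipow y (q - 1) ⊙ G c) h2 ?_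
      rw [← hb, hK.1, ← P.assoc, H.hom, pi_def, pipow_comp_pipow_comp,
        Nat.add_sub_cancel' hq]
    obtain rfl := h3.1
    have h4 := isId_endo.1 h3
    subst h4
    refine ⟨hF.uniq (hasDeg_id ?_), rfl⟩
    have := hF.2
    rwa [P.comp_id] at this
  · intro s t f m Ls hf hm
    obtain ⟨g, h, rfl⟩ := H.hI s t f hf
    have h1 : G t ⊙ g ⊙ P.pipow y 2 ⊙ xi ⊙ h = (G t ⊙ g) ⊙ P.pipow y (i + 2) ⊙ G x ⊙ h := by
      rw [hi, P.assoc, P.assoc, pipow_comp_pipow_comp, Nat.add_comm 2]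
    have h0 := hm.2
    rw [h1] at h0
    obtain ⟨u, hu⟩ := P.endo_cyclic y (G t ⊙ g)
    obtain ⟨v, hv⟩ := Ls (G x ⊙ h)
    have h2 : P.pipow y (u + (i + 2) + v) ⊙ G s = P.pipow y m ⊙ G s := by
      rw [← hm.1, h1, hu, hv, pipow_comp_pipow_comp, pipow_comp_pipow_comp]
    have h3 : u + (i + 2) + v = m := by
      refine pipow_comp_inj h2 ?_
      rw [h2]
      exact hm.nz
    refine ⟨by omega, fun h4 => ?_⟩
    obtain rfl : u = 0 := by omega
    obtain rfl : v = 0 := by omega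
    rw [P.pipow_zero] at hu
    exact ⟨(isId_of_comp_eq_id hu).2.1, h, hv, right_ne_zero (right_ne_zero h0)⟩

namespace Graded

variable {G : ∀ c, P.Hom c y} {I : ∀ a b : P.Obj, P.Hom a b → Prop} {i : ℕ}

theorem pow_ne_of_le {m n : ℕ} {c : P.Obj} (hmn : m ≤ n)
    (h : P.pipow y n ⊙ G c ≠ P.zero c y) : P.pipow y m ⊙ G c ≠ P.zero c y := by
  obtain ⟨k, rfl⟩ := Nat.exists_eq_add_of_le' hmn
  rw [← pipow_comp_pipow_comp] at h
  exact right_ne_zero h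

theorem nzy (H : Graded x y a b G I i) : P.pipow y (i + 2) ⊙ G y ≠ P.zero y y := by
  rw [H.Gy, P.comp_id]
  exact left_ne_zero H.nzx

theorem nza_of (H : Graded x y a b G I i) (h : ExDeg G x a 0) :
    P.pipow y (i + 2) ⊙ G a ≠ P.zero a y := by
  obtain ⟨f, hf, -⟩ := h
  have := H.nzx
  rw [← P.id_comp (G x), ← P.pipow_zero, ← hf, ← P.assoc] at this
  exact left_ne_zero this

/-- powers of `π(y)` -/
theorem ex_target (H : Graded x y a b G I i) {p : ℕ} (h : P.pipow y p ⊙ G c ≠ P.zero c y) :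
    ExDeg G c y p :=
  ⟨P.pipow y p ⊙ G c, by rw [H.Gy, P.id_comp], by rwa [H.Gy, P.id_comp]⟩

theorem ex_aa (H : Graded x y a b G I i) : ExDeg G a a 1 :=
  (H.ex_target (pow_ne_of_le (Nat.zero_le _) H.nza)).comp H.exa (pow_ne_of_le (by omega) H.nza)

theorem ne_of_exDeg_zero (H : Graded x y a b G I i) (h : ExDeg G y c 0) : c = y := by
  obtain ⟨f, hf, -⟩ := h
  rw [H.Gy, P.comp_id, P.pipow_zero] at hf
  exact (isId_of_comp_eq_id hf).2.1

theorem eq_of_irred (hc : P.IsIrreducible (G c)) {d : P.Obj} (h : ExDeg G c d 0) :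
    d = y ∨ d = c := by
  obtain ⟨f, hf, -⟩ := h
  rw [P.pipow_zero, P.id_comp] at hf
  rcases hc.2.2 _ _ _ hf.symm with h | h
  · exact Or.inl h.1
  · exact Or.inr h.1.symm

/-- Contradiction from a table of degrees of morphisms. -/
theorem false_of_family (H : Graded x y a b G I i) {k n : ℕ} [Nonempty (Fin n)]
    {W : Type} [AddCommGroup W] [Module ℚ W] [FiniteDimensional ℚ W]
    {e : ℚ → Fin n → W →ₗ[ℚ] W} (o : Fin k → P.Obj) (ho : Function.Injective o)
    (hoD : ∀ j, o j = x ∨ o j = y ∨ o j = a ∨ o j = b)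
    (ob : Fin n → Fin k) (deg : Fin n → ℕ) (up cov : Fin n → List (Fin n)) (N : Fin k → ℕ)
    (ok : Fin k → Fin k → ℕ → Prop)
    (ed : Fin k → Fin k → ℕ → Prop)
    (hN : ∀ j, P.pipow y (N j) ⊙ G (o j) ≠ P.zero (o j) y)
    (hed : ∀ i j p, ed i j p → ExDeg G (o i) (o j) p)
    (hok : ∀ i j p, ExDeg G (o i) (o j) p → ok i j p)
    (inj : ∀ s t, ob s = ob t → deg s = deg t → s = t)
    (trans : ∀ s, ∀ t ∈ up s, ∀ u ∈ up t, u ∈ up s)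
    (hcov : ∀ s, ∀ u ∈ up s, u ∈ cov s ∨
      ∃ t ∈ cov s, u ∈ up t ∧ (up t).length < (up s).length)
    (hdeg : ∀ s, ∀ u ∈ up s, deg u ≤ deg s ∧ deg s ≤ deg u + N (ob s))
    (hE : ∀ s, ∀ t ∈ cov s, t ∈ up s ∧ ed (ob s) (ob t) (deg s - deg t))
    (hkill : ∀ s, ∀ t ∈ up s, deg s < deg t + (i + 2) ∨
      (deg s = deg t + (i + 2) ∧ (o (ob t) ≠ y ∨ ¬ ExDeg G (o (ob s)) x 0)))
    (conv : ∀ s u j q r, s = u ∨ u ∈ up s → deg s = deg u + (q + r) → ok (ob s) j q →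
      ok j (ob u) r → ∃ t, ob t = j ∧ (s = t ∨ t ∈ up s) ∧ (t = u ∨ u ∈ up t) ∧
        deg t = deg u + r)
    (hS : Shape (fun s t => s = t ∨ t ∈ up s) W e) : False := by
  have hL : ∀ j, LeftCyclic G (o j) := by
    intro j
    rcases hoD j with h | h | h | h <;> rw [h]
    exacts [H.Lx, H.Ly, H.La, H.Lb]
  refine not_repFin_of_hasDeg (Setup.finite_points (x := x) (y := y) (a := a) (b := b))
    H.hI1 H.hI2 ho ?_ hL ?_ ob deg up (fun s t => t ∈ cov s) N ok hN inj trans hcov hdeg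
    ?_ ?_ hok conv hS H.rf
  · intro j
    simpa using hoD j
  · intro j
    exact right_ne_zero (hN j)
  · intro s t h
    obtain ⟨h1, h2⟩ := hE s t h
    exact ⟨h1, deg s - deg t, by have := (hdeg _ _ h1).1; omega, hed _ _ _ h2⟩
  · intro s t hst f p hp hf hI
    obtain ⟨h1, h2⟩ := H.kill _ _ f p (hL _) hI hf
    rcases hst with rfl | hst
    · omega
    · rcases hkill s t hst with h | ⟨h, h3⟩
      · omega
      · obtain ⟨h4, h5⟩ := h2 (by omega)
        exact h3.elim (fun h => h h4) (fun h => h h5)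

/-- Contradiction from a numerical table of degrees of morphisms. -/
theorem false_of_table (H : Graded x y a b G I i) {k n : ℕ} [Nonempty (Fin n)]
    {W : Type} [AddCommGroup W] [Module ℚ W] [FiniteDimensional ℚ W]
    {e : ℚ → Fin n → W →ₗ[ℚ] W} (o : Fin k → P.Obj) (ho : Function.Injective o)
    (hoD : ∀ j, o j = x ∨ o j = y ∨ o j = a ∨ o j = b)
    (ob : Fin n → Fin k) (deg : Fin n → ℕ) (up cov : Fin n → List (Fin n)) (N : Fin k → ℕ)
    (lo : Fin k → Fin k → ℕ) (ed : Fin k → Fin k → List ℕ)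
    (hN : ∀ j, P.pipow y (N j) ⊙ G (o j) ≠ P.zero (o j) y)
    (hed : ∀ i j, ∀ p ∈ ed i j, ExDeg G (o i) (o j) p)
    (hlo : ∀ i j p, ExDeg G (o i) (o j) p → (i = j ∧ p = 0) ∨ lo i j ≤ p)
    (src tgt : Fin k → Bool) (hsrc : ∀ j, src j = true → ¬ ExDeg G (o j) x 0)
    (htgt : ∀ j, tgt j = true → o j ≠ y)
    (hkill : ∀ s, ∀ t ∈ up s, deg s < deg t + 2 ∨
      (deg s = deg t + 2 ∧ (tgt (ob t) = true ∨ src (ob s) = true)))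
    (inj : ∀ s t, ob s = ob t → deg s = deg t → s = t)
    (trans : ∀ s, ∀ t ∈ up s, ∀ u ∈ up t, u ∈ up s)
    (hcov : ∀ s, ∀ u ∈ up s, u ∈ cov s ∨
      ∃ t ∈ cov s, u ∈ up t ∧ (up t).length < (up s).length)
    (hdeg : ∀ s, ∀ u ∈ up s, deg u ≤ deg s ∧ deg s ≤ deg u + N (ob s))
    (hE : ∀ s, ∀ t ∈ cov s, t ∈ up s ∧ deg s - deg t ∈ ed (ob s) (ob t))
    (conv : ∀ s u, s = u ∨ u ∈ up s → ∀ j, ∀ r ∈ List.range (deg s - deg u + 1),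
      ((ob s = j ∧ deg s - deg u - r = 0) ∨ lo (ob s) j ≤ deg s - deg u - r) →
      ((j = ob u ∧ r = 0) ∨ lo j (ob u) ≤ r) →
      ∃ t, ob t = j ∧ (s = t ∨ t ∈ up s) ∧ (t = u ∨ u ∈ up t) ∧ deg t = deg u + r)
    (hS : Shape (fun s t => s = t ∨ t ∈ up s) W e) : False :=
  H.false_of_family o ho hoD ob deg up cov N (fun i j p => (i = j ∧ p = 0) ∨ lo i j ≤ p)
    (fun i j p => p ∈ ed i j) hN hed hlo inj trans hcov hdeg hE
    (fun s t h => by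
      rcases hkill s t h with h1 | ⟨h1, h2⟩
      · left; omega
      · rcases Nat.eq_zero_or_pos i with rfl | hi
        · exact Or.inr ⟨h1, h2.imp (htgt _) (hsrc _)⟩
        · left; omega)
    (conv_of_bounded conv) hS

end Graded

end RayCategory

theorem forall_fin_four {p : Fin 4 → Prop} : (∀ i, p i) ↔ p 0 ∧ p 1 ∧ p 2 ∧ p 3 := by
  rw [Fin.forall_fin_succ, Fin.forall_fin_succ, Fin.forall_fin_two]
  rfl

section

variable {α : Type} {p q r s : α}

theorem injective_two (h : p ≠ q) : Function.Injective ![p, q] := by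
  intro i j hij
  fin_cases i <;> fin_cases j <;> simp_all

theorem injective_three (h1 : p ≠ q) (h2 : p ≠ r) (h3 : q ≠ r) :
    Function.Injective ![p, q, r] := by
  intro i j hij
  fin_cases i <;> fin_cases j <;> simp_all [eq_comm]

theorem injective_four (h1 : p ≠ q) (h2 : p ≠ r) (h3 : p ≠ s) (h4 : q ≠ r) (h5 : q ≠ s)
    (h6 : r ≠ s) : Function.Injective ![p, q, r, s] := by
  intro i j hij
  fin_cases i <;> fin_cases j <;> simp_all [eq_comm]

end

namespace RayCategory

set_option synthInstance.maxHeartbeats 400000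
set_option synthInstance.maxSize 4000
set_option maxRecDepth 100000

variable {P : RayCategory} {x y a b c d : P.Obj}

section

variable {G : ∀ c, P.Hom c y} {k : ℕ} {j j' : Fin k}

theorem ge_zero (p : ℕ) (_ : ExDeg G c d p) : (j = j' ∧ p = 0) ∨ 0 ≤ p := Or.inr (Nat.zero_le p)

theorem ge_one (h0 : ¬ ExDeg G c d 0) (p : ℕ) (h : ExDeg G c d p) : (j = j' ∧ p = 0) ∨ 1 ≤ p := by
  right
  by_contra hp
  obtain rfl : p = 0 := by omega
  exact h0 h

theorem ge_two (h0 : ¬ ExDeg G c d 0) (h1 : ¬ ExDeg G c d 1) (p : ℕ) (h : ExDeg G c d p) :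
    (j = j' ∧ p = 0) ∨ 2 ≤ p := by
  right
  by_contra hp
  obtain rfl | rfl : p = 0 ∨ p = 1 := by omega
  · exact h0 h
  · exact h1 h

theorem ge_three (h0 : ¬ ExDeg G c d 0) (h1 : ¬ ExDeg G c d 1) (h2 : ¬ ExDeg G c d 2) (p : ℕ)
    (h : ExDeg G c d p) : (j = j' ∧ p = 0) ∨ 3 ≤ p := by
  right
  by_contra hp
  obtain rfl | rfl | rfl : p = 0 ∨ p = 1 ∨ p = 2 := by omega
  · exact h0 h
  · exact h1 h
  · exact h2 h

theorem self_ge_one (p : ℕ) (_ : ExDeg G c c p) : (j = j ∧ p = 0) ∨ 1 ≤ p := by omega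

theorem self_ge_two (h1 : ¬ ExDeg G c c 1) (p : ℕ) (h : ExDeg G c c p) :
    (j = j ∧ p = 0) ∨ 2 ≤ p := by
  by_cases hp : p = 1
  · exact absurd (hp ▸ h) h1
  · omega

theorem mem_none {Q : ℕ → Prop} : ∀ p ∈ ([] : List ℕ), Q p := by simp

theorem mem_one {Q : ℕ → Prop} {q : ℕ} (h : Q q) : ∀ p ∈ [q], Q p := by simpa using h

end

namespace Graded

variable {G : ∀ c, P.Hom c y} {I : ∀ a b : P.Obj, P.Hom a b → Prop} {i : ℕ}

theorem ex_ay (H : Graded x y a b G I i) : ExDeg G a y 0 :=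
  H.ex_target (pow_ne_of_le (Nat.zero_le _) H.nza)

theorem ex_by (H : Graded x y a b G I i) : ExDeg G b y 0 :=
  H.ex_target (pow_ne_of_le (Nat.zero_le _) H.nzb)

theorem ex_xy (H : Graded x y a b G I i) : ExDeg G x y 0 :=
  H.ex_target (pow_ne_of_le (Nat.zero_le _) H.nzx)

theorem ex_yy (H : Graded x y a b G I i) : ExDeg G y y 1 :=
  H.ex_target (pow_ne_of_le (by omega) H.nzy)

theorem not_ya (H : Graded x y a b G I i) : ¬ ExDeg G y a 0 :=
  fun h => H.hay (H.ne_of_exDeg_zero h)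

theorem not_yb (H : Graded x y a b G I i) : ¬ ExDeg G y b 0 :=
  fun h => H.hby (H.ne_of_exDeg_zero h)

theorem not_ab (H : Graded x y a b G I i) : ¬ ExDeg G a b 0 :=
  fun h => (eq_of_irred H.ia h).elim H.hby H.hab.symm

theorem not_ba (H : Graded x y a b G I i) : ¬ ExDeg G b a 0 :=
  fun h => (eq_of_irred H.ib h).elim H.hay H.hab

theorem not_yx (H : Graded x y a b G I i) (hxy : x ≠ y) : ¬ ExDeg G y x 0 :=
  fun h => hxy (H.ne_of_exDeg_zero h)

theorem not_ax (H : Graded x y a b G I i) (hxy : x ≠ y) (hxa : x ≠ a) : ¬ ExDeg G a x 0 :=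
  fun h => (eq_of_irred H.ia h).elim hxy hxa

theorem not_bx (H : Graded x y a b G I i) (hxy : x ≠ y) (hxb : x ≠ b) : ¬ ExDeg G b x 0 :=
  fun h => (eq_of_irred H.ib h).elim hxy hxb

/-- The case `x = y` of degree one. -/
theorem false_of_eq_zero (H : Graded y y a b G I 0) : False := by
  refine H.false_of_table (k := 3) (n := 5) ![y, a, b] (injective_three H.hay.symm H.hby.symm H.hab)
    (forall_fin_three.2 ⟨Or.inr (Or.inl rfl), Or.inr (Or.inr (Or.inl rfl)), Or.inr (Or.inr (Or.inr rfl))⟩)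
    (ob := ![1, 2, 0, 1, 2]) (deg := ![1, 1, 1, 0, 0])
    (up := ![[2, 3, 4], [2, 3, 4], [3, 4], [], []])
    (cov := ![[2], [2], [3, 4], [], []]) (N := ![1, 1, 1])
    (lo := ![![1, 1, 1], ![0, 1, 1], ![0, 1, 1]])
    (ed := ![![[], [1], [1]], ![[0], [], []], ![[0], [], []]])
    (src := ![false, false, false]) (tgt := ![false, false, false])
    (forall_fin_three.2 ⟨pow_ne_of_le (m := 1) (by omega) H.nzy, pow_ne_of_le (m := 1) (by omega) H.nza, H.nzb⟩)
    (forall_fin_three.2 ⟨forall_fin_three.2 ⟨mem_none, mem_one H.exa, mem_one H.exb⟩, forall_fin_three.2 ⟨mem_one H.ex_ay, mem_none, mem_none⟩, forall_fin_three.2 ⟨mem_one H.ex_by, mem_none, mem_none⟩⟩)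
    (forall_fin_three.2 ⟨forall_fin_three.2 ⟨self_ge_one, ge_one H.not_ya, ge_one H.not_yb⟩, forall_fin_three.2 ⟨ge_zero, self_ge_one, ge_one H.not_ab⟩, forall_fin_three.2 ⟨ge_zero, ge_one H.not_ba, self_ge_one⟩⟩)
    (forall_fin_three.2 ⟨fun h => absurd h (by decide), fun h => absurd h (by decide), fun h => absurd h (by decide)⟩)
    (forall_fin_three.2 ⟨fun h => absurd h (by decide), fun h => absurd h (by decide), fun h => absurd h (by decide)⟩)
    (by decide) (by decide) (by decide) (by decide) (by decide) (by decide) (by decide)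
    (Kind.shape_of_root ![Kind.sub 0, Kind.sub 1, Kind.full, Kind.quot 2, Kind.quot 3] (by decide) 2 (by decide) (by decide) (by decide) rfl (by decide))

/-- First subcase of the case where `G x` factors through `G a`. -/
theorem false_of_xa_ax_one (H : Graded x y a b G I i) (hxy : x ≠ y) (hxa : x ≠ a)
    (hyx : ¬ ExDeg G y x 1) (h0 : ExDeg G x a 0) (h : ExDeg G a x 1) : False := by
  refine H.false_of_table (k := 3) (n := 5) ![x, a, y] (injective_three hxa hxy H.hay)
    (forall_fin_three.2 ⟨Or.inl rfl, Or.inr (Or.inr (Or.inl rfl)), Or.inr (Or.inl rfl)⟩)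
    (ob := ![0, 2, 1, 0, 2]) (deg := ![1, 2, 1, 0, 1])
    (up := ![[2, 3, 4], [2, 3, 4], [3, 4], [], []])
    (cov := ![[2], [2], [3, 4], [], []]) (N := ![1, 1, 2])
    (lo := ![![1, 0, 0], ![1, 1, 0], ![2, 1, 1]])
    (ed := ![![[], [0], []], ![[1], [], [0]], ![[], [1], []]])
    (src := ![false, false, false]) (tgt := ![true, true, false])
    (forall_fin_three.2 ⟨pow_ne_of_le (m := 1) (by omega) H.nzx, pow_ne_of_le (m := 1) (by omega) H.nza, pow_ne_of_le (m := 2) (by omega) H.nzy⟩)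
    (forall_fin_three.2 ⟨forall_fin_three.2 ⟨mem_none, mem_one h0, mem_none⟩, forall_fin_three.2 ⟨mem_one h, mem_none, mem_one H.ex_ay⟩, forall_fin_three.2 ⟨mem_none, mem_one H.exa, mem_none⟩⟩)
    (forall_fin_three.2 ⟨forall_fin_three.2 ⟨self_ge_one, ge_zero, ge_zero⟩, forall_fin_three.2 ⟨ge_one (H.not_ax hxy hxa), self_ge_one, ge_zero⟩, forall_fin_three.2 ⟨ge_two (H.not_yx hxy) hyx, ge_one H.not_ya, self_ge_one⟩⟩)
    (forall_fin_three.2 ⟨fun h => absurd h (by decide), fun h => absurd h (by decide), fun h => absurd h (by decide)⟩)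
    (forall_fin_three.2 ⟨fun _ => hxy, fun _ => H.hay, fun h => absurd h (by decide)⟩)
    (by decide) (by decide) (by decide) (by decide) (by decide) (by decide) (by decide)
    (Kind.shape_of_root ![Kind.sub 0, Kind.sub 1, Kind.full, Kind.quot 2, Kind.quot 3] (by decide) 2 (by decide) (by decide) (by decide) rfl (by decide))

/-- Second subcase of the case where `G x` factors through `G a`. -/
theorem false_of_xa_xx_ax_two (H : Graded x y a b G I i) (hxy : x ≠ y) (hxa : x ≠ a)
    (h0 : ExDeg G x a 0)
    (hax : ¬ ExDeg G a x 1) (hxx : ExDeg G x x 1) (h : ExDeg G a x 2) : False := by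
  refine H.false_of_table (k := 2) (n := 4) ![x, a] (injective_two hxa)
    (Fin.forall_fin_two.2 ⟨Or.inl rfl, Or.inr (Or.inr (Or.inl rfl))⟩)
    (ob := ![1, 0, 1, 0]) (deg := ![2, 1, 1, 0])
    (up := ![[2, 3], [2, 3], [], []])
    (cov := ![[2, 3], [2, 3], [], []]) (N := ![1, 2])
    (lo := ![![1, 0], ![2, 1]])
    (ed := ![![[1], [0]], ![[2], [1]]])
    (src := ![false, false]) (tgt := ![true, true])
    (Fin.forall_fin_two.2 ⟨pow_ne_of_le (m := 1) (by omega) H.nzx, pow_ne_of_le (m := 2) (by omega) (H.nza_of h0)⟩)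
    (Fin.forall_fin_two.2 ⟨Fin.forall_fin_two.2 ⟨mem_one hxx, mem_one h0⟩, Fin.forall_fin_two.2 ⟨mem_one h, mem_one H.ex_aa⟩⟩)
    (Fin.forall_fin_two.2 ⟨Fin.forall_fin_two.2 ⟨self_ge_one, ge_zero⟩, Fin.forall_fin_two.2 ⟨ge_two (H.not_ax hxy hxa) hax, self_ge_one⟩⟩)
    (Fin.forall_fin_two.2 ⟨fun h => absurd h (by decide), fun h => absurd h (by decide)⟩)
    (Fin.forall_fin_two.2 ⟨fun _ => hxy, fun _ => H.hay⟩)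
    (by decide) (by decide) (by decide) (by decide) (by decide) (by decide) (by decide)
    (Kind.shape_four (by decide))

/-- Third subcase of the case where `G x` factors through `G a`. -/
theorem false_of_xa_xx (H : Graded x y a b G I i) (hxy : x ≠ y) (hxa : x ≠ a)
    (hyx : ¬ ExDeg G y x 1) (h0 : ExDeg G x a 0)
    (hyx2 : ¬ ExDeg G y x 2) (hax : ¬ ExDeg G a x 1) (hax2 : ¬ ExDeg G a x 2)
    (hxx : ExDeg G x x 1) : False := by
  refine H.false_of_table (k := 3) (n := 8) ![x, a, y] (injective_three hxa hxy H.hay)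
    (forall_fin_three.2 ⟨Or.inl rfl, Or.inr (Or.inr (Or.inl rfl)), Or.inr (Or.inl rfl)⟩)
    (ob := ![1, 2, 1, 2, 1, 0, 0, 0]) (deg := ![3, 3, 2, 2, 1, 2, 1, 0])
    (up := EShape.up)
    (cov := ![[1], [2], [3], [4], [], [2, 6], [4, 7], []]) (N := ![2, 2, 2])
    (lo := ![![1, 0, 0], ![3, 1, 0], ![3, 1, 1]])
    (ed := ![![[1], [0], []], ![[], [], [0]], ![[], [1], []]])
    (src := ![false, false, false]) (tgt := ![true, true, false])
    (forall_fin_three.2 ⟨pow_ne_of_le (m := 2) (by omega) H.nzx, pow_ne_of_le (m := 2) (by omega) (H.nza_of h0), pow_ne_of_le (m := 2) (by omega) H.nzy⟩)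
    (forall_fin_three.2 ⟨forall_fin_three.2 ⟨mem_one hxx, mem_one h0, mem_none⟩, forall_fin_three.2 ⟨mem_none, mem_none, mem_one H.ex_ay⟩, forall_fin_three.2 ⟨mem_none, mem_one H.exa, mem_none⟩⟩)
    (forall_fin_three.2 ⟨forall_fin_three.2 ⟨self_ge_one, ge_zero, ge_zero⟩, forall_fin_three.2 ⟨ge_three (H.not_ax hxy hxa) hax hax2, self_ge_one, ge_zero⟩, forall_fin_three.2 ⟨ge_three (H.not_yx hxy) hyx hyx2, ge_one H.not_ya, self_ge_one⟩⟩)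
    (forall_fin_three.2 ⟨fun h => absurd h (by decide), fun h => absurd h (by decide), fun h => absurd h (by decide)⟩)
    (forall_fin_three.2 ⟨fun _ => hxy, fun _ => H.hay, fun h => absurd h (by decide)⟩)
    (by decide) (by decide) (by decide) (by decide) (by decide) (by decide) (by decide)
    (EShape.shape fun _ _ => Iff.rfl)

/-- Fourth subcase of the case where `G x` factors through `G a`. -/
theorem false_of_xa_yx_two (H : Graded x y a b G I i) (hxy : x ≠ y) (hxa : x ≠ a)
    (hyx : ¬ ExDeg G y x 1) (h0 : ExDeg G x a 0)
    (hax : ¬ ExDeg G a x 1) (hxx : ¬ ExDeg G x x 1) (h : ExDeg G y x 2) : False := by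
  refine H.false_of_table (k := 3) (n := 6) ![x, a, y] (injective_three hxa hxy H.hay)
    (forall_fin_three.2 ⟨Or.inl rfl, Or.inr (Or.inr (Or.inl rfl)), Or.inr (Or.inl rfl)⟩)
    (ob := ![1, 2, 0, 1, 2, 0]) (deg := ![2, 2, 0, 1, 1, 1])
    (up := ![[1, 2, 3, 4], [2, 3, 4], [], [4], [], [3, 4]])
    (cov := ![[1], [2, 3], [], [4], [], [3]]) (N := ![1, 2, 2])
    (lo := ![![2, 0, 0], ![2, 1, 0], ![2, 1, 1]])
    (ed := ![![[], [0], []], ![[], [], [0]], ![[2], [1], []]])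
    (src := ![false, false, false]) (tgt := ![true, true, false])
    (forall_fin_three.2 ⟨pow_ne_of_le (m := 1) (by omega) H.nzx, pow_ne_of_le (m := 2) (by omega) (H.nza_of h0), pow_ne_of_le (m := 2) (by omega) H.nzy⟩)
    (forall_fin_three.2 ⟨forall_fin_three.2 ⟨mem_none, mem_one h0, mem_none⟩, forall_fin_three.2 ⟨mem_none, mem_none, mem_one H.ex_ay⟩, forall_fin_three.2 ⟨mem_one h, mem_one H.exa, mem_none⟩⟩)
    (forall_fin_three.2 ⟨forall_fin_three.2 ⟨self_ge_two hxx, ge_zero, ge_zero⟩, forall_fin_three.2 ⟨ge_two (H.not_ax hxy hxa) hax, self_ge_one, ge_zero⟩, forall_fin_three.2 ⟨ge_two (H.not_yx hxy) hyx, ge_one H.not_ya, self_ge_one⟩⟩)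
    (forall_fin_three.2 ⟨fun h => absurd h (by decide), fun h => absurd h (by decide), fun h => absurd h (by decide)⟩)
    (forall_fin_three.2 ⟨fun _ => hxy, fun _ => H.hay, fun h => absurd h (by decide)⟩)
    (by decide) (by decide) (by decide) (by decide) (by decide) (by decide) (by decide)
    (Kind.shape_of_root ![Kind.sub 0, Kind.full, Kind.quot 2, Kind.full, Kind.quot 3, Kind.sub 1] (by decide) 1 (by decide) (by decide) (by decide) rfl (by decide))

/-- Fifth subcase of the case where `G x` factors through `G a`. -/
theorem false_of_xa (H : Graded x y a b G I i) (hxy : x ≠ y) (hxa : x ≠ a)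
    (hyx : ¬ ExDeg G y x 1) (h0 : ExDeg G x a 0)
    (hyx2 : ¬ ExDeg G y x 2) (hax : ¬ ExDeg G a x 1) (hxx : ¬ ExDeg G x x 1) : False := by
  refine H.false_of_table (k := 3) (n := 7) ![x, a, y] (injective_three hxa hxy H.hay)
    (forall_fin_three.2 ⟨Or.inl rfl, Or.inr (Or.inr (Or.inl rfl)), Or.inr (Or.inl rfl)⟩)
    (ob := ![2, 1, 2, 1, 2, 0, 0]) (deg := ![2, 1, 1, 0, 0, 1, 0])
    (up := ![[1, 2, 3, 4], [2, 3, 4], [3, 4], [4], [], [1, 2, 3, 4], [3, 4]])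
    (cov := ![[1], [2], [3], [4], [], [1], [3]]) (N := ![1, 1, 2])
    (lo := ![![2, 0, 0], ![2, 1, 0], ![3, 1, 1]])
    (ed := ![![[], [0], []], ![[], [], [0]], ![[], [1], []]])
    (src := ![false, false, true]) (tgt := ![true, true, false])
    (forall_fin_three.2 ⟨pow_ne_of_le (m := 1) (by omega) H.nzx, pow_ne_of_le (m := 1) (by omega) H.nza, pow_ne_of_le (m := 2) (by omega) H.nzy⟩)
    (forall_fin_three.2 ⟨forall_fin_three.2 ⟨mem_none, mem_one h0, mem_none⟩, forall_fin_three.2 ⟨mem_none, mem_none, mem_one H.ex_ay⟩, forall_fin_three.2 ⟨mem_none, mem_one H.exa, mem_none⟩⟩)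
    (forall_fin_three.2 ⟨forall_fin_three.2 ⟨self_ge_two hxx, ge_zero, ge_zero⟩, forall_fin_three.2 ⟨ge_two (H.not_ax hxy hxa) hax, self_ge_one, ge_zero⟩, forall_fin_three.2 ⟨ge_three (H.not_yx hxy) hyx hyx2, ge_one H.not_ya, self_ge_one⟩⟩)
    (forall_fin_three.2 ⟨fun h => absurd h (by decide), fun h => absurd h (by decide), fun _ => H.not_yx hxy⟩)
    (forall_fin_three.2 ⟨fun _ => hxy, fun _ => H.hay, fun h => absurd h (by decide)⟩)
    (by decide) (by decide) (by decide) (by decide) (by decide) (by decide) (by decide)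
    (Kind.shape_of_root ![Kind.sub 1, Kind.full, Kind.full, Kind.full, Kind.quot 3, Kind.sub 0, Kind.sub 2] (by decide) 1 (by decide) (by decide) (by decide) rfl (by decide))

/-- The case where `G x` factors neither through `G a` nor `G b`. -/
theorem false_of_not_xb (H : Graded x y a b G I i) (hxy : x ≠ y) (hxa : x ≠ a)
    (h0 : ¬ ExDeg G x a 0) (hxb : x ≠ b) (hb : ¬ ExDeg G x b 0) : False := by
  refine H.false_of_table (k := 4) (n := 5) ![x, a, b, y] (injective_four hxa hxb hxy H.hab H.hay H.hby)
    (forall_fin_four.2 ⟨Or.inl rfl, Or.inr (Or.inr (Or.inl rfl)), Or.inr (Or.inr (Or.inr rfl)), Or.inr (Or.inl rfl)⟩)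
    (ob := ![0, 1, 2, 3, 1]) (deg := ![1, 1, 1, 1, 0])
    (up := ![[3, 4], [3, 4], [3, 4], [4], []])
    (cov := ![[3], [3], [3], [4], []]) (N := ![1, 1, 1, 1])
    (lo := ![![1, 1, 1, 0], ![1, 1, 1, 0], ![1, 1, 1, 0], ![1, 1, 1, 1]])
    (ed := ![![[], [], [], [0]], ![[], [], [], [0]], ![[], [], [], [0]], ![[], [1], [], []]])
    (src := ![false, false, false, false]) (tgt := ![true, true, true, false])
    (forall_fin_four.2 ⟨pow_ne_of_le (m := 1) (by omega) H.nzx, pow_ne_of_le (m := 1) (by omega) H.nza, H.nzb, pow_ne_of_le (m := 1) (by omega) H.nzy⟩)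
    (forall_fin_four.2 ⟨forall_fin_four.2 ⟨mem_none, mem_none, mem_none, mem_one H.ex_xy⟩, forall_fin_four.2 ⟨mem_none, mem_none, mem_none, mem_one H.ex_ay⟩, forall_fin_four.2 ⟨mem_none, mem_none, mem_none, mem_one H.ex_by⟩, forall_fin_four.2 ⟨mem_none, mem_one H.exa, mem_none, mem_none⟩⟩)
    (forall_fin_four.2 ⟨forall_fin_four.2 ⟨self_ge_one, ge_one h0, ge_one hb, ge_zero⟩, forall_fin_four.2 ⟨ge_one (H.not_ax hxy hxa), self_ge_one, ge_one H.not_ab, ge_zero⟩, forall_fin_four.2 ⟨ge_one (H.not_bx hxy hxb), ge_one H.not_ba, self_ge_one, ge_zero⟩, forall_fin_four.2 ⟨ge_one (H.not_yx hxy), ge_one H.not_ya, ge_one H.not_yb, self_ge_one⟩⟩)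
    (forall_fin_four.2 ⟨fun h => absurd h (by decide), fun h => absurd h (by decide), fun h => absurd h (by decide), fun h => absurd h (by decide)⟩)
    (forall_fin_four.2 ⟨fun _ => hxy, fun _ => H.hay, fun _ => H.hby, fun h => absurd h (by decide)⟩)
    (by decide) (by decide) (by decide) (by decide) (by decide) (by decide) (by decide)
    (Kind.shape_of_root ![Kind.sub 0, Kind.sub 1, Kind.sub 2, Kind.full, Kind.quot 3] (by decide) 3 (by decide) (by decide) (by decide) rfl (by decide))

/-- The case of a nontrivial endomorphism of `x` and a morphism of degree two from `y`. -/
theorem false_of_xx_yx_two (H : Graded x y a b G I i) (hxy : x ≠ y)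
    (hyx : ¬ ExDeg G y x 1) (hxx : ExDeg G x x 1) (h : ExDeg G y x 2) : False := by
  refine H.false_of_table (k := 2) (n := 4) ![x, y] (injective_two hxy)
    (Fin.forall_fin_two.2 ⟨Or.inl rfl, Or.inr (Or.inl rfl)⟩)
    (ob := ![1, 0, 1, 0]) (deg := ![2, 1, 1, 0])
    (up := ![[2, 3], [2, 3], [], []])
    (cov := ![[2, 3], [2, 3], [], []]) (N := ![1, 2])
    (lo := ![![1, 0], ![2, 1]])
    (ed := ![![[1], [0]], ![[2], [1]]])
    (src := ![false, false]) (tgt := ![true, false])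
    (Fin.forall_fin_two.2 ⟨pow_ne_of_le (m := 1) (by omega) H.nzx, pow_ne_of_le (m := 2) (by omega) H.nzy⟩)
    (Fin.forall_fin_two.2 ⟨Fin.forall_fin_two.2 ⟨mem_one hxx, mem_one H.ex_xy⟩, Fin.forall_fin_two.2 ⟨mem_one h, mem_one H.ex_yy⟩⟩)
    (Fin.forall_fin_two.2 ⟨Fin.forall_fin_two.2 ⟨self_ge_one, ge_zero⟩, Fin.forall_fin_two.2 ⟨ge_two (H.not_yx hxy) hyx, self_ge_one⟩⟩)
    (Fin.forall_fin_two.2 ⟨fun h => absurd h (by decide), fun h => absurd h (by decide)⟩)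
    (Fin.forall_fin_two.2 ⟨fun _ => hxy, fun h => absurd h (by decide)⟩)
    (by decide) (by decide) (by decide) (by decide) (by decide) (by decide) (by decide)
    (Kind.shape_four (by decide))

/-- The case of a nontrivial endomorphism of `x` where `G x` does not factor through `G a`. -/
theorem false_of_xx (H : Graded x y a b G I i) (hxy : x ≠ y) (hxa : x ≠ a)
    (hyx : ¬ ExDeg G y x 1) (h0 : ¬ ExDeg G x a 0)
    (hyx2 : ¬ ExDeg G y x 2) (hax : ¬ ExDeg G a x 1) (hxx : ExDeg G x x 1) : False := by
  refine H.false_of_table (k := 3) (n := 8) ![x, a, y] (injective_three hxa hxy H.hay)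
    (forall_fin_three.2 ⟨Or.inl rfl, Or.inr (Or.inr (Or.inl rfl)), Or.inr (Or.inl rfl)⟩)
    (ob := ![2, 1, 2, 1, 2, 0, 0, 0]) (deg := ![3, 2, 2, 1, 1, 2, 1, 0])
    (up := EShape.up)
    (cov := ![[1], [2], [3], [4], [], [2, 6], [4, 7], []]) (N := ![2, 1, 2])
    (lo := ![![1, 1, 0], ![2, 1, 0], ![3, 1, 1]])
    (ed := ![![[1], [], [0]], ![[], [], [0]], ![[], [1], []]])
    (src := ![false, false, true]) (tgt := ![true, true, false])
    (forall_fin_three.2 ⟨pow_ne_of_le (m := 2) (by omega) H.nzx, pow_ne_of_le (m := 1) (by omega) H.nza, pow_ne_of_le (m := 2) (by omega) H.nzy⟩)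
    (forall_fin_three.2 ⟨forall_fin_three.2 ⟨mem_one hxx, mem_none, mem_one H.ex_xy⟩, forall_fin_three.2 ⟨mem_none, mem_none, mem_one H.ex_ay⟩, forall_fin_three.2 ⟨mem_none, mem_one H.exa, mem_none⟩⟩)
    (forall_fin_three.2 ⟨forall_fin_three.2 ⟨self_ge_one, ge_one h0, ge_zero⟩, forall_fin_three.2 ⟨ge_two (H.not_ax hxy hxa) hax, self_ge_one, ge_zero⟩, forall_fin_three.2 ⟨ge_three (H.not_yx hxy) hyx hyx2, ge_one H.not_ya, self_ge_one⟩⟩)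
    (forall_fin_three.2 ⟨fun h => absurd h (by decide), fun h => absurd h (by decide), fun _ => H.not_yx hxy⟩)
    (forall_fin_three.2 ⟨fun _ => hxy, fun _ => H.hay, fun h => absurd h (by decide)⟩)
    (by decide) (by decide) (by decide) (by decide) (by decide) (by decide) (by decide)
    (EShape.shape fun _ _ => Iff.rfl)

/-- The case of large degree where `x` has no nontrivial endomorphism. -/
theorem false_of_not_xx (H : Graded x y a b G I i) (hxy : x ≠ y) (hxa : x ≠ a)
    (hyx : ¬ ExDeg G y x 1) (h0 : ¬ ExDeg G x a 0)
    (hax : ¬ ExDeg G a x 1) (hxx : ¬ ExDeg G x x 1) (hi : 1 ≤ i) : False := by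
  refine H.false_of_table (k := 3) (n := 7) ![x, a, y] (injective_three hxa hxy H.hay)
    (forall_fin_three.2 ⟨Or.inl rfl, Or.inr (Or.inr (Or.inl rfl)), Or.inr (Or.inl rfl)⟩)
    (ob := ![1, 0, 2, 1, 2, 0, 1]) (deg := ![2, 2, 2, 1, 1, 1, 0])
    (up := ![[2, 3, 4, 6], [2, 3, 4, 6], [3, 4, 6], [4, 6], [6], [4, 6], []])
    (cov := ![[2], [2], [3], [4], [6], [4], []]) (N := ![2, 2, 2])
    (lo := ![![2, 1, 0], ![2, 1, 0], ![2, 1, 1]])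
    (ed := ![![[], [], [0]], ![[], [], [0]], ![[], [1], []]])
    (src := ![false, false, false]) (tgt := ![true, true, false])
    (forall_fin_three.2 ⟨pow_ne_of_le (m := 2) (by omega) H.nzx, pow_ne_of_le (m := 2) (by omega) H.nza, pow_ne_of_le (m := 2) (by omega) H.nzy⟩)
    (forall_fin_three.2 ⟨forall_fin_three.2 ⟨mem_none, mem_none, mem_one H.ex_xy⟩, forall_fin_three.2 ⟨mem_none, mem_none, mem_one H.ex_ay⟩, forall_fin_three.2 ⟨mem_none, mem_one H.exa, mem_none⟩⟩)
    (forall_fin_three.2 ⟨forall_fin_three.2 ⟨self_ge_two hxx, ge_one h0, ge_zero⟩, forall_fin_three.2 ⟨ge_two (H.not_ax hxy hxa) hax, self_ge_one, ge_zero⟩, forall_fin_three.2 ⟨ge_two (H.not_yx hxy) hyx, ge_one H.not_ya, self_ge_one⟩⟩)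
    (forall_fin_three.2 ⟨fun h => absurd h (by decide), fun h => absurd h (by decide), fun h => absurd h (by decide)⟩)
    (forall_fin_three.2 ⟨fun _ => hxy, fun _ => H.hay, fun h => absurd h (by decide)⟩)
    (by decide) (by decide) (by decide) (by decide) (by decide) (by decide) (by decide)
    (Kind.shape_of_root ![Kind.sub 0, Kind.sub 1, Kind.full, Kind.full, Kind.full, Kind.sub 2, Kind.quot 3] (by decide) 2 (by decide) (by decide) (by decide) rfl (by decide))

end Graded

end RayCategory

namespace RayCategory

set_option synthInstance.maxHeartbeats 400000
set_option synthInstance.maxSize 4000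
set_option maxRecDepth 100000

/-- lower bounds for the degrees of non-identities between `y`, `a`, `b` if `x = y` -/
def loopLo (l : ℕ) : Fin 3 → Fin 3 → ℕ := ![![1, 1, l], ![0, 1, l], ![0, 1, 1]]

def loopUp : Fin 7 → List (Fin 7) :=
  ![[1, 2, 3, 4, 5], [2, 3, 4, 5], [], [4, 5], [5], [], [4, 5]]

def loopCov : Fin 7 → List (Fin 7) := ![[1], [2, 3], [], [4], [5], [], [4]]

def loopOb : Fin 7 → Fin 3 := ![1, 0, 2, 1, 0, 1, 2]

def loopDeg (l : ℕ) : Fin 7 → ℕ := ![l, l, 0, l - 1, l - 1, l - 2, l - 1]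

theorem loopConv {l : ℕ} (hl : 2 ≤ l) (s u : Fin 7) (j : Fin 3) (q r : ℕ)
    (hle : s = u ∨ u ∈ loopUp s) (h1 : loopDeg l s = loopDeg l u + (q + r))
    (h2 : (loopOb s = j ∧ q = 0) ∨ loopLo l (loopOb s) j ≤ q)
    (h3 : (j = loopOb u ∧ r = 0) ∨ loopLo l j (loopOb u) ≤ r) :
    ∃ t, loopOb t = j ∧ (s = t ∨ t ∈ loopUp s) ∧ (t = u ∨ u ∈ loopUp t) ∧
      loopDeg l t = loopDeg l u + r := by
  have hr : r = 0 ∨ r = 1 ∨ r = 2 ∨ 3 ≤ r := by omega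
  have hq : q = 0 ∨ q = 1 ∨ q = 2 ∨ 3 ≤ q := by omega
  fin_cases s <;> fin_cases u <;> simp [loopUp] at hle <;> fin_cases j <;>
    simp [loopOb, loopLo] at h2 h3 <;> simp [loopDeg] at h1 <;>
    first
    | omega
    | (rcases hr with rfl | rfl | rfl | hr <;>
    rcases hq with rfl | rfl | rfl | hq <;>
    first
    | omega
    | (refine ⟨0, rfl, by simp [loopUp], by simp [loopUp], ?_⟩ <;> simp [loopDeg] <;> omega)
    | (refine ⟨1, rfl, by simp [loopUp], by simp [loopUp], ?_⟩ <;> simp [loopDeg] <;> omega)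
    | (refine ⟨2, rfl, by simp [loopUp], by simp [loopUp], ?_⟩ <;> simp [loopDeg] <;> omega)
    | (refine ⟨3, rfl, by simp [loopUp], by simp [loopUp], ?_⟩ <;> simp [loopDeg] <;> omega)
    | (refine ⟨4, rfl, by simp [loopUp], by simp [loopUp], ?_⟩ <;> simp [loopDeg] <;> omega)
    | (refine ⟨5, rfl, by simp [loopUp], by simp [loopUp], ?_⟩ <;> simp [loopDeg] <;> omega)
    | (refine ⟨6, rfl, by simp [loopUp], by simp [loopUp], ?_⟩ <;> simp [loopDeg] <;> omega))

namespace Graded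

variable {P : RayCategory} {x y a b c d : P.Obj}
variable {G : ∀ c, P.Hom c y} {I : ∀ a b : P.Obj, P.Hom a b → Prop} {i : ℕ}

theorem a_ne_source (H : Graded y y a b G I i) {q : ℕ} (h : ExDeg G a b q) : i + 1 ≤ q := by
  by_contra hq
  have h0 : q ≠ 0 := by
    rintro rfl
    exact H.not_ab h
  have h1 : ExDeg G y a (i + 1 - q) := by
    have := (H.ex_target (c := y) (p := i - q) (pow_ne_of_le (by omega) H.nzy)).comp H.exa
    have h2 := this (pow_ne_of_le (by omega) H.nzy)
    rwa [show i - q + 1 = i + 1 - q by omega] at h2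
  exact H.hay (H.princ a _ q h1 h (by omega) (by omega)).2

theorem le_of_exDeg_target (H : Graded x y a b G I i) {q : ℕ} (h : ExDeg G y b q) :
    i + 1 ≤ q := by
  by_contra hq
  have h0 : q ≠ 0 := by
    rintro rfl
    exact H.not_yb h
  have h1 : ExDeg G x y (i + 1 - q) := H.ex_target (pow_ne_of_le (by omega) H.nzx)
  have := (H.princ y _ q h1 h (by omega) (by omega)).1
  omega

theorem false_of_eq_pos (H : Graded y y a b G I i) (hi : 1 ≤ i) : False := by
  refine H.false_of_family (k := 3) (n := 7) ![y, a, b]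
    (injective_three H.hay.symm H.hby.symm H.hab)
    (forall_fin_three.2 ⟨Or.inl rfl, Or.inr (Or.inr (Or.inl rfl)), Or.inr (Or.inr (Or.inr rfl))⟩)
    loopOb (loopDeg (i + 1)) loopUp loopCov ![i + 2, i + 1, 1]
    (fun j j' p => (j = j' ∧ p = 0) ∨ loopLo (i + 1) j j' ≤ p)
    (fun j j' p => (j = 0 ∧ j' = 1 ∧ p = 1) ∨ (j = 0 ∧ j' = 2 ∧ p = i + 1) ∨
      (j = 1 ∧ j' = 0 ∧ p = 0) ∨ (j = 2 ∧ j' = 0 ∧ p = 0))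
    (forall_fin_three.2 ⟨H.nzy, H.nza, H.nzb⟩) ?_
    (forall_fin_three.2 ⟨forall_fin_three.2 ⟨self_ge_one, ge_one H.not_ya, ?_⟩,
      forall_fin_three.2 ⟨ge_zero, self_ge_one, ?_⟩,
      forall_fin_three.2 ⟨ge_zero, ge_one H.not_ba, self_ge_one⟩⟩)
    ?_ (by decide) (by decide) ?_ ?_ ?_ (fun s u j q r => loopConv (by omega) s u j q r)
    (Kind.shape_of_root ![Kind.sub 0, Kind.full, Kind.quot 1, Kind.full, Kind.full, Kind.quot 2,
      Kind.sub 3] (by decide) 1 (by decide) (by decide) (by decide) rfl (by decide))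
  · rintro j j' p (⟨rfl, rfl, rfl⟩ | ⟨rfl, rfl, rfl⟩ | ⟨rfl, rfl, rfl⟩ | ⟨rfl, rfl, rfl⟩)
    · exact H.exa
    · exact H.exb
    · exact H.ex_ay
    · exact H.ex_by
  · exact fun p hp => Or.inr (H.le_of_exDeg_target hp)
  · exact fun p hp => Or.inr (H.a_ne_source hp)
  · intro s t h1 h2
    fin_cases s <;> fin_cases t <;> simp [loopOb, loopDeg] at h1 h2 ⊢ <;> omega
  · intro s t hst
    fin_cases s <;> fin_cases t <;> simp [loopUp] at hst <;> simp [loopOb, loopDeg] <;> omega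
  · intro s t hst
    fin_cases s <;> fin_cases t <;> simp [loopCov] at hst <;>
      simp [loopUp, loopOb, loopDeg] <;> omega
  · intro s t hst
    fin_cases s <;> fin_cases t <;> simp [loopUp] at hst <;> simp [loopDeg] <;> omega

end Graded

end RayCategory

namespace RayCategory

set_option synthInstance.maxHeartbeats 400000
set_option synthInstance.maxSize 4000
set_option maxRecDepth 100000

/-- lower bounds for the degrees of non-identities between `x`, `b`, `y` -/
def backLo (l i : ℕ) : Fin 3 → Fin 3 → ℕ := ![![1, l, 0], ![1, 1, 0], ![1, i + 2, 1]]

def backUp : Fin 6 → List (Fin 6) := ![[1, 2, 3, 4], [2, 3, 4], [3], [], [], [2, 3]]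

def backCov : Fin 6 → List (Fin 6) := ![[1], [2, 4], [3], [], [], [2]]

def backOb : Fin 6 → Fin 3 := ![2, 0, 2, 0, 1, 1]

def backDeg (l : ℕ) : Fin 6 → ℕ := ![l + 1, l, l, l - 1, 0, l]

theorem backConv {l i : ℕ} (hl : 1 ≤ l) (hli : l ≤ i + 1) (s u : Fin 6) (j : Fin 3) (q r : ℕ)
    (hle : s = u ∨ u ∈ backUp s) (h1 : backDeg l s = backDeg l u + (q + r))
    (h2 : (backOb s = j ∧ q = 0) ∨ backLo l i (backOb s) j ≤ q)
    (h3 : (j = backOb u ∧ r = 0) ∨ backLo l i j (backOb u) ≤ r) :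
    ∃ t, backOb t = j ∧ (s = t ∨ t ∈ backUp s) ∧ (t = u ∨ u ∈ backUp t) ∧
      backDeg l t = backDeg l u + r := by
  have hr : r = 0 ∨ r = 1 ∨ r = 2 ∨ 3 ≤ r := by omega
  have hq : q = 0 ∨ q = 1 ∨ q = 2 ∨ 3 ≤ q := by omega
  fin_cases s <;> fin_cases u <;> simp [backUp] at hle <;> fin_cases j <;>
    simp [backOb, backLo] at h2 h3 <;> simp [backDeg] at h1 <;>
    first
    | omega
    | (rcases hr with rfl | rfl | rfl | hr <;>
    rcases hq with rfl | rfl | rfl | hq <;>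
    first
    | omega
    | (refine ⟨0, rfl, by simp [backUp], by simp [backUp], ?_⟩; simp [backDeg] <;> omega)
    | (refine ⟨1, rfl, by simp [backUp], by simp [backUp], ?_⟩; simp [backDeg] <;> omega)
    | (refine ⟨2, rfl, by simp [backUp], by simp [backUp], ?_⟩; simp [backDeg] <;> omega)
    | (refine ⟨3, rfl, by simp [backUp], by simp [backUp], ?_⟩; simp [backDeg] <;> omega)
    | (refine ⟨4, rfl, by simp [backUp], by simp [backUp], ?_⟩; simp [backDeg] <;> omega)
    | (refine ⟨5, rfl, by simp [backUp], by simp [backUp], ?_⟩; simp [backDeg] <;> omega))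

namespace Graded

variable {P : RayCategory} {x y a b c d : P.Obj}
variable {G : ∀ c, P.Hom c y} {I : ∀ a b : P.Obj, P.Hom a b → Prop} {i : ℕ}

theorem lt_of_exDeg_target (H : Graded x y a b G I i) (hxy : x ≠ y) {q : ℕ}
    (h : ExDeg G y b q) : i + 2 ≤ q := by
  rcases (H.le_of_exDeg_target h).lt_or_eq with h1 | rfl
  · exact h1
  · exact absurd (H.princ y 0 (i + 1) H.ex_xy h (by omega) (by omega)).2 (Ne.symm hxy)

theorem false_of_yx (H : Graded x y a b G I i) (hxy : x ≠ y) (hyx : ExDeg G y x 1) : False := by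
  classical
  have hxb : x ≠ b := by
    rintro rfl
    have := H.lt_of_exDeg_target hxy hyx
    omega
  have hex : ∃ l, ExDeg G x b l := ⟨_, H.exb⟩
  obtain ⟨l, hl, hmin⟩ : ∃ l, ExDeg G x b l ∧ ∀ p, ExDeg G x b p → l ≤ p :=
    ⟨Nat.find hex, Nat.find_spec hex, fun p hp => Nat.find_min' hex hp⟩
  have hli : l ≤ i + 1 := hmin _ H.exb
  have h1 : ExDeg G y b (1 + l) := by
    have := hyx.comp hl (pow_ne_of_le (by omega) H.nzy)
    exact this
  have hl1 : 1 ≤ l := by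
    have := H.lt_of_exDeg_target hxy h1
    omega
  refine H.false_of_family (k := 3) (n := 6) ![x, b, y]
    (injective_three hxb hxy H.hby)
    (forall_fin_three.2 ⟨Or.inl rfl, Or.inr (Or.inr (Or.inr rfl)), Or.inr (Or.inl rfl)⟩)
    backOb (backDeg l) backUp backCov ![i + 2, 1, i + 2]
    (fun j j' p => (j = j' ∧ p = 0) ∨ backLo l i j j' ≤ p)
    (fun j j' p => (j = 2 ∧ j' = 0 ∧ p = 1) ∨ (j = 0 ∧ j' = 2 ∧ p = 0) ∨
      (j = 0 ∧ j' = 1 ∧ p = l) ∨ (j = 1 ∧ j' = 2 ∧ p = 0))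
    (forall_fin_three.2 ⟨H.nzx, H.nzb, H.nzy⟩) ?_
    (forall_fin_three.2 ⟨forall_fin_three.2 ⟨self_ge_one, ?_, ge_zero⟩,
      forall_fin_three.2 ⟨ge_one (H.not_bx hxy hxb), self_ge_one, ge_zero⟩,
      forall_fin_three.2 ⟨ge_one (H.not_yx hxy), ?_, self_ge_one⟩⟩)
    ?_ (by decide) (by decide) ?_ ?_ ?_ (fun s u j q r => backConv hl1 hli s u j q r)
    (Kind.shape_of_root ![Kind.sub 0, Kind.full, Kind.full, Kind.quot 1, Kind.quot 2,
      Kind.sub 3] (by decide) 1 (by decide) (by decide) (by decide) rfl (by decide))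
  · rintro j j' p (⟨rfl, rfl, rfl⟩ | ⟨rfl, rfl, rfl⟩ | ⟨rfl, rfl, rfl⟩ | ⟨rfl, rfl, rfl⟩)
    · exact hyx
    · exact H.ex_xy
    · exact hl
    · exact H.ex_by
  · exact fun p hp => Or.inr (hmin p hp)
  · exact fun p hp => Or.inr (H.lt_of_exDeg_target hxy hp)
  · intro s t h1 h2
    fin_cases s <;> fin_cases t <;> simp [backOb, backDeg] at h1 h2 ⊢ <;> omega
  · intro s t hst
    fin_cases s <;> fin_cases t <;> simp [backUp] at hst <;> simp [backOb, backDeg] <;> omega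
  · intro s t hst
    fin_cases s <;> fin_cases t <;> simp [backCov] at hst <;>
      simp [backUp, backOb, backDeg] <;> omega
  · intro s t hst
    rcases (show (backDeg l s = backDeg l t + (i + 2) ∧ (t = 3 ∨ t = 4)) ∨
        backDeg l s < backDeg l t + (i + 2) by
      fin_cases s <;> fin_cases t <;> simp [backUp] at hst <;> simp [backDeg] <;> omega) with
      ⟨h, rfl | rfl⟩ | h
    · exact Or.inr ⟨h, Or.inl hxy⟩
    · exact Or.inr ⟨h, Or.inl H.hby⟩
    · exact Or.inl h

/-- If `x ≠ y` has no nontrivial endomorphism of degree one and `G x` factors through `G b`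
only, the degree of the contour is at least two. -/
theorem pos_of_xb (H : Graded x y a b G I i) (hxx : ¬ ExDeg G x x 1) (hxb : ExDeg G x b 0) :
    1 ≤ i := by
  by_contra hi
  obtain rfl : i = 0 := by omega
  have hbb : ¬ ExDeg G b b 1 := by
    intro h
    obtain rfl := (H.princ b 0 1 hxb h le_rfl (by omega)).2
    exact hxx h
  obtain ⟨e, he⟩ := hxb
  obtain ⟨d, hd⟩ := H.exb
  obtain ⟨g, hg | hg⟩ := P.hom_cyclic x b
  · obtain ⟨j, rfl⟩ := hg e
    obtain ⟨k, rfl⟩ := hg d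
    obtain ⟨p, q, h0, hp, -⟩ := he.split H.Lx H.Lb
    obtain ⟨p', q', h1, hp', hq'⟩ := hd.split H.Lx H.Lb
    have := hp.uniq hp'
    exact hbb ⟨_, (show q' = 1 by omega) ▸ hq'⟩
  · obtain ⟨j, rfl⟩ := hg e
    obtain ⟨k, rfl⟩ := hg d
    obtain ⟨p, q, h0, -, hq⟩ := he.split H.Lx H.Lx
    obtain ⟨p', q', h1, hp', hq'⟩ := hd.split H.Lx H.Lx
    have := hq.uniq hq'
    exact hxx ⟨_, (show p' = 1 by omega) ▸ hp'⟩

/-- No graded situation exists. -/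
theorem elim (H : Graded x y a b G I i) : False := by
  by_cases hxy : x = y
  · subst hxy
    rcases Nat.eq_zero_or_pos i with rfl | hi
    · exact H.false_of_eq_zero
    · exact H.false_of_eq_pos hi
  by_cases hyx : ExDeg G y x 1
  · exact H.false_of_yx hxy hyx
  have hxa : x ≠ a := by
    rintro rfl
    exact hyx H.exa
  have nzy2 : ∀ m, m ≤ i + 2 → P.pipow y m ⊙ G y ≠ P.zero y y :=
    fun m hm => pow_ne_of_le hm H.nzy
  by_cases h0 : ExDeg G x a 0
  · by_cases hax : ExDeg G a x 1
    · exact H.false_of_xa_ax_one hxy hxa hyx h0 hax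
    by_cases hxx : ExDeg G x x 1
    · by_cases hax2 : ExDeg G a x 2
      · exact H.false_of_xa_xx_ax_two hxy hxa h0 hax hxx hax2
      · refine H.false_of_xa_xx hxy hxa hyx h0 (fun h => hax2 ?_) hax hax2 hxx
        have := H.ex_ay.comp h (pow_ne_of_le (by omega) (H.nza_of h0))
        rwa [Nat.zero_add] at this
    · by_cases hyx2 : ExDeg G y x 2
      · exact H.false_of_xa_yx_two hxy hxa hyx h0 hax hxx hyx2
      · exact H.false_of_xa hxy hxa hyx h0 hyx2 hax hxx
  · by_cases hxb : ExDeg G x b 0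
    · by_cases hxx : ExDeg G x x 1
      · by_cases hyx2 : ExDeg G y x 2
        · exact H.false_of_xx_yx_two hxy hyx hxx hyx2
        · refine H.false_of_xx hxy hxa hyx h0 hyx2 (fun h => hyx2 ?_) hxx
          exact H.exa.comp h (nzy2 _ (by omega))
      · have hi := H.pos_of_xb hxx hxb
        refine H.false_of_not_xx hxy hxa hyx h0 (fun h => ?_) hxx hi
        have h1 : ExDeg G a b 1 := by
          have := h.comp hxb (pow_ne_of_le (by omega) H.nza)
          rwa [Nat.add_zero] at this
        have h2 : ExDeg G x a i := by
          have h3 := (H.ex_target (c := x) (p := i - 1) (pow_ne_of_le (by omega) H.nzx)).comp H.exa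
            (pow_ne_of_le (by omega) H.nzx)
          rwa [Nat.sub_add_cancel hi] at h3
        exact hxa (H.princ a i 1 h2 h1 le_rfl rfl).2.symm
    · refine H.false_of_not_xb hxy hxa h0 (fun h => hxb ?_) hxb
      subst h
      exact ⟨_, hasDeg_id (right_ne_zero H.nzx)⟩

end Graded

end RayCategory

namespace RayCategory

variable {P : RayCategory} {x y a b : P.Obj}

/-- A nonzero morphism is not a proper multiple of itself. -/
theorem eq_zero_of_eq_pipow_comp {f : P.Hom x y} {k j : ℕ}
    (h : f = P.pipow y k ⊙ f ⊙ P.pipow x j) (h0 : f ≠ P.zero x y) : k = 0 ∧ j = 0 := by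
  have key : ∀ n : ℕ, f = P.pipow y (n * k) ⊙ f ⊙ P.pipow x (n * j) := by
    intro n
    induction n with
    | zero => rw [Nat.zero_mul, Nat.zero_mul, P.pipow_zero, P.pipow_zero, P.id_comp, P.comp_id]
    | succ n ih =>
      nth_rewrite 1 [ih]
      nth_rewrite 1 [h]
      rw [P.assoc, P.assoc, pipow_comp_pipow, ← P.assoc, pipow_comp_pipow, Nat.succ_mul,
        Nat.succ_mul, Nat.add_comm (n * j)]
  constructor
  · by_contra hk
    apply h0
    rw [key (P.nilp y), pipow_eq_zero (Nat.le_mul_of_pos_right _ (Nat.pos_of_ne_zero hk)),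
      P.zero_comp]
  · by_contra hj
    apply h0
    rw [key (P.nilp x),
      pipow_eq_zero (x := x) (Nat.le_mul_of_pos_right _ (Nat.pos_of_ne_zero hj)),
      P.comp_zero, P.comp_zero]

/-- A transit morphism generates its bimodule from the left. -/
theorem IsTransit.exists_comp_pi {f : P.Hom x y} (h : P.IsTransit f) :
    ∃ e, f ⊙ P.pi x = P.pipow y e ⊙ f := by
  obtain ⟨h0, g, ⟨i, j, hg⟩, hgen⟩ := h
  obtain ⟨k, hk⟩ := hgen f ⟨0, 0, by rw [P.pipow_zero, P.pipow_zero, P.id_comp, P.comp_id]⟩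
  have h1 := hk
  rw [hg, pipow_comp_pipow_comp] at h1
  obtain ⟨h2, rfl⟩ := eq_zero_of_eq_pipow_comp h1 h0
  obtain rfl : k = 0 := by omega
  rw [P.pipow_zero, P.id_comp] at hk
  rw [hk]
  exact hgen _ ⟨0, 1, by rw [P.pipow_zero, P.id_comp, hk]; rfl⟩

theorem IsCotransit.exists_pi_comp {f : P.Hom x y} (h : P.IsCotransit f) :
    ∃ e, P.pi y ⊙ f = f ⊙ P.pipow x e := by
  obtain ⟨h0, g, ⟨i, j, hg⟩, hgen⟩ := h
  obtain ⟨k, hk⟩ := hgen f ⟨0, 0, by rw [P.pipow_zero, P.pipow_zero, P.id_comp, P.comp_id]⟩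
  have h1 := hk
  rw [hg, P.assoc, P.assoc, pipow_comp_pipow] at h1
  obtain ⟨rfl, h2⟩ := eq_zero_of_eq_pipow_comp h1 h0
  obtain rfl : k = 0 := by omega
  rw [P.pipow_zero, P.comp_id] at hk
  rw [hk]
  exact hgen _ ⟨1, 0, by rw [P.pipow_zero, P.comp_id, hk]; rfl⟩

/-- A morphism which is transit and cotransit but not deep commutes with `π`. -/
theorem comp_pi_eq {f : P.Hom x y} {d e : ℕ} (he : f ⊙ P.pi x = P.pipow y e ⊙ f)
    (hd : P.pi y ⊙ f = f ⊙ P.pipow x d) (h0 : P.pi y ⊙ f ≠ P.zero x y) :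
    f ⊙ P.pi x = P.pi y ⊙ f := by
  have key : ∀ n : ℕ, f ⊙ P.pipow x n = P.pipow y (n * e) ⊙ f := by
    intro n
    induction n with
    | zero => rw [Nat.zero_mul, P.pipow_zero, P.pipow_zero, P.id_comp, P.comp_id]
    | succ n ih =>
      rw [pipow_add, ← P.assoc, ih, P.assoc, ← pi_def, he, pipow_comp_pipow_comp, Nat.succ_mul]
  rw [key, pi_def] at hd
  have h1 : 1 = d * e := pipow_comp_inj hd h0
  obtain rfl : e = 1 := Nat.eq_one_of_mul_eq_one_left h1.symm
  exact he

theorem pi_comp_ne_zero {f : P.Hom x y} {e : ℕ} (h0 : f ≠ P.zero x y) (hd : ¬ P.IsDeep f)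
    (he : f ⊙ P.pi x = P.pipow y e ⊙ f) : P.pi y ⊙ f ≠ P.zero x y := by
  intro h1
  match e with
  | 0 =>
    rw [P.pipow_zero, P.id_comp] at he
    have h2 : P.pi x ≠ P.zero x x := right_ne_zero (g := f) (by rwa [he])
    exact not_isId_pi h2 (isId_endo.2 (isId_of_comp_eq_self_right he h0))
  | e + 1 =>
    refine hd ⟨h0, h1, ?_⟩
    rw [he, pipow_add, P.assoc, ← pi_def, h1, P.comp_zero]

/-- Identities are not in the ideal generated by a multiple of `π²`. -/
theorem id_ne_comp_pipow_two {c : P.Obj} {xi : P.Hom x y} {g : P.Hom y c} {e : P.Hom c x}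
    (h0 : P.pipow y 2 ≠ P.zero y y) : P.id c ≠ g ⊙ P.pipow y 2 ⊙ xi ⊙ e := by
  intro h
  have h1 := isId_id c
  rw [h, isId_comp_iff, isId_comp_iff, isId_endo, ← P.pipow_zero] at h1
  exact absurd (pipow_inj h1.1.2 h0) (by norm_num)

/-- Irreducible morphisms are not in the ideal generated by a multiple of `π²`. -/
theorem IsIrreducible.ne_comp_pipow_two {c d : P.Obj} {f : P.Hom d c} (hf : P.IsIrreducible f)
    {xi : P.Hom x y} {g : P.Hom y c} {e : P.Hom d x}
    (h0 : P.pipow y 2 ≠ P.zero y y) : f ≠ g ⊙ P.pipow y 2 ⊙ xi ⊙ e := by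
  intro h
  have hpi : ¬ P.IsId (P.pi y) := not_isId_pi (pipow_ne_zero_of_le (by norm_num) h0)
  have h2 : P.pipow y 2 = P.pi y ⊙ P.pi y := pipow_add y 1 1
  rw [h2] at h
  rcases hf.2.2 _ _ _ (h.trans (by simp only [P.assoc] :
    _ = (g ⊙ P.pi y) ⊙ P.pi y ⊙ xi ⊙ e)) with h1 | h1
  · exact hpi (isId_comp_iff.1 h1).1
  · exact hpi (isId_comp_iff.1 h1).2

end RayCategory

namespace Contour

variable {P : RayCategory} {x y : P.Obj}

/-- The two final arrows of a contour have different sources. -/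
theorem ne_of_cons (C : Contour P x y) {a b : P.Obj} {alp : P.Hom a y}
    {halp : P.IsIrreducible alp} {p : RPath P x a} (hv : C.v = RPath.cons alp halp p)
    {bet : P.Hom b y} {hbet : P.IsIrreducible bet} {q : RPath P x b}
    (hw : C.w = RPath.cons bet hbet q) (hay : a ≠ y) : a ≠ b := by
  rintro rfl
  have hab : alp = bet := by
    obtain ⟨g, hg | hg⟩ := P.hom_cyclic a y
    · obtain ⟨i, hi⟩ := hg alp
      obtain ⟨j, hj⟩ := hg bet
      rw [RayCategory.eq_of_irred_left halp hay hi, RayCategory.eq_of_irred_left hbet hay hj]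
    · obtain ⟨i, hi⟩ := hg alp
      obtain ⟨j, hj⟩ := hg bet
      rw [RayCategory.eq_of_irred_right halp hay hi, RayCategory.eq_of_irred_right hbet hay hj]
  subst hab
  have he := C.hom_eq
  have h0 := C.nz
  rw [hv] at he h0
  rw [hw] at he
  simp only [RPath.toHom] at he h0
  have hpq := RayCategory.cancel_left he h0
  refine C.nint (Relation.TransGen.single
    ⟨x, a, RPath.cons alp halp (RPath.nil a), p, q, RPath.nil x, ?_, ?_, hpq, ?_, ?_⟩)
  · simp only [RPath.append_nil, hv, RPath.append]
  · simp only [RPath.append_nil, hw, RPath.append]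
  · exact RayCategory.right_ne_zero h0
  · intro h
    simp only [RPath.length] at h
    omega

/-- In a mild contour with `v⃗` transit, small decisive subcategories of `P/π(y)v⃗` are
representation-finite. -/
theorem Mild.repFin {C : Contour P x y} (hM : C.Mild) {e : ℕ}
    (he : C.v.toHom ⊙ P.pi x = P.pipow y e ⊙ C.v.toHom)
    (h0 : P.pi y ⊙ C.v.toHom ≠ P.zero x y) {D : Set P.Obj} (hD : C.DecisiveT D)
    (hf : D.Finite) (hc : D.ncard ≤ 4) : RepFin P D C.It := by
  rcases hM with h | h
  · exact h.2.2 D hD hf hc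
  · obtain ⟨d, hd⟩ := RayCategory.IsCotransit.exists_pi_comp h.2.1
    have hI : C.Ic = C.It := by
      rw [Ic, It, RayCategory.comp_pi_eq he hd h0]
    have h2 := h.2.2 D
    rw [DecisiveC, hI] at h2
    exact h2 hD hf hc

theorem Mild.nonDeep {C : Contour P x y} (hM : C.Mild) : ¬ P.IsDeep C.v.toHom :=
  hM.elim (fun h => h.1) (fun h => h.1)

theorem Mild.setup {C : Contour P x y} (hM : C.Mild) (hT : P.IsTransit C.v.toHom)
    {a b : P.Obj} {alp : P.Hom a y} {halp : P.IsIrreducible alp} {p : RPath P x a}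
    (hv : C.v = RPath.cons alp halp p)
    {bet : P.Hom b y} {hbet : P.IsIrreducible bet} {q : RPath P x b}
    (hw : C.w = RPath.cons bet hbet q)
    {om : P.Hom y a} (hom : P.pi y = P.comp alp om) (hnid : ¬ P.IsId om)
    {xi : P.Hom x y} (hxi : p.toHom = P.comp om xi) :
    RayCategory.Setup alp bet om xi q.toHom C.It := by
  have hV : C.v.toHom = P.pi y ⊙ xi := by
    rw [hv, RPath.toHom, hxi, hom, P.assoc]
  have hV' : C.v.toHom = bet ⊙ q.toHom := by
    rw [C.hom_eq, hw, RPath.toHom]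
  have hVp : C.v.toHom = alp ⊙ p.toHom := by rw [hv, RPath.toHom]
  obtain ⟨e, he⟩ := RayCategory.IsTransit.exists_comp_pi hT
  have h0 := RayCategory.pi_comp_ne_zero C.nz hM.nonDeep he
  have hsq : P.pi y ⊙ C.v.toHom = P.pipow y 2 ⊙ xi := by
    rw [hV, RayCategory.pi_def, RayCategory.pipow_comp_pipow_comp]
  have hnz : P.pipow y 2 ⊙ xi ≠ P.zero x y := hsq ▸ h0
  have h2 : P.pipow y 2 ≠ P.zero y y := RayCategory.left_ne_zero hnz
  have hpi : P.pi y ≠ P.zero y y := RayCategory.left_ne_zero h0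
  have hay : a ≠ y := by
    rintro rfl
    have h := hom.symm
    rw [RayCategory.IsIrreducible.eq_pi halp] at h
    exact hnid (RayCategory.isId_endo.2 (RayCategory.isId_of_comp_eq_self_right h hpi))
  have hI : ∀ (s t : P.Obj) (f : P.Hom s t), C.It s t f →
      ∃ (g : P.Hom y t) (e : P.Hom s x), f = g ⊙ P.pipow y 2 ⊙ xi ⊙ e := by
    rintro s t f ⟨g, h, rfl⟩
    exact ⟨g, h, by rw [hsq, P.assoc]⟩
  have hid : ∀ c, ¬ C.It c c (P.id c) := fun c h => by
    obtain ⟨g, e, h⟩ := hI _ _ _ h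
    exact RayCategory.id_ne_comp_pipow_two h2 h
  have hirr : ∀ {c d : P.Obj} {f : P.Hom d c}, P.IsIrreducible f → ¬ C.It d c f := by
    intro c d f hf h
    obtain ⟨g, e, h⟩ := hI _ _ _ h
    exact hf.ne_comp_pipow_two h2 h
  refine
    { halp := halp
      hbet := hbet
      hab := C.ne_of_cons hv hw hay
      hom := hom.symm
      hnid := hnid
      heq := hV.symm.trans hV'
      nz := hnz
      tr := ⟨e, by rw [← hV]; exact he⟩
      princ := ?_
      hI1 := ?_
      hI2 := ?_
      hI := hI
      rf := ?_ }
  · intro c F G G' hq hG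
    by_contra hF
    apply C.nint
    rw [hv, hw]
    exact RPath.interlaced_of_comp halp hbet p q (hVp ▸ C.nz) (hVp.symm.trans hV') hF G G' hq hG
  · rintro s t c g f ⟨g', h, rfl⟩
    exact ⟨g ⊙ g', h, by simp only [P.assoc]⟩
  · rintro s t c g f ⟨g', h, rfl⟩
    exact ⟨g', h ⊙ f, by simp only [P.assoc]⟩
  · refine hM.repFin he h0 ⟨by simp, by simp, ?_⟩ (Set.toFinite _) ?_
    · rintro c (rfl | rfl | rfl | rfl)
      · exact Or.inl ⟨P.id c, RayCategory.id_ne_zero c, hid c⟩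
      · exact Or.inr ⟨P.id c, RayCategory.id_ne_zero c, hid c⟩
      · exact Or.inr ⟨alp, halp.1, hirr halp⟩
      · exact Or.inr ⟨bet, hbet.1, hirr hbet⟩
    · classical
      have : ({x, y, a, b} : Set P.Obj) = (({x, y, a, b} : Finset P.Obj) : Set P.Obj) := by simp
      rw [this, Set.ncard_coe_finset]
      exact Finset.card_le_four

end Contour

/-- **Lemma 2.5.** Let `C = {v,w}` be a mild contour from `x` to `y` with `v⃗` transit,
`α = v⃗_1`, `γ = v⃗_2⋯v⃗_n` and `ρ = π(y) = αω` where `ω` is not an identity.  Then the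
case `γ = ωξ` is impossible. -/
theorem mild_contour_no_factor_gamma (P : RayCategory) {x y : P.Obj} (C : Contour P x y)
    (hM : C.Mild) (hT : P.IsTransit C.v.toHom)
    {a1 b1 : P.Obj} (alp : P.Hom a1 y) (halp : P.IsIrreducible alp) (p : RPath P x a1)
    (hv : C.v = RPath.cons alp halp p)
    (bet : P.Hom b1 y) (hbet : P.IsIrreducible bet) (q : RPath P x b1)
    (hw : C.w = RPath.cons bet hbet q)
    (om : P.Hom y a1) (hom : P.pi y = P.comp alp om) (hnid : ¬ P.IsId om) :
    ¬ ∃ ξ : P.Hom x y, p.toHom = P.comp om ξ := by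
  rintro ⟨xi, hxi⟩
  obtain ⟨G, i, H⟩ := (hM.setup hT hv hw hom hnid hxi).exists_graded
  exact H.elim
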